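/- Let p_i, p_j, p_k be distinct odd primes and M = p_i^2 p_j^2 p_k^2. Assume A ⊕ B = ℤ_M with |A| = |B| = p_i p_j p_k, that Φ_M | A, and that there exists a D(M)-grid Λ such that A ∩ Λ is nonempty and A ∩ Λ is not M-fibered in any of the three directions p_i, p_j, p_k. Then Λ ⊕ B = ℤ_M is also a tiling, and both A and B satisfy (T2). -/

import Mathlib

open Polynomial

/-- The mask polynomial `A(X) = Σ_{a ∈ A} X^a` of a finite subset of `ZMod M`,
using the representatives in `{0, …, M-1}`. -/
noncomputable def maskPoly (M : ℕ) (A : Finset (ZMod M)) : Polynomial ℤ :=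
  ∑ a ∈ A, X ^ a.val

/-- `Φ_s | A` : the `s`-th cyclotomic polynomial divides the mask polynomial of `A` in `ℤ[X]`. -/
def cycDvd (M s : ℕ) (A : Finset (ZMod M)) : Prop :=
  cyclotomic s ℤ ∣ maskPoly M A

/-- `A ⊕ B = ℤ_M` : every element of `ℤ_M` has a unique representation `a + b`
with `a ∈ A` and `b ∈ B`. -/
def IsTiling (M : ℕ) (A B : Set (ZMod M)) : Prop :=
  ∀ z : ZMod M, ∃! ab : ZMod M × ZMod M, ab.1 ∈ A ∧ ab.2 ∈ B ∧ ab.1 + ab.2 = z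

/-- The Coven–Meyerowitz property (T2): whenever `s_1, …, s_m` are prime powers dividing `M`,
powers of pairwise distinct primes, with `Φ_{s_t} | A` for each `t`, then `Φ_{s_1 ⋯ s_m} | A`. -/
def SatisfiesT2 (M : ℕ) (A : Finset (ZMod M)) : Prop :=
  ∀ (P : Finset ℕ) (e : ℕ → ℕ), P.Nonempty →
    (∀ p ∈ P, p.Prime ∧ 1 ≤ e p ∧ p ^ e p ∣ M ∧ cycDvd M (p ^ e p) A) →
    cycDvd M (∏ p ∈ P, p ^ e p) A

/-- The `D`-grid through `x` in `ZMod M` : `Λ(x, D) = {y : D ∣ y - x}`. -/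
def gridSet (M : ℕ) (x : ZMod M) (D : ℕ) : Set (ZMod M) :=
  {y : ZMod M | (D : ZMod M) ∣ (y - x)}

/-- `S` is fibered in the `p` direction on scale `M`: every element of `S` has its whole
fiber `Λ(s, M/p)` contained in `S`. -/
def Fibered (M p : ℕ) (S : Set (ZMod M)) : Prop :=
  ∀ s ∈ S, gridSet M s (M / p) ⊆ S

/-- `Div_N(S)` : the set of values `(s - s', N) = gcd(s - s', N)` for `s, s' ∈ S`. -/
def DivSet (M N : ℕ) (S : Set (ZMod M)) : Set ℕ :=
  {m : ℕ | ∃ s ∈ S, ∃ s' ∈ S, Nat.gcd (s - s').val N = m}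


section
open Finset

/-- Relative valuation of two points of one coordinate. -/
def vv {X : Type} [DecidableEq X] (l : X → ℕ) (x x' : X) : ℕ :=
  if x = x' then 2 else if l x = l x' then 1 else 0

/-- Test functions of level `e` on one coordinate. -/
def Vt {X : Type} [Fintype X] (l : X → ℕ) : ℕ → (X → ℚ) → Prop
  | 0, f => ∃ c, ∀ x, f x = c
  | 1, f => (∀ x x', l x = l x' → f x = f x') ∧ ∑ x, f x = 0
  | _, f => ∀ x, (∑ x' with l x' = l x, f x') = 0

/-- One coordinate: `p ^ 2` points in classes of size `p`. -/
structure Coord (X : Type) [Fintype X] (l : X → ℕ) (p : ℕ) : Prop where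
  prime : p.Prime
  three : 3 ≤ p
  card : Fintype.card X = p ^ 2
  fib : ∀ x, (univ.filter (fun x' => l x' = l x)).card = p

def Cub {X Y Z : Type} [Fintype X] [Fintype Y] [Fintype Z]
    (lx : X → ℕ) (ly : Y → ℕ) (lz : Z → ℕ) (e1 e2 e3 : ℕ) (T : Finset (X × Y × Z)) : Prop :=
  ∀ f g h, Vt lx e1 f → Vt ly e2 g → Vt lz e3 h →
    ∑ t ∈ T, f t.1 * g t.2.1 * h t.2.2 = 0

structure Tile {X Y Z : Type} [Fintype X] [Fintype Y] [Fintype Z]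
    (lx : X → ℕ) (ly : Y → ℕ) (lz : Z → ℕ) (p q r : ℕ) (A B : Finset (X × Y × Z)) : Prop where
  cx : Coord X lx p
  cy : Coord Y ly q
  cz : Coord Z lz r
  hpq : p ≠ q
  hpr : p ≠ r
  hqr : q ≠ r
  cardA : A.card = p * q * r
  cardB : B.card = p * q * r
  dich : ∀ e1 e2 e3, e1 ≤ 2 → e2 ≤ 2 → e3 ≤ 2 → e1 + e2 + e3 ≠ 0 →
    Cub lx ly lz e1 e2 e3 A ∨ Cub lx ly lz e1 e2 e3 B

/-- number of points of `T` at relative valuation `(i,j,k)` from `Q` -/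
def Nn {X Y Z : Type} [DecidableEq X] [DecidableEq Y] [DecidableEq Z]
    (lx : X → ℕ) (ly : Y → ℕ) (lz : Z → ℕ) (T : Finset (X × Y × Z)) (i j k : ℕ)
    (Q : X × Y × Z) : ℕ :=
  (T.filter (fun t => vv lx Q.1 t.1 = i ∧ vv ly Q.2.1 t.2.1 = j ∧ vv lz Q.2.2 t.2.2 = k)).card

def ww (p i : ℕ) : ℚ := if i = 0 then (p:ℚ) ^ 2 - p else if i = 1 then (p:ℚ) - 1 else 1

def EE {X : Type} [DecidableEq X] (l : X → ℕ) (p : ℕ) (e : ℕ) (x x' : X) : ℚ :=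
  if e = 0 then 1 / (p:ℚ) ^ 2
  else if e = 1 then (if l x = l x' then 1 / (p:ℚ) else 0) - 1 / (p:ℚ) ^ 2
  else (if x = x' then 1 else 0) - (if l x = l x' then 1 / (p:ℚ) else 0)

def aa (p e : ℕ) : ℚ :=
  if e = 0 then (p:ℚ) ^ 2 else if e = 1 then (p:ℚ) ^ 2 / (p - 1) else (p:ℚ) ^ 2 / ((p:ℚ) ^ 2 - p)

lemma vv_le {X : Type} [DecidableEq X] (l : X → ℕ) (x x' : X) : vv l x x' ≤ 2 := by
  unfold vv; split_ifs <;> omega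

lemma vv_two {X : Type} [DecidableEq X] {l : X → ℕ} {x x' : X} : vv l x x' = 2 ↔ x = x' := by
  unfold vv; split_ifs <;> simp_all

lemma vv_one {X : Type} [DecidableEq X] {l : X → ℕ} {x x' : X} :
    vv l x x' = 1 ↔ x ≠ x' ∧ l x = l x' := by
  unfold vv; split_ifs <;> simp_all

lemma vv_zero {X : Type} [DecidableEq X] {l : X → ℕ} {x x' : X} :
    vv l x x' = 0 ↔ l x ≠ l x' := by
  unfold vv; split_ifs <;> simp_all

lemma ww_pos {p : ℕ} (hp : 3 ≤ p) (i : ℕ) : 0 < ww p i := by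
  have : (3:ℚ) ≤ p := by exact_mod_cast hp
  unfold ww; split_ifs <;> nlinarith

lemma kernel_id {X : Type} [DecidableEq X] (l : X → ℕ) {p : ℕ} (hp : 3 ≤ p) (x a b b' : X) :
    ∑ i ∈ range 3, (if vv l x a = i then (1:ℚ) else 0) * ((if vv l b b' = i then 1 else 0) / ww p i)
      = ∑ e ∈ range 3, EE l p e x a * (aa p e * EE l p e b b') := by
  have h3 : (3:ℚ) ≤ p := by exact_mod_cast hp
  have h0 : (p:ℚ) ≠ 0 := by linarith
  have h1 : (p:ℚ) - 1 ≠ 0 := by intro h; linarith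
  have h2 : (p:ℚ)^2 - p ≠ 0 := by intro h; nlinarith
  simp only [sum_range_succ, sum_range_zero, vv, EE, aa, ww]
  have e2 : (p:ℚ)^2 - p = p * (p - 1) := by ring
  by_cases hxa : x = a <;> by_cases hbb : b = b' <;> by_cases hl : l x = l a <;>
    by_cases hl' : l b = l b' <;> simp_all <;> field_simp <;> ring

lemma EE_Vt {X : Type} [Fintype X] [DecidableEq X] {l : X → ℕ} {p : ℕ} (c : Coord X l p) (x : X)
    (e : ℕ) (he : e ≤ 2) : Vt l e (EE l p e x) := by
  have h3 : (3:ℚ) ≤ p := by exact_mod_cast c.three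
  have h0 : (p:ℚ) ≠ 0 := by linarith
  interval_cases e
  · exact ⟨1 / (p:ℚ) ^ 2, fun y => by simp [EE]⟩
  · refine ⟨fun y y' h => by simp [EE, h], ?_⟩
    have h := c.fib x
    simp only [EE]
    simp only [one_ne_zero, if_false, if_true, sum_sub_distrib, sum_const, card_univ, c.card]
    rw [← sum_filter]
    simp only [eq_comm (a := l x), sum_const, h]
    simp; field_simp; simp
  · intro y
    simp only [EE]
    norm_num
    by_cases hy : l y = l x
    · have h := c.fib x
      rw [hy, sum_congr rfl (g := fun _ => (p:ℚ)⁻¹), sum_const, h]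
      · simp [h0]
      · intro z hz; simp at hz; simp [hz]
    · rw [sum_eq_zero, if_neg (by tauto)]
      · simp
      · intro z hz; simp at hz; rw [if_neg]; intro h; exact hy (by rw [← hz, ← h])

lemma expand3 {α β : Type} (S : Finset α) (T : Finset β) (I : Finset ℕ)
    (P R U : ℕ → α → ℚ) (P' R' U' : ℕ → β → ℚ) :
    ∑ a ∈ S, ∑ b ∈ T, (∑ i ∈ I, P i a * P' i b) * (∑ j ∈ I, R j a * R' j b) *
      (∑ k ∈ I, U k a * U' k b) =
    ∑ i ∈ I, ∑ j ∈ I, ∑ k ∈ I, (∑ a ∈ S, P i a * R j a * U k a) *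
      (∑ b ∈ T, P' i b * R' j b * U' k b) := by
  have h1 : ∀ a b, (∑ i ∈ I, P i a * P' i b) * (∑ j ∈ I, R j a * R' j b) *
      (∑ k ∈ I, U k a * U' k b) = ∑ i ∈ I, ∑ j ∈ I, ∑ k ∈ I,
        (P i a * R j a * U k a) * (P' i b * R' j b * U' k b) := by
    intro a b
    rw [Finset.sum_mul_sum, Finset.sum_mul]
    refine sum_congr rfl fun i _ => ?_
    rw [Finset.sum_mul]
    refine sum_congr rfl fun j _ => ?_
    rw [Finset.mul_sum]
    refine sum_congr rfl fun k _ => by ring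
  simp_rw [h1, Finset.sum_mul_sum]
  have h2 : ∀ (F : α → β → ℕ → ℚ), ∑ a ∈ S, ∑ b ∈ T, ∑ i ∈ I, F a b i =
      ∑ i ∈ I, ∑ a ∈ S, ∑ b ∈ T, F a b i := by
    intro F
    rw [Finset.sum_comm (s := I)]
    refine sum_congr rfl fun a _ => Finset.sum_comm
  rw [h2]
  refine sum_congr rfl fun i _ => ?_
  rw [h2]
  refine sum_congr rfl fun j _ => ?_
  rw [h2]

section
variable {X Y Z : Type} [Fintype X] [Fintype Y] [Fintype Z]
  [DecidableEq X] [DecidableEq Y] [DecidableEq Z]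
  {lx : X → ℕ} {ly : Y → ℕ} {lz : Z → ℕ} {p q r : ℕ} {A B : Finset (X × Y × Z)}

lemma Tile.sat (H : Tile lx ly lz p q r A B) (Q b : X × Y × Z) :
    ∑ i ∈ range 3, ∑ j ∈ range 3, ∑ k ∈ range 3,
      (Nn lx ly lz A i j k Q : ℚ) * Nn lx ly lz B i j k b / (ww p i * ww q j * ww r k) = 1 := by
  have key : ∑ i ∈ range 3, ∑ j ∈ range 3, ∑ k ∈ range 3,
      (Nn lx ly lz A i j k Q : ℚ) * Nn lx ly lz B i j k b / (ww p i * ww q j * ww r k) =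
      ∑ i ∈ range 3, ∑ j ∈ range 3, ∑ k ∈ range 3,
       (∑ a ∈ A, EE lx p i Q.1 a.1 * EE ly q j Q.2.1 a.2.1 * EE lz r k Q.2.2 a.2.2) *
       (∑ a ∈ B, (aa p i * EE lx p i b.1 a.1) * (aa q j * EE ly q j b.2.1 a.2.1) *
         (aa r k * EE lz r k b.2.2 a.2.2)) := by
    rw [← expand3 A B (range 3) (fun i a => EE lx p i Q.1 a.1) (fun i a => EE ly q i Q.2.1 a.2.1)
      (fun i a => EE lz r i Q.2.2 a.2.2) (fun i a => aa p i * EE lx p i b.1 a.1)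
      (fun i a => aa q i * EE ly q i b.2.1 a.2.1) (fun i a => aa r i * EE lz r i b.2.2 a.2.2)]
    simp_rw [← kernel_id lx H.cx.three, ← kernel_id ly H.cy.three, ← kernel_id lz H.cz.three]
    rw [expand3 A B (range 3) (fun i a => if vv lx Q.1 a.1 = i then (1:ℚ) else 0)
      (fun i a => if vv ly Q.2.1 a.2.1 = i then (1:ℚ) else 0)
      (fun i a => if vv lz Q.2.2 a.2.2 = i then (1:ℚ) else 0)
      (fun i a => (if vv lx b.1 a.1 = i then (1:ℚ) else 0) / ww p i)
      (fun i a => (if vv ly b.2.1 a.2.1 = i then (1:ℚ) else 0) / ww q i)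
      (fun i a => (if vv lz b.2.2 a.2.2 = i then (1:ℚ) else 0) / ww r i)]
    refine sum_congr rfl fun i _ => sum_congr rfl fun j _ => sum_congr rfl fun k _ => ?_
    have e1 : (∑ a ∈ A, ((if vv lx Q.1 a.1 = i then (1:ℚ) else 0) *
      (if vv ly Q.2.1 a.2.1 = j then (1:ℚ) else 0)) *
      (if vv lz Q.2.2 a.2.2 = k then (1:ℚ) else 0)) = Nn lx ly lz A i j k Q := by
      unfold Nn
      rw [card_filter]
      push_cast
      refine sum_congr rfl fun a _ => ?_
      split_ifs <;> simp_all
    have e2 : (∑ a ∈ B, ((if vv lx b.1 a.1 = i then (1:ℚ) else 0) / ww p i *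
      ((if vv ly b.2.1 a.2.1 = j then (1:ℚ) else 0) / ww q j)) *
      ((if vv lz b.2.2 a.2.2 = k then (1:ℚ) else 0) / ww r k)) =
        Nn lx ly lz B i j k b / (ww p i * ww q j * ww r k) := by
      unfold Nn
      rw [card_filter]
      push_cast
      rw [sum_div]
      refine sum_congr rfl fun a _ => ?_
      split_ifs <;> simp_all <;> field_simp
    rw [e1, e2, mul_div_assoc]
  rw [key]
  have h3 : (3:ℚ) ≤ p := by exact_mod_cast H.cx.three
  have h4 : (3:ℚ) ≤ q := by exact_mod_cast H.cy.three
  have h5 : (3:ℚ) ≤ r := by exact_mod_cast H.cz.three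
  have van : ∀ i j k, i ≤ 2 → j ≤ 2 → k ≤ 2 → i + j + k ≠ 0 →
       (∑ a ∈ A, EE lx p i Q.1 a.1 * EE ly q j Q.2.1 a.2.1 * EE lz r k Q.2.2 a.2.2) *
       (∑ a ∈ B, (aa p i * EE lx p i b.1 a.1) * (aa q j * EE ly q j b.2.1 a.2.1) *
         (aa r k * EE lz r k b.2.2 a.2.2)) = 0 := by
    intro i j k hi hj hk h
    rcases H.dich i j k hi hj hk h with h | h
    · rw [h _ _ _ (EE_Vt H.cx Q.1 i hi) (EE_Vt H.cy Q.2.1 j hj) (EE_Vt H.cz Q.2.2 k hk), zero_mul]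
    · have := h _ _ _ (EE_Vt H.cx b.1 i hi) (EE_Vt H.cy b.2.1 j hj) (EE_Vt H.cz b.2.2 k hk)
      have e : (∑ a ∈ B, (aa p i * EE lx p i b.1 a.1) * (aa q j * EE ly q j b.2.1 a.2.1) *
         (aa r k * EE lz r k b.2.2 a.2.2)) = aa p i * aa q j * aa r k *
           ∑ a ∈ B, EE lx p i b.1 a.1 * EE ly q j b.2.1 a.2.1 * EE lz r k b.2.2 a.2.2 := by
        rw [mul_sum]; refine sum_congr rfl fun a _ => by ring
      rw [e, this]; simp
  rw [sum_eq_single 0, sum_eq_single 0, sum_eq_single 0]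
  · simp only [EE, aa, if_true, sum_const, H.cardA, H.cardB]
    simp only [nsmul_eq_mul]; push_cast; field_simp
  · intro k hk hk0; exact van 0 0 k (by simp) (by simp) (by simp at hk; omega) (by omega)
  · simp
  · intro j hj hj0; exact sum_eq_zero fun k hk => van 0 j k (by simp) (by simp at hj; omega) (by simp at hk; omega) (by omega)
  · simp
  · intro i hi hi0; exact sum_eq_zero fun j hj => sum_eq_zero fun k hk => van i j k (by simp at hi; omega) (by simp at hj; omega) (by simp at hk; omega) (by omega)
  · simp

end

end


section
open Finset

/-- A 0/1 function on a box satisfying the cube relations, unfibered in all directions. -/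
structure UF {U V W : Type} (f : U → V → W → ℤ) : Prop where
  zo : ∀ u v w, f u v w = 0 ∨ f u v w = 1
  cube : ∀ u u' v v' w w', f u v w - f u' v w - f u v' w + f u' v' w
    - f u v w' + f u' v w' + f u v' w' - f u' v' w' = 0
  tu : ∀ u u' : U, ∃ t, t ≠ u ∧ t ≠ u'
  tv : ∀ u u' : V, ∃ t, t ≠ u ∧ t ≠ u'
  tw : ∀ u u' : W, ∃ t, t ≠ u ∧ t ≠ u'
  nx : ∃ u u' v w, f u v w = 1 ∧ f u' v w = 0
  ny : ∃ u v v' w, f u v w = 1 ∧ f u v' w = 0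
  nz : ∃ u v w w', f u v w = 1 ∧ f u v w' = 0

section
variable {U V W : Type} {f : U → V → W → ℤ}

lemma UF.sw12 (h : UF f) : UF (fun v u w => f u v w) where
  zo v u w := h.zo u v w
  cube v v' u u' w w' := by have := h.cube u u' v v' w w'; linarith
  tu := h.tv
  tv := h.tu
  tw := h.tw
  nx := by obtain ⟨u, v, v', w, h⟩ := h.ny; exact ⟨v, v', u, w, h⟩
  ny := by obtain ⟨u, u1, v, w, h⟩ := h.nx; exact ⟨v, u, u1, w, h⟩
  nz := by obtain ⟨u, v, v', w, h⟩ := h.nz; exact ⟨v, u, _, _, h⟩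

lemma UF.sw23 (h : UF f) : UF (fun u w v => f u v w) where
  zo u w v := h.zo u v w
  cube u u' w w' v v' := by have := h.cube u u' v v' w w'; linarith
  tu := h.tu
  tv := h.tw
  tw := h.tv
  nx := by obtain ⟨u, u', v, w, h⟩ := h.nx; exact ⟨u, u', w, v, h⟩
  ny := by obtain ⟨u, v, w, w', h⟩ := h.nz; exact ⟨u, w, w', v, h⟩
  nz := by obtain ⟨u, v, v', w, h⟩ := h.ny; exact ⟨u, w, v, v', h⟩

lemma UF.T1aux (h : UF f) (no : ∀ u u' v w, f u v w = 1 → f u' v w = 1 → u = u')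
    {x y y' z} (h1 : f x y z = 1) (h0 : f x y' z = 0) (w : W) : f x y w = 1 := by
  by_contra hw
  have hw0 := (h.zo x y w).resolve_right hw
  have key : ∀ x', x' ≠ x → f x' y' w = 1 := by
    intro x' hx
    have c := h.cube x x' y y' z w
    have a1 : f x' y z = 0 := (h.zo x' y z).resolve_right fun hh => hx (no _ _ _ _ hh h1)
    rcases h.zo x' y' z with h2 | h2 <;> rcases h.zo x' y' w with h3 | h3 <;>
      rcases h.zo x y' w with h4 | h4 <;> rcases h.zo x' y w with h5 | h5 <;> omega
  obtain ⟨t, ht, -⟩ := h.tu x x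
  obtain ⟨t', ht', ht2⟩ := h.tu x t
  exact ht2 (no _ _ _ _ (key t' ht') (key t ht))

lemma UF.T1 (h : UF f) : ∃ u u' v w, u ≠ u' ∧ f u v w = 1 ∧ f u' v w = 1 := by
  by_contra hno
  push Not at hno
  have no : ∀ u u' v w, f u v w = 1 → f u' v w = 1 → u = u' := by
    intro u u' v w h1 h2
    by_contra hh
    exact hno u u' v w hh h1 h2
  obtain ⟨x, y, y', z, h1, h0⟩ := h.ny
  obtain ⟨x2, y2, z2, z2', h3, h4⟩ := h.nz
  have l1 := h.T1aux no h1 h0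
  have l2 := h.sw23.T1aux (fun u u' v w => no u u' w v) h3 h4
  have e : x = x2 := no _ _ _ _ (l1 z2) (l2 y)
  subst e
  obtain ⟨t, ht, -⟩ := h.tu x x
  have c := h.cube x t y y' z z2
  have a1 : f t y z = 0 := (h.zo t y z).resolve_right fun hh => ht (no _ _ _ _ hh h1)
  have a2 : f t y z2 = 0 := (h.zo t y z2).resolve_right fun hh => ht (no _ _ _ _ hh (l1 z2))
  have a3 : f t y' z2 = 0 := (h.zo t y' z2).resolve_right fun hh => ht (no _ _ _ _ hh (l2 y'))
  have := l1 z2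
  have := l2 y'
  rcases h.zo t y' z with h2 | h2 <;> omega

lemma UF.T123aux (h : UF f)
    (no : ∀ u u' v v' w w', f u v w = 1 → f u' v' w' = 1 → u = u' ∨ v = v' ∨ w = w')
    {x y z z'} (h1 : f x y z = 1) (h0 : f x y z' = 0) :
    (∀ u v, f u v z' = 0) ∧ ((∀ u, f u y z = 1) ∨ (∀ v, f x v z = 1)) := by
  have hz : z ≠ z' := by rintro rfl; omega
  have key : ∀ u v, u ≠ x → v ≠ y →
      (f u y z = 1 ∧ f u y z' = 0) ∨ (f x v z = 1 ∧ f x v z' = 0) := by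
    intro u v hu hv
    have c := h.cube x u y v z z'
    have a1 : f u v z' = 0 := (h.zo _ _ _).resolve_right fun hh => by
      have := no _ _ _ _ _ _ hh h1; tauto
    rcases h.zo u v z with h2 | h2 <;> rcases h.zo u y z with h3 | h3 <;>
      rcases h.zo u y z' with h4 | h4 <;> rcases h.zo x v z with h5 | h5 <;>
      rcases h.zo x v z' with h6 | h6 <;> omega
  have full : (∀ u, f u y z = 1) ∨ (∀ v, f x v z = 1) := by
    by_contra hh
    push Not at hh
    obtain ⟨⟨u, hu⟩, v, hv⟩ := hh
    have := key u v (by rintro rfl; exact hu h1) (by rintro rfl; exact hv h1)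
    tauto
  refine ⟨?_, full⟩
  intro u v
  refine (h.zo _ _ _).resolve_right fun hh => ?_
  obtain ⟨t, ht, -⟩ := h.tu x x
  obtain ⟨s, hs, -⟩ := h.tv y y
  obtain ⟨t', ht', ht2⟩ := h.tu x u
  obtain ⟨s', hs', hs2⟩ := h.tv y v
  have n1 := no _ _ _ _ _ _ hh h1
  by_cases hu : u = x
  · subst hu
    have hv : v ≠ y := by rintro rfl; omega
    have k := key t v ht hv
    have : f t y z = 1 := by rcases k with k | k; exact k.1; omega
    have := no _ _ _ _ _ _ hh this
    grind
  · have hv : v = y := by tauto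
    subst hv
    have k := key u s hu hs
    have : f x s z = 1 := by rcases k with k | k; omega; exact k.1
    have := no _ _ _ _ _ _ hh this
    grind

lemma UF.T123 (h : UF f) : ∃ u u' v v' w w', u ≠ u' ∧ v ≠ v' ∧ w ≠ w' ∧
    f u v w = 1 ∧ f u' v' w' = 1 := by
  by_contra hno
  push Not at hno
  have no : ∀ u u' v v' w w', f u v w = 1 → f u' v' w' = 1 → u = u' ∨ v = v' ∨ w = w' := by
    intro u u' v v' w w' h1 h2
    by_contra hh
    push Not at hh
    exact hno u u' v v' w w' hh.1 hh.2.1 hh.2.2 h1 h2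
  obtain ⟨x, x', y, z, h1, h0⟩ := h.nx
  obtain ⟨x2, y2, y2', z2, h3, h4⟩ := h.ny
  obtain ⟨x3, y3, z3, z3', h5, h6⟩ := h.nz
  have l1 := h.sw12.sw23.sw12.T123aux (f := fun z y x => f x y z)
    (fun u u' v v' w w' a b => by have := no w w' v v' u u' a b; tauto) h1 h0
  have l2 := h.sw23.T123aux
    (fun u u' v v' w w' a b => by have := no u u' w w' v v' a b; tauto) h3 h4
  have l3 := h.T123aux no h5 h6
  rcases l3.2 with k | k
  · have := k x'; have := l1.1 z3 y3; omega
  · have := k y2'; have := l2.1 x3 z3; omega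

/-- the two exceptional structures -/
def UF.CaseA (f : U → V → W → ℤ) : Prop := ∃ x y z1 z2,
  (∀ u v, f u v z1 = 1 ↔ u = x) ∧ (∀ u v, f u v z2 = 1 ↔ v = y)
def UF.CaseB (f : U → V → W → ℤ) : Prop := ∃ x y z1 z2,
  (∀ u v, f u v z1 = 1 ↔ u = x ∧ v ≠ y) ∧ (∀ u v, f u v z2 = 1 ↔ v = y ∧ u ≠ x) ∧
  ∀ z, (∀ u v, f u v z = 1 ↔ u = x ∧ v ≠ y) ∨ (∀ u v, f u v z = 1 ↔ v = y ∧ u ≠ x)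

lemma UF.claim (h : UF f) (no : ∀ u u' v v' w, f u v w = 1 → f u' v' w = 1 → u = u' ∨ v = v')
    {x y z z'} (h1 : f x y z = 1) (h0 : f x y z' = 0) :
    (∀ u, f u y z = 1) ∨ (∀ v, f x v z = 1) ∨
    (∃ t, (∀ u v, f u v z = 1 ↔ u = x ∧ v ≠ t) ∧ (∀ u v, f u v z' = 1 ↔ v = t ∧ u ≠ x)) ∨
    (∃ s, (∀ u v, f u v z' = 1 ↔ u = s ∧ v ≠ y) ∧ (∀ u v, f u v z = 1 ↔ v = y ∧ u ≠ s)) := by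
  by_contra hh
  push Not at hh
  obtain ⟨⟨s, hs⟩, ⟨t, ht⟩, hC, hD⟩ := hh
  have hs0 := (h.zo _ _ _).resolve_right hs
  have ht0 := (h.zo _ _ _).resolve_right ht
  have hsx : s ≠ x := by rintro rfl; exact hs h1
  have hty : t ≠ y := by rintro rfl; exact ht h1
  have Z : ∀ u v, u ≠ x → v ≠ y → f u v z = 0 := fun u v hu hv =>
    (h.zo _ _ _).resolve_right fun hh => by have := no _ _ _ _ _ hh h1; tauto
  have c := h.cube x s y t z z'
  have z1 := Z s t hsx hty
  have b0 : f s t z' = 1 ∧ f s y z' = 0 ∧ f x t z' = 0 := by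
    rcases h.zo s t z' with h2 | h2 <;> rcases h.zo s y z' with h3 | h3 <;>
      rcases h.zo x t z' with h4 | h4 <;> omega
  obtain ⟨b1, b2, b3⟩ := b0
  have Z' : ∀ u v, u ≠ s → v ≠ t → f u v z' = 0 := fun u v hu hv =>
    (h.zo _ _ _).resolve_right fun hh => by have := no _ _ _ _ _ hh b1; tauto
  have k1 : ∀ u, u ≠ x → u ≠ s → f u y z = 1 - f u t z' := by
    intro u hu hus
    have c := h.cube x u y t z z'
    have := Z u t hu hty
    have := Z' u y hus hty.symm
    omega
  have k2 : ∀ v, v ≠ y → v ≠ t → f x v z = 1 - f s v z' := by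
    intro u hu hus
    have c := h.cube x s y u z z'
    have := Z s u hsx hu
    have := Z' x u hsx.symm hus
    omega
  have n1 : ∀ u v, u ≠ x → v ≠ y → u ≠ s → v ≠ t → (f u y z = 1 ∧ f x v z = 0) ∨
      (f u y z = 0 ∧ f x v z = 1) := by
    intro u v hu hv hus hvt
    have e1 := k1 u hu hus
    have e2 := k2 v hv hvt
    rcases h.zo u y z with h2 | h2 <;> rcases h.zo x v z with h3 | h3
    · have := no u s t v z' (by omega) (by omega)
      grind
    · tauto
    · tauto
    · have := no u x y v z (by omega) (by omega)
      grind
  obtain ⟨u0, hu0, hus0⟩ := h.tu x s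
  obtain ⟨v0, hv0, hvt0⟩ := h.tv y t
  rcases n1 u0 v0 hu0 hv0 hus0 hvt0 with hh | hh
  · -- row
    have rv : ∀ v, v ≠ y → f x v z = 0 := by
      intro v hv
      by_cases hvt : v = t
      · subst hvt; exact ht0
      · have := n1 u0 v hu0 hv hus0 hvt; omega
    have ru : ∀ u, u ≠ s → f u y z = 1 := by
      intro u hu
      by_cases hux : u = x
      · subst hux; exact h1
      · have := n1 u v0 hux hv0 hu hvt0; omega
    obtain ⟨u, v, huv⟩ := hD s (by
      intro u v
      by_cases hus : u = s
      · subst hus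
        by_cases hv : v = y
        · subst hv; simp [b2]
        · by_cases hvt : v = t
          · subst hvt; simp [b1, hv]
          · have := k2 v hv hvt; have := rv v hv; simp [hv]; omega
      · simp only [hus, false_and, iff_false]
        by_cases hvt : v = t
        · subst hvt
          by_cases hux : u = x
          · subst hux; omega
          · have := k1 u hux hus; have := ru u hus; omega
        · have := Z' u v hus hvt; omega)
    have : f u v z = 1 ↔ v = y ∧ u ≠ s := by
      by_cases hv : v = y
      · subst hv
        by_cases hus : u = s
        · subst hus; simp [hs0]
        · simp [hus, ru u hus]
      · simp only [hv, false_and, iff_false]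
        by_cases hux : u = x
        · subst hux; have := rv v hv; omega
        · have := Z u v hux hv; omega
    tauto
  · have rv : ∀ v, v ≠ t → f x v z = 1 := by
      intro v hv
      by_cases hvt : v = y
      · subst hvt; exact h1
      · have := n1 u0 v hu0 hvt hus0 hv; omega
    have ru : ∀ u, u ≠ x → f u y z = 0 := by
      intro u hu
      by_cases hux : u = s
      · subst hux; exact hs0
      · have := n1 u v0 hu hv0 hux hvt0; omega
    obtain ⟨u, v, huv⟩ := hC t (by
      intro u v
      by_cases hux : u = x
      · subst hux
        by_cases hv : v = t
        · subst hv; simp [ht0]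
        · simp [hv, rv v hv]
      · simp only [hux, false_and, iff_false]
        by_cases hv : v = y
        · subst hv; have := ru u hux; omega
        · have := Z u v hux hv; omega)
    have : f u v z' = 1 ↔ v = t ∧ u ≠ x := by
      by_cases hvt : v = t
      · subst hvt
        by_cases hux : u = x
        · subst hux; simp [b3]
        · simp only [hux, ne_eq, not_false_eq_true, and_self, iff_true]
          by_cases hus : u = s
          · subst hus; exact b1
          · have := k1 u hux hus; have := ru u hux; omega
      · simp only [hvt, false_and, iff_false]
        by_cases hus : u = s
        · subst hus
          by_cases hv : v = y
          · subst hv; omega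
          · have := k2 v hv hvt; have := rv v hvt; omega
        · have := Z' u v hus hvt; omega
    tauto

lemma UF.fullrow (h : UF f) (no : ∀ u u' v v' w, f u v w = 1 → f u' v' w = 1 → u = u' ∨ v = v')
    {y z} (hf : ∀ u, f u y z = 1) : UF.CaseA f := by
  have hz : ∀ u v, f u v z = 1 ↔ v = y := by
    intro u v
    constructor
    · intro hh
      obtain ⟨t, ht, -⟩ := h.tu u u
      have := no _ _ _ _ _ hh (hf t)
      tauto
    · rintro rfl; exact hf u
  obtain ⟨x0, x', y0, z0, h1, h0⟩ := h.nx
  have fin : (∀ v, f x0 v z0 = 1) → UF.CaseA f := by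
    intro hc
    refine ⟨x0, y, z0, z, ?_, hz⟩
    intro u v
    constructor
    · intro hh
      obtain ⟨t, ht, -⟩ := h.tv v v
      have := no _ _ _ _ _ hh (hc t)
      tauto
    · rintro rfl; exact hc v
  by_cases hy : y0 = y
  · subst hy
    apply fin
    intro v
    by_cases hv : v = y0
    · subst hv; exact h1
    have c := h.cube x' x0 y0 v z z0
    have := hf x0
    have := hf x'
    have : f x0 v z = 0 := (h.zo _ _ _).resolve_right fun hh => hv ((hz _ _).1 hh)
    have : f x' v z = 0 := (h.zo _ _ _).resolve_right fun hh => hv ((hz _ _).1 hh)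
    have : f x' v z0 = 0 := (h.zo _ _ _).resolve_right fun hh => by
      have := no _ _ _ _ _ hh h1
      rcases this with e | e
      · subst e; omega
      · exact hv e
    omega
  · have : f x0 y0 z = 0 := (h.zo _ _ _).resolve_right fun hh => hy ((hz _ _).1 hh)
    rcases h.claim no h1 this with k | k | ⟨t, k, k'⟩ | ⟨s, k, k'⟩
    · have := k x'; omega
    · exact fin k
    · have := (k' x0 y).1 (hf x0); tauto
    · obtain ⟨u, hu, -⟩ := h.tu s s
      have := (k u y).1 (hf u); tauto

lemma UF.CaseA.sw (h : UF.CaseA (fun v u w => f u v w)) : UF.CaseA f := by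
  obtain ⟨x, y, z1, z2, h1, h2⟩ := h
  exact ⟨y, x, z2, z1, fun u v => h2 v u, fun u v => h1 v u⟩

lemma UF.fullcol (h : UF f) (no : ∀ u u' v v' w, f u v w = 1 → f u' v' w = 1 → u = u' ∨ v = v')
    {x z} (hf : ∀ v, f x v z = 1) : UF.CaseA f :=
  UF.CaseA.sw (h.sw12.fullrow (fun u u' v v' w a b => (no v v' u u' w a b).symm) hf)

lemma UF.part (h : UF f) (no : ∀ u u' v v' w, f u v w = 1 → f u' v' w = 1 → u = u' ∨ v = v')
    (hna : ¬ UF.CaseA f) {x y z z'} (k1 : ∀ u v, f u v z = 1 ↔ u = x ∧ v ≠ y)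
    (k2 : ∀ u v, f u v z' = 1 ↔ v = y ∧ u ≠ x) : UF.CaseB f := by
  refine ⟨x, y, z, z', k1, k2, ?_⟩
  intro w
  by_cases hw : ∃ v, v ≠ y ∧ f x v w = 0
  · obtain ⟨v, hv, h0⟩ := hw
    have h1 : f x v z = 1 := (k1 x v).2 ⟨rfl, hv⟩
    rcases h.claim no h1 h0 with k | k | ⟨t, k, k'⟩ | ⟨s, k, k'⟩
    · exact absurd (h.fullrow no k) hna
    · exact absurd (h.fullcol no k) hna
    · right
      have : t = y := by
        by_contra ht
        have a := (k x t).1 ((k1 x t).2 ⟨rfl, ht⟩)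
        tauto
      subst this
      exact k'
    · obtain ⟨t, ht, ht2⟩ := h.tv v y
      have := (k' x t).1 ((k1 x t).2 ⟨rfl, ht2⟩)
      tauto
  · push Not at hw
    have hw1 : ∀ v, v ≠ y → f x v w = 1 := fun v hv => (h.zo _ _ _).resolve_left (hw v hv)
    left
    intro u v
    constructor
    · intro hh
      obtain ⟨t, ht, ht2⟩ := h.tv v y
      have hu : u = x := by have := no _ _ _ _ _ hh (hw1 t ht2); tauto
      subst hu
      refine ⟨rfl, ?_⟩
      rintro rfl
      refine hna (h.fullcol no (x := u) (z := w) ?_)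
      intro v'
      by_cases hv' : v' = v
      · subst hv'; exact hh
      · exact hw1 v' hv'
    · rintro ⟨rfl, hv⟩; exact hw1 v hv

lemma UF.T12 (h : UF f) : (∃ u u' v v' w, u ≠ u' ∧ v ≠ v' ∧ f u v w = 1 ∧ f u' v' w = 1) ∨
    UF.CaseA f ∨ UF.CaseB f := by
  by_contra hno
  push Not at hno
  obtain ⟨hno, hna, hnb⟩ := hno
  have no : ∀ u u' v v' w, f u v w = 1 → f u' v' w = 1 → u = u' ∨ v = v' := by
    intro u u' v v' w h1 h2
    by_contra hh
    push Not at hh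
    exact hno u u' v v' w hh.1 hh.2 h1 h2
  obtain ⟨x, y, z, z', h1, h0⟩ := h.nz
  rcases h.claim no h1 h0 with k | k | ⟨t, k, k'⟩ | ⟨s, k, k'⟩
  · exact hna (h.fullrow no k)
  · exact hna (h.fullcol no k)
  · exact hnb (h.part no hna k k')
  · exact hnb (h.part no hna k k')

end

end


section
open Finset

section
variable {X Y Z : Type} [Fintype X] [Fintype Y] [Fintype Z]
  [DecidableEq X] [DecidableEq Y] [DecidableEq Z]
  {lx : X → ℕ} {ly : Y → ℕ} {lz : Z → ℕ} {p q r : ℕ} {A B : Finset (X × Y × Z)}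

lemma vv_eq {X : Type} [DecidableEq X] {l : X → ℕ} {x x' u u' : X}
    (h1 : x = x' ↔ u = u') (h2 : l x = l x' ↔ l u = l u') : vv l x x' = vv l u u' := by
  unfold vv; simp only [h1, h2]

lemma vv_eq_iff {X : Type} [DecidableEq X] {l : X → ℕ} {x x' u u' : X} :
    vv l x x' = vv l u u' ↔ ((x = x' ↔ u = u') ∧ (l x = l x' ↔ l u = l u')) := by
  constructor
  · intro h
    unfold vv at h
    by_cases h1 : x = x' <;> by_cases h2 : u = u' <;> by_cases h3 : l x = l x' <;>
      by_cases h4 : l u = l u' <;> simp_all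
  · rintro ⟨h1, h2⟩; exact vv_eq h1 h2

/-- a single term of the saturation identity -/
def tm (lx : X → ℕ) (ly : Y → ℕ) (lz : Z → ℕ) (p q r : ℕ) (A B : Finset (X × Y × Z))
    (Q b : X × Y × Z) (t : ℕ × ℕ × ℕ) : ℚ :=
  (Nn lx ly lz A t.1 t.2.1 t.2.2 Q : ℚ) * Nn lx ly lz B t.1 t.2.1 t.2.2 b /
    (ww p t.1 * ww q t.2.1 * ww r t.2.2)

/-- the type of a pair of points -/
def ty (lx : X → ℕ) (ly : Y → ℕ) (lz : Z → ℕ) (a b : X × Y × Z) : ℕ × ℕ × ℕ :=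
  (vv lx a.1 b.1, vv ly a.2.1 b.2.1, vv lz a.2.2 b.2.2)

lemma Tile.sat' (H : Tile lx ly lz p q r A B) (Q b : X × Y × Z) :
    ∑ t ∈ range 3 ×ˢ range 3 ×ˢ range 3, tm lx ly lz p q r A B Q b t = 1 := by
  rw [← H.sat Q b, sum_product]
  refine sum_congr rfl fun i _ => ?_
  rw [sum_product]
  rfl

lemma Nn_pos {T : Finset (X × Y × Z)} {Q : X × Y × Z} {i j k : ℕ} :
    Nn lx ly lz T i j k Q ≠ 0 ↔ ∃ t ∈ T, ty lx ly lz Q t = (i, j, k) := by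
  unfold Nn
  rw [Finset.card_ne_zero]
  constructor
  · rintro ⟨t, ht⟩
    simp only [mem_filter] at ht
    exact ⟨t, ht.1, by simp [ty, ht.2]⟩
  · rintro ⟨t, ht, h⟩
    simp only [ty, Prod.mk.injEq] at h
    exact ⟨t, by simp [ht, h]⟩

lemma Tile.tm_nonneg (H : Tile lx ly lz p q r A B) (Q b : X × Y × Z) (t : ℕ × ℕ × ℕ) :
    0 ≤ tm lx ly lz p q r A B Q b t := by
  have := ww_pos H.cx.three t.1
  have := ww_pos H.cy.three t.2.1
  have := ww_pos H.cz.three t.2.2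
  unfold tm; positivity

lemma ty_mem (a b : X × Y × Z) : ty lx ly lz a b ∈ range 3 ×ˢ range 3 ×ˢ range 3 := by
  simp only [ty, mem_product, mem_range]
  have := vv_le lx a.1 b.1
  have := vv_le ly a.2.1 b.2.1
  have := vv_le lz a.2.2 b.2.2
  omega

lemma Tile.supp (H : Tile lx ly lz p q r A B) (Q b : X × Y × Z) (L : Finset (ℕ × ℕ × ℕ))
    (hL : L ⊆ range 3 ×ˢ range 3 ×ˢ range 3)
    (h : ∀ a ∈ A, ∀ b' ∈ B, ty lx ly lz Q a = ty lx ly lz b b' → ty lx ly lz Q a ∈ L) :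
    ∑ t ∈ L, tm lx ly lz p q r A B Q b t = 1 := by
  rw [← H.sat' Q b]
  refine sum_subset hL fun t _ ht => ?_
  by_contra hne
  unfold tm at hne
  have h1 : Nn lx ly lz A t.1 t.2.1 t.2.2 Q ≠ 0 := by
    intro h; rw [h] at hne; simp at hne
  have h2 : Nn lx ly lz B t.1 t.2.1 t.2.2 b ≠ 0 := by
    intro h; rw [h] at hne; simp at hne
  obtain ⟨a, ha, e⟩ := Nn_pos.1 h1
  obtain ⟨b', hb', e'⟩ := Nn_pos.1 h2
  have := h a ha b' hb' (e.trans e'.symm)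
  rw [e] at this
  exact ht this

lemma Tile.pair (H : Tile lx ly lz p q r A B) (Q b : X × Y × Z) :
    ∃ a ∈ A, ∃ b' ∈ B, ty lx ly lz Q a = ty lx ly lz b b' := by
  by_contra hh
  push Not at hh
  have := H.supp Q b ∅ (by simp) (fun a ha b' hb' e => absurd e (hh a ha b' hb'))
  simp at this

lemma ty_self (a : X × Y × Z) : ty lx ly lz a a = (2, 2, 2) := by
  simp [ty, vv]

lemma ty_two {a b : X × Y × Z} : ty lx ly lz a b = (2, 2, 2) ↔ a = b := by
  simp only [ty, Prod.mk.injEq, vv_two]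
  exact ⟨fun h => Prod.ext h.1 (Prod.ext h.2.1 h.2.2), fun h => by simp [h]⟩

lemma Tile.sands (H : Tile lx ly lz p q r A B) {a a' b b' : X × Y × Z} (ha : a ∈ A) (ha' : a' ∈ A)
    (hb : b ∈ B) (hb' : b' ∈ B) (h : ty lx ly lz a a' = ty lx ly lz b b') : a = a' := by
  by_contra hne
  have hpos : ∀ (i j k : ℕ), Nn lx ly lz A i j k a ≠ 0 → Nn lx ly lz B i j k b ≠ 0 →
      0 < tm lx ly lz p q r A B a b (i, j, k) := by
    intro i j k h1 h2
    have := ww_pos H.cx.three i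
    have := ww_pos H.cy.three j
    have := ww_pos H.cz.three k
    have h1' := Nat.pos_of_ne_zero h1
    have h2' := Nat.pos_of_ne_zero h2
    unfold tm; simp only; positivity
  have h222 : 1 ≤ tm lx ly lz p q r A B a b (2, 2, 2) := by
    have h1 : Nn lx ly lz A 2 2 2 a ≠ 0 := Nn_pos.2 ⟨a, ha, ty_self a⟩
    have h2 : Nn lx ly lz B 2 2 2 b ≠ 0 := Nn_pos.2 ⟨b, hb, ty_self b⟩
    have h1' : (1:ℚ) ≤ Nn lx ly lz A 2 2 2 a := by exact_mod_cast Nat.pos_of_ne_zero h1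
    have h2' : (1:ℚ) ≤ Nn lx ly lz B 2 2 2 b := by exact_mod_cast Nat.pos_of_ne_zero h2
    simp only [tm, ww]; norm_num; nlinarith
  set t := ty lx ly lz a a' with ht
  have htp : 0 < tm lx ly lz p q r A B a b t := by
    apply hpos
    · exact Nn_pos.2 ⟨a', ha', ht.symm⟩
    · exact Nn_pos.2 ⟨b', hb', h.symm⟩
  have hne' : t ≠ (2, 2, 2) := fun e => hne (ty_two.1 e)
  have hsub : ({t, (2, 2, 2)} : Finset (ℕ × ℕ × ℕ)) ⊆ range 3 ×ˢ range 3 ×ˢ range 3 := by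
    intro s hs
    simp only [mem_insert, mem_singleton] at hs
    rcases hs with rfl | rfl
    · exact ty_mem a a'
    · decide
  have := sum_le_sum_of_subset_of_nonneg hsub
    (fun s _ _ => H.tm_nonneg a b s)
  rw [H.sat' a b, sum_pair hne'] at this
  linarith

/-- coordinate form of Sands' theorem -/
lemma Tile.sd (H : Tile lx ly lz p q r A B) {x x' u u' : X} {y y' v v' : Y} {z z' w w' : Z}
    (ha : (x, y, z) ∈ A) (ha' : (x', y', z') ∈ A) (hb : (u, v, w) ∈ B) (hb' : (u', v', w') ∈ B)
    (h1 : (x = x' ↔ u = u') ∧ (lx x = lx x' ↔ lx u = lx u'))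
    (h2 : (y = y' ↔ v = v') ∧ (ly y = ly y' ↔ ly v = ly v'))
    (h3 : (z = z' ↔ w = w') ∧ (lz z = lz z' ↔ lz w = lz w')) :
    x = x' ∧ y = y' ∧ z = z' := by
  have := H.sands ha ha' hb hb' (by simp only [ty]; rw [vv_eq_iff.2 h1, vv_eq_iff.2 h2, vv_eq_iff.2 h3])
  simpa using this

lemma Tile.pr (H : Tile lx ly lz p q r A B) (x u : X) (y v : Y) (z w : Z) :
    ∃ x' y' z' u' v' w', (x', y', z') ∈ A ∧ (u', v', w') ∈ B ∧
    ((x = x' ↔ u = u') ∧ (lx x = lx x' ↔ lx u = lx u')) ∧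
    ((y = y' ↔ v = v') ∧ (ly y = ly y' ↔ ly v = ly v')) ∧
    ((z = z' ↔ w = w') ∧ (lz z = lz z' ↔ lz w = lz w')) := by
  obtain ⟨⟨x', y', z'⟩, ha, ⟨u', v', w'⟩, hb, h⟩ := H.pair (x, y, z) (u, v, w)
  simp only [ty, Prod.mk.injEq, vv_eq_iff] at h
  exact ⟨x', y', z', u', v', w', ha, hb, h.1, h.2.1, h.2.2⟩

lemma Coord.third {l : X → ℕ} (c : Coord X l p) (x x' : X) : ∃ t, l t = l x ∧ t ≠ x ∧ t ≠ x' := by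
  have h := c.fib x
  have h3 := c.three
  have : ((univ.filter (fun t => l t = l x)) \ {x, x'}).Nonempty := by
    rw [← Finset.card_pos]
    have := le_card_sdiff {x, x'} (univ.filter (fun t => l t = l x))
    have : ({x, x'} : Finset X).card ≤ 2 := card_le_two
    omega
  obtain ⟨t, ht⟩ := this
  simp at ht
  exact ⟨t, ht.1, by tauto, by tauto⟩

lemma Coord.cardOff {l : X → ℕ} (c : Coord X l p) (x : X) :
    (univ.filter (fun t => l x ≠ l t)).card = p ^ 2 - p := by
  have h := c.fib x
  have h2 := card_filter_add_card_filter_not (s := (univ : Finset X)) (fun t => l t = l x)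
  rw [card_univ, c.card, h] at h2
  have : (univ.filter (fun t => l x ≠ l t)) = univ.filter (fun t => ¬ l t = l x) := by
    ext t; simp [eq_comm]
  rw [this]; omega

lemma Coord.cardPun {l : X → ℕ} (c : Coord X l p) (x : X) :
    (univ.filter (fun t => x ≠ t ∧ l x = l t)).card = p - 1 := by
  have h := c.fib x
  have : (univ.filter (fun t => x ≠ t ∧ l x = l t)) = (univ.filter (fun t => l t = l x)).erase x := by
    ext t; simp [eq_comm]
  rw [this, card_erase_of_mem (by simp), h]

lemma Coord.cardImg {l : X → ℕ} (c : Coord X l p) : (univ.image l).card = p := by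
  have h : (univ : Finset X).card = ∑ k ∈ univ.image l, (univ.filter (fun t => l t = k)).card :=
    card_eq_sum_card_image l univ
  rw [sum_congr rfl (g := fun _ => p), sum_const, card_univ, c.card] at h
  · have := c.three
    simp at h
    nlinarith
  · intro k hk
    simp only [mem_image, mem_univ, true_and] at hk
    obtain ⟨x, rfl⟩ := hk
    exact c.fib x

end

end


section
open Finset
set_option linter.unusedSectionVars false

section
variable {X Y Z : Type} [Fintype X] [Fintype Y] [Fintype Z]
  [DecidableEq X] [DecidableEq Y] [DecidableEq Z]
  {lx : X → ℕ} {ly : Y → ℕ} {lz : Z → ℕ} {p q r : ℕ} {A B : Finset (X × Y × Z)}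

/-- type `(i,j,k)` occurs as a difference in `T` -/
def Dv (lx : X → ℕ) (ly : Y → ℕ) (lz : Z → ℕ) (T : Finset (X × Y × Z)) (i j k : ℕ) : Prop :=
  ∃ x y z x' y' z', (x, y, z) ∈ T ∧ (x', y', z') ∈ T ∧ vv lx x x' = i ∧ vv ly y y' = j ∧
    vv lz z z' = k

lemma Tile.nd (H : Tile lx ly lz p q r A B) {i j k : ℕ} (hA : Dv lx ly lz A i j k)
    (hB : Dv lx ly lz B i j k) : i = 2 ∧ j = 2 ∧ k = 2 := by
  obtain ⟨x, y, z, x', y', z', h1, h2, h3, h4, h5⟩ := hA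
  obtain ⟨u, v, w, u', v', w', g1, g2, g3, g4, g5⟩ := hB
  have := H.sands h1 h2 g1 g2 (by simp only [ty]; rw [h3, h4, h5, g3, g4, g5])
  simp only [Prod.mk.injEq] at this
  obtain ⟨rfl, rfl, rfl⟩ := this
  simp only [vv, if_true] at h3 h4 h5
  omega

/-- data of the exceptional structure -/
structure Cr (lx : X → ℕ) (ly : Y → ℕ) (lz : Z → ℕ) (p q r : ℕ) (A B : Finset (X × Y × Z))
    (x : X) (y : Y) (z1 z2 : Z) : Prop where
  H : Tile lx ly lz p q r A B
  lt : p < q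
  hz : lz z1 = lz z2
  hzn : z1 ≠ z2
  S1 : ∀ t, ly t = ly y → t ≠ y → (x, t, z1) ∈ A
  S2 : ∀ t, lx t = lx x → t ≠ x → (t, y, z2) ∈ A
  P1 : ∀ u v, lx u = lx x → ly v = ly y → (u, v, z1) ∈ A → u = x
  P2 : ∀ u v, lx u = lx x → ly v = ly y → (u, v, z2) ∈ A → v = y
  hH : ((x, y, z1) ∈ A ∧ (x, y, z2) ∈ A) ∨
    ((x, y, z1) ∉ A ∧ (x, y, z2) ∉ A ∧ ∀ z, lz z = lz z1 →
      ((∀ u v, lx u = lx x → ly v = ly y → ((u, v, z) ∈ A ↔ u = x ∧ v ≠ y)) ∨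
       (∀ u v, lx u = lx x → ly v = ly y → ((u, v, z) ∈ A ↔ v = y ∧ u ≠ x))))

variable {x : X} {y : Y} {z1 z2 : Z}

lemma Cr.two_x (C : Cr lx ly lz p q r A B x y z1 z2) : ∃ t t', lx t = lx x ∧ lx t' = lx x ∧
    t ≠ x ∧ t' ≠ x ∧ t ≠ t' := by
  obtain ⟨t, h1, h2, -⟩ := C.H.cx.third x x
  obtain ⟨t', h1', h2', h3'⟩ := C.H.cx.third x t
  exact ⟨t, t', h1, h1', h2, h2', h3'.symm⟩

lemma Cr.two_y (C : Cr lx ly lz p q r A B x y z1 z2) : ∃ t t', ly t = ly y ∧ ly t' = ly y ∧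
    t ≠ y ∧ t' ≠ y ∧ t ≠ t' := by
  obtain ⟨t, h1, h2, -⟩ := C.H.cy.third y y
  obtain ⟨t', h1', h2', h3'⟩ := C.H.cy.third y t
  exact ⟨t, t', h1, h1', h2, h2', h3'.symm⟩

lemma Cr.A122 (C : Cr lx ly lz p q r A B x y z1 z2) : Dv lx ly lz A 1 2 2 := by
  obtain ⟨t, t', h1, h1', h2, h2', h3⟩ := C.two_x
  exact ⟨_, _, _, _, _, _, C.S2 t h1 h2, C.S2 t' h1' h2', vv_one.2 ⟨h3, by rw [h1, h1']⟩,
    vv_two.2 rfl, vv_two.2 rfl⟩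

lemma Cr.A212 (C : Cr lx ly lz p q r A B x y z1 z2) : Dv lx ly lz A 2 1 2 := by
  obtain ⟨t, t', h1, h1', h2, h2', h3⟩ := C.two_y
  exact ⟨_, _, _, _, _, _, C.S1 t h1 h2, C.S1 t' h1' h2', vv_two.2 rfl, vv_one.2 ⟨h3, by rw [h1, h1']⟩,
    vv_two.2 rfl⟩

lemma Cr.A111 (C : Cr lx ly lz p q r A B x y z1 z2) : Dv lx ly lz A 1 1 1 := by
  obtain ⟨t, t', h1, h1', h2, h2', h3⟩ := C.two_y
  obtain ⟨s, s', g1, g1', g2, g2', g3⟩ := C.two_x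
  exact ⟨_, _, _, _, _, _, C.S2 s g1 g2, C.S1 t h1 h2, vv_one.2 ⟨g2, g1⟩,
    vv_one.2 ⟨h2.symm, h1.symm⟩, vv_one.2 ⟨C.hzn.symm, C.hz.symm⟩⟩

/-- trichotomy of the structure -/
lemma Cr.tri (C : Cr lx ly lz p q r A B x y z1 z2) :
    ((x, y, z1) ∈ A ∧ (x, y, z2) ∈ A) ∨
    ((x, y, z1) ∉ A ∧ (x, y, z2) ∉ A ∧ ∃ z3, lz z3 = lz z2 ∧ z3 ≠ z1 ∧ z3 ≠ z2 ∧
      ∀ t, lx t = lx x → t ≠ x → (t, y, z3) ∈ A) ∨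
    ((x, y, z1) ∉ A ∧ (x, y, z2) ∉ A ∧ ∀ z3, lz z3 = lz z2 → z3 ≠ z2 →
      ∀ t, ly t = ly y → t ≠ y → (x, t, z3) ∈ A) := by
  rcases C.hH with h | ⟨h1, h2, h⟩
  · exact Or.inl h
  right
  by_cases hh : ∃ z3, lz z3 = lz z2 ∧ z3 ≠ z1 ∧ z3 ≠ z2 ∧ ∀ t, lx t = lx x → t ≠ x → (t, y, z3) ∈ A
  · exact Or.inl ⟨h1, h2, hh⟩
  right
  refine ⟨h1, h2, ?_⟩
  intro z3 hz3 hn t ht hty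
  by_cases h13 : z3 = z1
  · subst h13; exact C.S1 t ht hty
  rcases h z3 (by rw [hz3, C.hz]) with k | k
  · exact (k x t rfl ht).2 ⟨rfl, hty⟩
  · exact absurd ⟨z3, hz3, h13, hn, fun t ht htx => (k t y ht rfl).2 ⟨rfl, htx⟩⟩ hh

lemma Cr.A221 (C : Cr lx ly lz p q r A B x y z1 z2) : Dv lx ly lz A 2 2 1 := by
  obtain ⟨t, t', h1, h1', h2, h2', h3⟩ := C.two_y
  obtain ⟨s, s', g1, g1', g2, g2', g3⟩ := C.two_x
  rcases C.tri with h | ⟨_, _, z3, k1, k2, k3, k4⟩ | ⟨_, _, k⟩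
  · exact ⟨_, _, _, _, _, _, h.1, h.2, vv_two.2 rfl, vv_two.2 rfl, vv_one.2 ⟨C.hzn, C.hz⟩⟩
  · exact ⟨_, _, _, _, _, _, k4 s g1 g2, C.S2 s g1 g2, vv_two.2 rfl, vv_two.2 rfl, vv_one.2 ⟨k3, k1⟩⟩
  · obtain ⟨z3, m1, m2, m3⟩ := C.H.cz.third z2 z1
    exact ⟨_, _, _, _, _, _, k z3 m1 m2 t h1 h2, C.S1 t h1 h2, vv_two.2 rfl, vv_two.2 rfl,
      vv_one.2 ⟨m3, by rw [m1, C.hz]⟩⟩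

lemma Cr.A211 (C : Cr lx ly lz p q r A B x y z1 z2) : Dv lx ly lz A 2 1 1 ∨ Dv lx ly lz A 1 2 1 := by
  obtain ⟨t, t', h1, h1', h2, h2', h3⟩ := C.two_y
  obtain ⟨s, s', g1, g1', g2, g2', g3⟩ := C.two_x
  rcases C.tri with h | ⟨_, _, z3, k1, k2, k3, k4⟩ | ⟨_, _, k⟩
  · left
    exact ⟨_, _, _, _, _, _, h.2, C.S1 t h1 h2, vv_two.2 rfl, vv_one.2 ⟨h2.symm, h1.symm⟩, vv_one.2 ⟨C.hzn.symm, C.hz.symm⟩⟩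
  · right
    exact ⟨_, _, _, _, _, _, k4 s g1 g2, C.S2 s' g1' g2', vv_one.2 ⟨g3, by rw [g1, g1']⟩, vv_two.2 rfl, vv_one.2 ⟨k3, k1⟩⟩
  · obtain ⟨z3, m1, m2, m3⟩ := C.H.cz.third z2 z1
    left
    exact ⟨_, _, _, _, _, _, k z3 m1 m2 t h1 h2, C.S1 t' h1' h2', vv_two.2 rfl, vv_one.2 ⟨h3, by rw [h1, h1']⟩,
      vv_one.2 ⟨m3, by rw [m1, C.hz]⟩⟩

/-- in case (a), `(2,1,1)` occurs -/
lemma Cr.A211a (C : Cr lx ly lz p q r A B x y z1 z2) (h : (x, y, z2) ∈ A) :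
    Dv lx ly lz A 2 1 1 := by
  obtain ⟨t, t', h1, h1', h2, h2', h3⟩ := C.two_y
  exact ⟨_, _, _, _, _, _, h, C.S1 t h1 h2, vv_two.2 rfl, vv_one.2 ⟨h2.symm, h1.symm⟩, vv_one.2 ⟨C.hzn.symm, C.hz.symm⟩⟩

lemma Cr.n122 (C : Cr lx ly lz p q r A B x y z1 z2) {u u' : X} {v : Y} {w : Z}
    (h : (u, v, w) ∈ B) (h' : (u', v, w) ∈ B) (e : lx u = lx u') : u = u' := by
  by_contra hh
  have := C.H.nd C.A122 ⟨_, _, _, _, _, _, h, h', vv_one.2 ⟨hh, e⟩, vv_two.2 rfl, vv_two.2 rfl⟩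
  omega

lemma Cr.n212 (C : Cr lx ly lz p q r A B x y z1 z2) {u : X} {v v' : Y} {w : Z}
    (h : (u, v, w) ∈ B) (h' : (u, v', w) ∈ B) (e : ly v = ly v') : v = v' := by
  by_contra hh
  have := C.H.nd C.A212 ⟨_, _, _, _, _, _, h, h', vv_two.2 rfl, vv_one.2 ⟨hh, e⟩, vv_two.2 rfl⟩
  omega

lemma Cr.n221 (C : Cr lx ly lz p q r A B x y z1 z2) {u : X} {v : Y} {w w' : Z}
    (h : (u, v, w) ∈ B) (h' : (u, v, w') ∈ B) (e : lz w = lz w') : w = w' := by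
  by_contra hh
  have := C.H.nd C.A221 ⟨_, _, _, _, _, _, h, h', vv_two.2 rfl, vv_two.2 rfl, vv_one.2 ⟨hh, e⟩⟩
  omega

lemma Cr.n111 (C : Cr lx ly lz p q r A B x y z1 z2) {u u' : X} {v v' : Y} {w w' : Z}
    (h : (u, v, w) ∈ B) (h' : (u', v', w') ∈ B) (e : lx u = lx u') (e' : ly v = ly v')
    (e'' : lz w = lz w') : u = u' ∨ v = v' ∨ w = w' := by
  by_contra hh
  push Not at hh
  have := C.H.nd C.A111 ⟨_, _, _, _, _, _, h, h', vv_one.2 ⟨hh.1, e⟩, vv_one.2 ⟨hh.2.1, e'⟩,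
    vv_one.2 ⟨hh.2.2, e''⟩⟩
  omega

lemma Cr.cls (C : Cr lx ly lz p q r A B x y z1 z2) {y2 : Y} (hy : ly y2 = ly y) (hyn : y2 ≠ y)
    {a1 b1 c1 : X} {a2 b2 c2 : Y} {a3 b3 c3 : Z} (ha : (a1, a2, a3) ∈ A)
    (hb : (b1, b2, b3) ∈ B) (hc : (c1, c2, c3) ∈ B)
    (e1 : ((x = a1 ↔ b1 = c1) ∧ (lx x = lx a1 ↔ lx b1 = lx c1)))
    (e2 : ((y2 = a2 ↔ b2 = c2) ∧ (ly y2 = ly a2 ↔ ly b2 = ly c2)))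
    (e3 : ((z2 = a3 ↔ b3 = c3) ∧ (lz z2 = lz a3 ↔ lz b3 = lz c3))) :
    (a3 = z2 ∧ a2 = y ∧ a1 ≠ x ∧ lx a1 = lx x) ∨
    (a3 = z2 ∧ a2 = y ∧ lx a1 ≠ lx x) ∨
    (a3 = z2 ∧ a2 = y2 ∧ lx a1 ≠ lx x) ∨
    (a3 = z1 ∧ a2 = y ∧ lx a1 ≠ lx x) ∨
    (a3 = z1 ∧ a2 = y2 ∧ lx a1 ≠ lx x) ∨
    (a3 = z2 ∧ a1 = x ∧ ly a2 ≠ ly y) ∨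
    (a3 = z1 ∧ a1 = x ∧ ly a2 = ly y ∧ a2 ≠ y2) ∨
    (a3 = z1 ∧ a1 = x ∧ ly a2 ≠ ly y) := by
  have hz := C.hz
  have hzn := C.hzn
  have s1 := C.S1 y2 hy hyn
  have F1 : a3 = z1 ∨ a3 = z2 := by
    by_contra hh
    push Not at hh
    have := C.H.sd s1 ha hb hc e1 e2 (by grind)
    tauto
  have F2 : a1 = x ∨ a2 = y ∨ a2 = y2 := by
    by_contra hh
    push Not at hh
    obtain ⟨t, ht1, ht2, ht3⟩ := C.H.cx.third x a1
    have := C.H.sd (C.S2 t ht1 ht2) ha hb hc (by grind) (by grind) e3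
    tauto
  have p1 := C.P1 a1 a2
  have p2 := C.P2 a1 a2
  have n1 : ¬ (a1 = x ∧ a2 = y ∧ a3 = z2) := by
    rintro ⟨rfl, rfl, rfl⟩
    have e := e1.1.1 rfl
    have e' := e3.1.1 rfl
    subst e; subst e'
    have := C.n212 hb hc (e2.2.1 hy)
    grind
  have n2 : ¬ (a1 = x ∧ a2 = y2 ∧ a3 = z1) := by
    rintro ⟨rfl, rfl, rfl⟩
    have e := e1.1.1 rfl
    have e' := e2.1.1 rfl
    subst e; subst e'
    have := C.n221 hb hc (e3.2.1 hz.symm)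
    grind
  grind

end

end


section
open Finset
set_option linter.unusedSectionVars false

section
variable {X Y Z : Type} [Fintype X] [Fintype Y] [Fintype Z]
  [DecidableEq X] [DecidableEq Y] [DecidableEq Z]
  {lx : X → ℕ} {ly : Y → ℕ} {lz : Z → ℕ} {p q r : ℕ} {A B : Finset (X × Y × Z)}

lemma Tile.supp2 (H : Tile lx ly lz p q r A B) (x b1 : X) (y b2 : Y) (z b3 : Z)
    (t1 t2 : ℕ × ℕ × ℕ) (hne : t1 ≠ t2)
    (h1 : t1 ∈ range 3 ×ˢ range 3 ×ˢ range 3) (h2 : t2 ∈ range 3 ×ˢ range 3 ×ˢ range 3)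
    (h : ∀ a1 a2 a3 c1 c2 c3, (a1, a2, a3) ∈ A → (c1, c2, c3) ∈ B →
      ((x = a1 ↔ b1 = c1) ∧ (lx x = lx a1 ↔ lx b1 = lx c1)) →
      ((y = a2 ↔ b2 = c2) ∧ (ly y = ly a2 ↔ ly b2 = ly c2)) →
      ((z = a3 ↔ b3 = c3) ∧ (lz z = lz a3 ↔ lz b3 = lz c3)) →
      (vv lx x a1, vv ly y a2, vv lz z a3) = t1 ∨ (vv lx x a1, vv ly y a2, vv lz z a3) = t2) :
    tm lx ly lz p q r A B (x, y, z) (b1, b2, b3) t1 +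
      tm lx ly lz p q r A B (x, y, z) (b1, b2, b3) t2 = 1 := by
  rw [← sum_pair hne]
  refine H.supp _ _ _ ?_ ?_
  · intro t ht
    simp only [mem_insert, mem_singleton] at ht
    rcases ht with rfl | rfl <;> assumption
  · rintro ⟨a1, a2, a3⟩ ha ⟨c1, c2, c3⟩ hc e
    simp only [ty, Prod.mk.injEq, vv_eq_iff] at e
    simp only [mem_insert, mem_singleton]
    exact h a1 a2 a3 c1 c2 c3 ha hc e.1 e.2.1 e.2.2

variable {x : X} {y : Y} {z1 z2 : Z}

set_option maxHeartbeats 1000000 in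
lemma Cr.cls12 (C : Cr lx ly lz p q r A B x y z1 z2) {y2 : Y} (hy : ly y2 = ly y) (hyn : y2 ≠ y)
    {a1 b1 c1 d1 : X} {a2 b2 c2 d2 : Y} {a3 b3 c3 : Z} (ha : (a1, a2, a3) ∈ A)
    (hb : (b1, b2, b3) ∈ B) (hc : (c1, c2, c3) ∈ B) (hd : (d1, d2, b3) ∈ B)
    (hd1 : lx d1 = lx b1) (hd2 : ly d2 = ly b2) (hd1n : d1 ≠ b1) (hd2n : d2 ≠ b2)
    (e1 : ((x = a1 ↔ b1 = c1) ∧ (lx x = lx a1 ↔ lx b1 = lx c1)))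
    (e2 : ((y2 = a2 ↔ b2 = c2) ∧ (ly y2 = ly a2 ↔ ly b2 = ly c2)))
    (e3 : ((z2 = a3 ↔ b3 = c3) ∧ (lz z2 = lz a3 ↔ lz b3 = lz c3))) :
    (a3 = z2 ∧ a2 = y ∧ a1 ≠ x ∧ lx a1 = lx x) ∨
    (a3 = z2 ∧ a2 = y ∧ lx a1 ≠ lx x) ∨
    (a3 = z1 ∧ a2 = y ∧ lx a1 ≠ lx x) := by
  have hz := C.hz
  have hzn := C.hzn
  obtain ⟨t, ht1, ht2, ht3⟩ := C.H.cx.third x a1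
  rcases C.cls hy hyn ha hb hc e1 e2 e3 with h | h | h | h | h | h | h | h
  · exact Or.inl h
  · exact Or.inr (Or.inl h)
  · have := C.H.sd (C.S2 t ht1 ht2) ha hd hc (by grind) (by grind) (by grind); grind
  · exact Or.inr (Or.inr h)
  · have := C.H.sd (C.S2 t ht1 ht2) ha hd hc (by grind) (by grind) (by grind); grind
  · have := C.H.sd (C.S2 t ht1 ht2) ha hd hc (by grind) (by grind) (by grind); grind
  · exfalso
    rcases C.A211 with k | k
    · have := C.H.nd k ⟨_, _, _, _, _, _, hb, hc, vv_two.2 (by grind), vv_one.2 (by grind),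
        vv_one.2 (by grind)⟩
      omega
    · by_cases hdc : d2 = c2
      · have := C.H.nd k ⟨_, _, _, _, _, _, hd, hc, vv_one.2 (by grind), vv_two.2 (by grind),
          vv_one.2 (by grind)⟩
        omega
      · have := C.n111 hd hc (by grind) (by grind) (by grind)
        grind
  · have := C.H.sd (C.S2 t ht1 ht2) ha hd hc (by grind) (by grind) (by grind); grind

lemma Cr.al112 (C : Cr lx ly lz p q r A B x y z1 z2) {y2 : Y} (hy : ly y2 = ly y) :
    Nn lx ly lz A 1 1 2 (x, y2, z2) ≤ p - 1 := by
  rw [← C.H.cx.cardPun x]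
  refine le_trans (card_le_card ?_) (card_image_le (f := fun t => (t, y, z2)))
  rintro ⟨a1, a2, a3⟩ ha
  simp only [mem_filter, vv_one, vv_two] at ha
  obtain ⟨ha, h1, h2, rfl⟩ := ha
  simp only [mem_image, mem_filter, mem_univ, true_and, Prod.mk.injEq]
  exact ⟨a1, h1, rfl, (C.P2 a1 a2 h1.2.symm (by rw [← h2.2, hy]) ha).symm, trivial⟩

lemma Cr.al012 (C : Cr lx ly lz p q r A B x y z1 z2) {y2 : Y}
    (h : ∀ a1 a2, (a1, a2, z2) ∈ A → lx x ≠ lx a1 → ly y2 = ly a2 → y2 ≠ a2 → a2 = y) :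
    Nn lx ly lz A 0 1 2 (x, y2, z2) ≤ p ^ 2 - p ∧
    (p ^ 2 - p ≤ Nn lx ly lz A 0 1 2 (x, y2, z2) → ∀ u, lx u ≠ lx x → (u, y, z2) ∈ A) := by
  have hc := C.H.cx.cardOff x
  set F := (univ.filter (fun t => lx x ≠ lx t)).image (fun t => (t, y, z2)) with hF
  have hFc : F.card = p ^ 2 - p := by
    rw [hF, card_image_of_injective, hc]
    intro a b; simp
  have hsub : A.filter (fun t => vv lx x t.1 = 0 ∧ vv ly y2 t.2.1 = 1 ∧ vv lz z2 t.2.2 = 2) ⊆ F := by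
    rintro ⟨a1, a2, a3⟩ ha
    simp only [mem_filter, vv_zero, vv_one, vv_two] at ha
    obtain ⟨ha, h1, h2, rfl⟩ := ha
    simp only [hF, mem_image, mem_filter, mem_univ, true_and, Prod.mk.injEq]
    exact ⟨a1, h1, rfl, (h a1 a2 ha h1 h2.2 h2.1).symm, trivial⟩
  constructor
  · rw [← hFc]; exact card_le_card hsub
  · intro hle u hu
    have := eq_of_subset_of_card_le hsub (by rw [hFc]; exact hle)
    have hm : (u, y, z2) ∈ F := by simp [hF]; exact hu.symm
    rw [← this] at hm
    exact (mem_filter.1 hm).1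

lemma Cr.be2 (C : Cr lx ly lz p q r A B x y z1 z2) (h022 : Dv lx ly lz A 0 2 2) (b1 : X) (b2 : Y) (b3 : Z) :
    Nn lx ly lz B 1 1 2 (b1, b2, b3) + Nn lx ly lz B 0 1 2 (b1, b2, b3) ≤ q - 1 := by
  rw [← C.H.cy.cardPun b2]
  unfold Nn
  rw [← card_union_of_disjoint]
  · refine card_le_card_of_injOn (fun t => t.2.1) ?_ ?_
    · rintro ⟨a1, a2, a3⟩ ha
      simp only [coe_union, coe_filter, Set.mem_union, Set.mem_ofPred_eq, vv_zero, vv_one, vv_two,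
        mem_univ, true_and] at ha ⊢
      tauto
    · rintro ⟨a1, a2, a3⟩ ha ⟨c1, c2, c3⟩ hc e
      simp only [coe_union, coe_filter, Set.mem_union, Set.mem_ofPred_eq, vv_zero, vv_one, vv_two] at ha hc e
      subst e
      have e3 : a3 = c3 := by grind
      subst e3
      by_cases hl : lx a1 = lx c1
      · have := C.n122 (u := a1) (u' := c1) (v := a2) (w := a3) (by tauto) (by tauto) hl
        subst this; rfl
      · have := C.H.nd h022 ⟨a1, a2, a3, c1, a2, a3, by tauto, by tauto, vv_zero.2 hl,
          vv_two.2 rfl, vv_two.2 rfl⟩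
        omega
  · rw [disjoint_left]
    intro a h1 h2
    simp only [mem_filter] at h1 h2
    omega

/-- numeric core for the two types `(1,1,2)`, `(0,1,2)` -/
lemma num1 {p q : ℕ} (hp : 3 ≤ p) (hq : 3 ≤ q) {a b c d : ℕ} (ha : a ≤ p - 1)
    (hc : d ≠ 0 → c ≤ p ^ 2 - p)
    (h : (a * b : ℚ) / (ww p 1 * ww q 1 * ww r 2) + (c * d : ℚ) / (ww p 0 * ww q 1 * ww r 2) = 1) :
    q - 1 ≤ b + d ∧ (b + d ≤ q - 1 → d ≠ 0 → p ^ 2 - p ≤ c) := by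
  have hp' : (3:ℚ) ≤ p := by exact_mod_cast hp
  have hq' : (3:ℚ) ≤ q := by exact_mod_cast hq
  have hpp : p ≤ p ^ 2 := by nlinarith
  simp only [ww] at h
  norm_num at h
  have e1 : (p:ℚ) ^ 2 - p = p * (p - 1) := by ring
  have p1 : (0:ℚ) < p - 1 := by linarith
  have q1 : (0:ℚ) < q - 1 := by linarith
  have pp : (0:ℚ) < p := by linarith
  rw [e1] at h
  have h' : (a * b * p + c * d : ℚ) = p * (p - 1) * (q - 1) := by
    field_simp at h
    nlinarith
  have hn : a * b * p + c * d = p * (p - 1) * (q - 1) := by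
    have : ((a * b * p + c * d : ℕ) : ℚ) = ((p * (p - 1) * (q - 1) : ℕ) : ℚ) := by
      push_cast [Nat.cast_sub (show 1 ≤ p by omega), Nat.cast_sub (show 1 ≤ q by omega)]
      linarith
    exact_mod_cast this
  have e2 : p ^ 2 - p = p * (p - 1) := by rw [Nat.mul_sub, pow_two]; simp
  rw [e2] at hc ⊢
  have hpos : 0 < p * (p - 1) := by apply Nat.mul_pos <;> omega
  have t1 : a * b * p ≤ p * (p - 1) * b := by
    calc a * b * p = a * (b * p) := by ring
      _ ≤ (p - 1) * (b * p) := Nat.mul_le_mul_right _ ha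
      _ = _ := by ring
  constructor
  · by_contra hh
    push Not at hh
    have t2 : c * d ≤ p * (p - 1) * d := by
      by_cases hd : d = 0
      · subst hd; simp
      · exact Nat.mul_le_mul_right _ (hc hd)
    have : p * (p - 1) * (b + d) < p * (p - 1) * (q - 1) := Nat.mul_lt_mul_of_pos_left hh hpos
    rw [mul_add] at this
    omega
  · intro hbd hd
    by_contra hh
    push Not at hh
    have t2 : c * d < p * (p - 1) * d := Nat.mul_lt_mul_of_pos_right hh (by omega)
    have : p * (p - 1) * (b + d) ≤ p * (p - 1) * (q - 1) := Nat.mul_le_mul_left _ hbd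
    rw [mul_add] at this
    omega

end

end


section
open Finset
set_option linter.unusedSectionVars false

section
variable {X Y Z : Type} [Fintype X] [Fintype Y] [Fintype Z]
  [DecidableEq X] [DecidableEq Y] [DecidableEq Z]
  {lx : X → ℕ} {ly : Y → ℕ} {lz : Z → ℕ} {p q r : ℕ} {A B : Finset (X × Y × Z)}

lemma num2 {p q r : ℕ} (hp : 3 ≤ p) (hpq : p < q) (hr : 3 ≤ r) {a b c d : ℕ} (ha : a ≤ p - 1)
    (hb : b ≤ p - 1) (hcd : c * d ≤ (p ^ 2 - p) * (q - 1 - b))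
    (h : (a * b : ℚ) / (ww p 1 * ww q 1 * ww r 2) + (c * d : ℚ) / (ww p 0 * ww q 1 * ww r 1) = 1) :
    False := by
  obtain ⟨p, rfl⟩ : ∃ p', p = p' + 1 := ⟨p - 1, by omega⟩
  obtain ⟨q, rfl⟩ : ∃ p', q = p' + 1 := ⟨q - 1, by omega⟩
  obtain ⟨r, rfl⟩ : ∃ p', r = p' + 2 := ⟨r - 2, by omega⟩
  simp only [Nat.add_sub_cancel] at *
  obtain ⟨e, rfl⟩ : ∃ e, q = b + e + 1 := ⟨q - b - 1, by omega⟩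
  have e2 : (p + 1) ^ 2 - (p + 1) = (p + 1) * p := by
    rw [show (p + 1) ^ 2 = (p + 1) * p + (p + 1) by ring]; omega
  rw [e2, show b + e + 1 - b = e + 1 by omega] at hcd
  simp only [ww] at h
  norm_num at h
  have p0 : (0:ℚ) < p := by exact_mod_cast (by omega : 0 < p)
  have e3 : ((p:ℚ) + 1) ^ 2 - (p + 1) = (p + 1) * p := by ring
  have e4 : (r:ℚ) + 2 - 1 = r + 1 := by ring
  rw [e3, e4] at h
  have h' : (a * b * (p + 1) * (r + 1) + c * d : ℚ) = (p + 1) * p * (b + e + 1) * (r + 1) := by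
    have h5 : (0:ℚ) < p + 1 := by positivity
    have h6 : (0:ℚ) < b + e + 1 := by positivity
    have h7 : (0:ℚ) < r + 1 := by positivity
    field_simp at h
    linarith
  have hn : a * b * (p + 1) * (r + 1) + c * d = (p + 1) * p * (b + e + 1) * (r + 1) := by
    exact_mod_cast h'
  have t1 : a * b * (p + 1) * (r + 1) ≤ (p + 1) * p * b * (r + 1) := by
    calc a * b * (p + 1) * (r + 1) = a * (b * (p + 1) * (r + 1)) := by ring
      _ ≤ p * (b * (p + 1) * (r + 1)) := Nat.mul_le_mul_right _ ha
      _ = _ := by ring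
  have : (p + 1) * p * (b + e + 1) * (r + 1) ≤ (p + 1) * p * b * (r + 1) + (p + 1) * p * (e + 1) := by
    omega
  have h8 : 0 < (p + 1) * p * (e + 1) * r := by
    have : 0 < p := by omega
    have : 0 < r := by omega
    positivity
  have : (p + 1) * p * (b + e + 1) * (r + 1) = (p + 1) * p * b * (r + 1) + (p + 1) * p * (e + 1) +
    (p + 1) * p * (e + 1) * r := by ring
  omega

variable {x : X} {y : Y} {z1 z2 : Z}

lemma Cr.be112 (C : Cr lx ly lz p q r A B x y z1 z2) (b1 : X) (b2 : Y) (b3 : Z) :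
    Nn lx ly lz B 1 1 2 (b1, b2, b3) ≤ p - 1 := by
  rw [← C.H.cx.cardPun b1]
  refine card_le_card_of_injOn (fun t => t.1) ?_ ?_
  · rintro ⟨a1, a2, a3⟩ ha
    simp only [coe_filter, Set.mem_ofPred_eq, vv_one, vv_two, mem_univ, true_and] at ha ⊢
    exact ha.2.1
  · rintro ⟨a1, a2, a3⟩ ha ⟨c1, c2, c3⟩ hc e
    simp only [coe_filter, Set.mem_ofPred_eq, vv_one, vv_two] at ha hc e
    obtain ⟨ha, h1, h2, rfl⟩ := ha
    obtain ⟨hc, g1, g2, rfl⟩ := hc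
    subst e
    have := C.n212 ha hc (by rw [← h2.2, g2.2])
    rw [this]

/-- the `C3` alternative is impossible -/
lemma Cr.noC3 (C : Cr lx ly lz p q r A B x y z1 z2) {y2 : Y} (hy : ly y2 = ly y) (hyn : y2 ≠ y)
    {b1 d1 : X} {b2 d2 : Y} {b3 : Z}
    (hb : (b1, b2, b3) ∈ B) (hd : (d1, d2, b3) ∈ B)
    (hd1 : lx d1 = lx b1) (hd2 : ly d2 = ly b2) (hd1n : d1 ≠ b1) (hd2n : d2 ≠ b2)
    {a1 c1 : X} {c2 : Y} {c3 : Z} (ha : (a1, y, z1) ∈ A) (hax : lx a1 ≠ lx x)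
    (hc : (c1, c2, c3) ∈ B) (hc1 : lx c1 ≠ lx b1) (hc2 : ly c2 = ly b2) (hc2n : c2 ≠ b2)
    (hc3 : lz c3 = lz b3) (hc3n : c3 ≠ b3) : False := by
  have hz := C.hz
  have hzn := C.hzn
  have H := C.H
  obtain ⟨t, ht1, ht2, ht3⟩ := C.H.cx.third x x
  have A012 : Dv lx ly lz A 0 1 2 := ⟨_, _, _, _, _, _, ha, C.S1 y2 hy hyn, vv_zero.2 hax,
    vv_one.2 ⟨hyn.symm, hy.symm⟩, vv_two.2 rfl⟩
  have A021 : Dv lx ly lz A 0 2 1 := ⟨_, _, _, _, _, _, ha, C.S2 t ht1 ht2, vv_zero.2 (by rw [ht1]; exact hax),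
    vv_two.2 rfl, vv_one.2 ⟨hzn, hz⟩⟩
  have A121 : Dv lx ly lz A 1 2 1 := by
    rcases C.tri with h | ⟨_, _, z3, k1, k2, k3, k4⟩ | ⟨_, _, k⟩
    · exact ⟨_, _, _, _, _, _, h.1, C.S2 t ht1 ht2, vv_one.2 ⟨ht2.symm, ht1.symm⟩, vv_two.2 rfl, vv_one.2 ⟨hzn, hz⟩⟩
    · obtain ⟨t', ht1', ht2', ht3'⟩ := C.H.cx.third x t
      exact ⟨_, _, _, _, _, _, k4 t ht1 ht2, C.S2 t' ht1' ht2', vv_one.2 ⟨ht3'.symm, by rw [ht1, ht1']⟩,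
        vv_two.2 rfl, vv_one.2 ⟨k3, k1⟩⟩
    · obtain ⟨z3, m1, m2, m3⟩ := C.H.cz.third z2 z1
      have := H.sd (k z3 m1 m2 y2 hy hyn) ha hb hc (by grind) (by grind) (by grind)
      grind
  have n012 : ¬ Dv lx ly lz B 0 1 2 := fun h => by have := H.nd A012 h; omega
  have n021 : ¬ Dv lx ly lz B 0 2 1 := fun h => by have := H.nd A021 h; omega
  have n121 : ¬ Dv lx ly lz B 1 2 1 := fun h => by have := H.nd A121 h; omega
  have cl := fun {a1 a2 a3 c1 c2 c3} ha hc => C.cls12 (a1 := a1) (a2 := a2) (a3 := a3) (c1 := c1)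
    (c2 := c2) (c3 := c3) hy hyn ha hb hc hd hd1 hd2 hd1n hd2n
  have s := H.supp2 x b1 y2 b2 z2 b3 (1, 1, 2) (0, 1, 1) (by decide) (by decide) (by decide) (by
    intro a1 a2 a3 c1 c2 c3 ha hc e1 e2 e3
    rcases cl ha hc e1 e2 e3 with ⟨rfl, rfl, h1, h2⟩ | ⟨rfl, rfl, h1⟩ | ⟨rfl, rfl, h1⟩
    · left
      simp only [Prod.mk.injEq, vv_one, vv_two]
      grind
    · exfalso
      exact n012 ⟨_, _, _, _, _, _, hb, hc, vv_zero.2 (by grind), vv_one.2 (by grind), vv_two.2 (by grind)⟩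
    · right
      simp only [Prod.mk.injEq, vv_zero, vv_one]
      grind)
  simp only [tm] at s
  refine num2 H.cx.three C.lt H.cz.three (C.al112 hy) (C.be112 b1 b2 b3) ?_ s
  have aform : ∀ t ∈ A.filter (fun t => vv lx x t.1 = 0 ∧ vv ly y2 t.2.1 = 1 ∧ vv lz z2 t.2.2 = 1),
      ∃ u, lx x ≠ lx u ∧ (u, y, z1) = t := by
    rintro ⟨a1, a2, a3⟩ ha
    simp only [mem_filter, vv_zero, vv_one] at ha
    obtain ⟨ha, h1, h2, h3⟩ := ha
    rcases cl ha hc (by grind) (by grind) (by grind) with ⟨rfl, rfl, k1, k2⟩ | ⟨rfl, rfl, k1⟩ | ⟨rfl, rfl, k1⟩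
    · grind
    · grind
    · exact ⟨a1, h1, rfl⟩
  by_cases h022 : Dv lx ly lz B 0 2 2
  · have hA : Nn lx ly lz A 0 1 1 (x, y2, z2) ≤ p := by
      rw [← H.cx.fib a1]
      refine le_trans (card_le_card ?_) (card_image_le (f := fun t => (t, y, z1)))
      intro t ht
      obtain ⟨u, hu, rfl⟩ := aform t ht
      have hu2 := (mem_filter.1 ht).1
      simp only [mem_image, mem_filter, mem_univ, true_and, Prod.mk.injEq, and_true]
      refine ⟨u, ?_, rfl⟩
      by_contra hh
      have := H.nd ⟨_, _, _, _, _, _, hu2, ha, vv_zero.2 hh, vv_two.2 rfl, vv_two.2 rfl⟩ h022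
      omega
    have hB : Nn lx ly lz B 0 1 1 (b1, b2, b3) ≤ (p - 1) * (q - 1 - Nn lx ly lz B 1 1 2 (b1, b2, b3)) := by
      set P := B.filter (fun t => vv lx b1 t.1 = 1 ∧ vv ly b2 t.2.1 = 1 ∧ vv lz b3 t.2.2 = 2) with hP
      set K := univ.filter (fun t => b2 ≠ t ∧ ly b2 = ly t) with hK
      have c1 : ((univ.image lx).erase (lx b1)).card = p - 1 := by
        rw [card_erase_of_mem (by simp), H.cx.cardImg]
      have hsub : P.image (fun t => t.2.1) ⊆ K := by
        intro v hv
        simp only [hP, mem_image, mem_filter, vv_one, vv_two] at hv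
        obtain ⟨w, hw, rfl⟩ := hv
        simp only [hK, mem_filter, mem_univ, true_and]
        exact hw.2.2.1
      have hinj : (P.image (fun t => t.2.1)).card = P.card := by
        apply card_image_of_injOn
        rintro ⟨u1, u2, u3⟩ hu ⟨v1, v2, v3⟩ hv e
        simp only [hP, coe_filter, Set.mem_ofPred_eq, vv_one, vv_two] at hu hv e
        obtain ⟨hu, h1, h2, rfl⟩ := hu
        obtain ⟨hv, g1, g2, rfl⟩ := hv
        subst e
        have := C.n122 hu hv (by rw [← h1.2, g1.2])
        rw [this]
      have c2 : (K \ P.image (fun t => t.2.1)).card = q - 1 - Nn lx ly lz B 1 1 2 (b1, b2, b3) := by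
        rw [card_sdiff_of_subset hsub, hinj, hK, H.cy.cardPun]; rfl
      rw [← c1, ← c2, ← card_product]
      refine card_le_card_of_injOn (fun t => (lx t.1, t.2.1)) ?_ ?_
      · rintro ⟨u1, u2, u3⟩ hu
        simp only [coe_filter, Set.mem_ofPred_eq, vv_zero, vv_one] at hu
        obtain ⟨hu, h1, h2, h3⟩ := hu
        simp only [coe_product, Set.mem_prod, mem_coe, mem_erase, mem_image, mem_univ, true_and,
          mem_sdiff, hK, mem_filter]
        refine ⟨⟨h1.symm, u1, rfl⟩, h2, ?_⟩
        rintro ⟨⟨v1, v2, v3⟩, hv, e⟩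
        simp only [hP, mem_filter, vv_one, vv_two] at hv e
        obtain ⟨hv, g1, g2, rfl⟩ := hv
        subst e
        exact n021 ⟨_, _, _, _, _, _, hu, hv, vv_zero.2 (by grind), vv_two.2 rfl, vv_one.2 (by grind)⟩
      · rintro ⟨u1, u2, u3⟩ hu ⟨v1, v2, v3⟩ hv e
        simp only [coe_filter, Set.mem_ofPred_eq, vv_one, vv_zero, Prod.mk.injEq] at hu hv e
        obtain ⟨hu, h1, h2, h3⟩ := hu
        obtain ⟨hv, g1, g2, g3⟩ := hv
        obtain ⟨e1, rfl⟩ := e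
        have e3 : lz u3 = lz v3 := by rw [← h3.2, g3.2]
        by_cases k1 : u1 = v1
        · subst k1
          rw [C.n221 hu hv e3]
        · by_cases k3 : u3 = v3
          · subst k3
            exact absurd (C.n122 hu hv e1) k1
          · exact absurd ⟨_, _, _, _, _, _, hu, hv, vv_one.2 ⟨k1, e1⟩, vv_two.2 rfl, vv_one.2 ⟨k3, e3⟩⟩ n121
    have e2 : p ^ 2 - p = p * (p - 1) := by rw [Nat.mul_sub, pow_two]; simp
    rw [e2, mul_assoc]
    exact Nat.mul_le_mul hA hB
  · have hA : Nn lx ly lz A 0 1 1 (x, y2, z2) ≤ p ^ 2 - p := by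
      rw [← H.cx.cardOff x]
      refine le_trans (card_le_card ?_) (card_image_le (f := fun t => (t, y, z1)))
      intro t ht
      obtain ⟨u, hu, rfl⟩ := aform t ht
      simp only [mem_image, mem_filter, mem_univ, true_and, Prod.mk.injEq, and_true]
      exact ⟨u, hu, rfl⟩
    have hB : Nn lx ly lz B 1 1 2 (b1, b2, b3) + Nn lx ly lz B 0 1 1 (b1, b2, b3) ≤ q - 1 := by
      rw [← C.H.cy.cardPun b2]
      unfold Nn
      rw [← card_union_of_disjoint]
      · refine card_le_card_of_injOn (fun t => t.2.1) ?_ ?_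
        · rintro ⟨a1, a2, a3⟩ ha
          simp only [coe_union, coe_filter, Set.mem_union, Set.mem_ofPred_eq, vv_zero, vv_one, vv_two,
            mem_univ, true_and] at ha ⊢
          tauto
        · rintro ⟨u1, u2, u3⟩ ha ⟨v1, v2, v3⟩ hc e
          simp only [coe_union, coe_filter, Set.mem_union, Set.mem_ofPred_eq, vv_zero, vv_one, vv_two] at ha hc e
          subst e
          have hu : (u1, u2, u3) ∈ B := by tauto
          have hv : (v1, u2, v3) ∈ B := by tauto
          have e3 : lz u3 = lz v3 := by grind
          clear s aform cl hd ha hc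
          by_cases k3 : u3 = v3
          · subst k3
            by_cases k1 : lx u1 = lx v1
            · rw [C.n122 hu hv k1]
            · exact absurd ⟨_, _, _, _, _, _, hu, hv, vv_zero.2 k1, vv_two.2 rfl, vv_two.2 rfl⟩ h022
          · by_cases k1 : lx u1 = lx v1
            · by_cases k2 : u1 = v1
              · subst k2; exact absurd (C.n221 hu hv e3) k3
              · exact absurd ⟨_, _, _, _, _, _, hu, hv, vv_one.2 ⟨k2, k1⟩, vv_two.2 rfl, vv_one.2 ⟨k3, e3⟩⟩ n121
            · exact absurd ⟨_, _, _, _, _, _, hu, hv, vv_zero.2 k1, vv_two.2 rfl, vv_one.2 ⟨k3, e3⟩⟩ n021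
      · rw [disjoint_left]
        intro a h1 h2
        simp only [mem_filter] at h1 h2
        omega
    exact Nat.mul_le_mul hA (by omega)

lemma Cr.step2 (C : Cr lx ly lz p q r A B x y z1 z2) (hB : Dv lx ly lz B 1 1 2) :
    (∀ u, lx u ≠ lx x → (u, y, z2) ∈ A) ∧ Dv lx ly lz B 0 1 2 := by
  obtain ⟨b1, b2, b3, d1, d2, d3, hb, hd, k1, k2, k3⟩ := hB
  rw [vv_one] at k1 k2
  rw [vv_two] at k3
  subst k3
  have H := C.H
  obtain ⟨y2, hy, hyn, -⟩ := C.H.cy.third y y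
  obtain ⟨t, ht1, ht2, -⟩ := C.H.cx.third x x
  have cl := fun {a1 a2 a3 c1 c2 c3} ha hc => C.cls12 (a1 := a1) (a2 := a2) (a3 := a3) (c1 := c1)
    (c2 := c2) (c3 := c3) hy hyn ha hb hc hd k1.2.symm k2.2.symm k1.1.symm k2.1.symm
  have hz := C.hz
  have hzn := C.hzn
  have s := H.supp2 x b1 y2 b2 z2 b3 (1, 1, 2) (0, 1, 2) (by decide) (by decide) (by decide) (by
    intro a1 a2 a3 c1 c2 c3 ha hc e1 e2 e3
    rcases cl ha hc e1 e2 e3 with ⟨rfl, rfl, h1, h2⟩ | ⟨rfl, rfl, h1⟩ | ⟨rfl, rfl, h1⟩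
    · left
      simp only [Prod.mk.injEq, vv_one, vv_two]
      grind
    · right
      simp only [Prod.mk.injEq, vv_zero, vv_one, vv_two]
      grind
    · exfalso
      exact C.noC3 hy hyn hb hd k1.2.symm k2.2.symm k1.1.symm k2.1.symm ha h1 hc (by grind) (by grind)
        (by grind) (by grind) (by grind))
  simp only [tm] at s
  have hq := C.lt
  have hp3 := H.cx.three
  have hbe := C.be112 b1 b2 b3
  have hal := C.al112 (y2 := y2) hy
  have hcd : Nn lx ly lz A 0 1 2 (x, y2, z2) * Nn lx ly lz B 0 1 2 (b1, b2, b3) ≠ 0 := by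
    intro h0
    have h0' : (Nn lx ly lz A 0 1 2 (x, y2, z2) * Nn lx ly lz B 0 1 2 (b1, b2, b3) : ℚ) = 0 := by
      exact_mod_cast h0
    rw [h0'] at s
    have := (num1 (r := r) H.cx.three H.cy.three (c := 0) (d := 0) hal (by simp) (by simpa using s)).1
    omega
  have hd0 : Nn lx ly lz B 0 1 2 (b1, b2, b3) ≠ 0 := right_ne_zero_of_mul hcd
  have hc0 : Nn lx ly lz A 0 1 2 (x, y2, z2) ≠ 0 := left_ne_zero_of_mul hcd
  obtain ⟨⟨c1, c2, c3⟩, hc, e⟩ := Nn_pos.1 hd0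
  simp only [ty, Prod.mk.injEq, vv_zero, vv_one, vv_two] at e
  have form : ∀ a1 a2, (a1, a2, z2) ∈ A → lx x ≠ lx a1 → ly y2 = ly a2 → y2 ≠ a2 → a2 = y := by
    intro a1 a2 ha h1 h2 h3
    rcases cl ha hc (by grind) (by grind) (by grind) with ⟨h, rfl, k1, k2⟩ | ⟨h, rfl, k1⟩ | ⟨h, rfl, k1⟩ <;> rfl
  have A022 : Dv lx ly lz A 0 2 2 := by
    obtain ⟨⟨a1, a2, a3⟩, ha, e'⟩ := Nn_pos.1 hc0
    simp only [ty, Prod.mk.injEq, vv_zero, vv_one, vv_two] at e'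
    obtain ⟨f1, f2, rfl⟩ := e'
    have := form a1 a2 ha f1 f2.2 f2.1
    subst this
    exact ⟨_, _, _, _, _, _, ha, C.S2 t ht1 ht2, vv_zero.2 (by rw [ht1]; exact f1.symm), vv_two.2 rfl, vv_two.2 rfl⟩
  have := C.al012 form
  refine ⟨this.2 ?_, ⟨_, _, _, _, _, _, hb, hc, vv_zero.2 e.1, vv_one.2 e.2.1, vv_two.2 e.2.2⟩⟩
  exact (num1 (r := r) H.cx.three H.cy.three hal (fun _ => this.1) s).2 (C.be2 A022 b1 b2 b3) hd0

end

end


section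
open Finset
set_option linter.unusedSectionVars false

section
variable {X Y Z : Type} [Fintype X] [Fintype Y] [Fintype Z]
  [DecidableEq X] [DecidableEq Y] [DecidableEq Z]
  {lx : X → ℕ} {ly : Y → ℕ} {lz : Z → ℕ} {p q r : ℕ} {A B : Finset (X × Y × Z)}

lemma Vt0one (l : X → ℕ) : Vt l 0 (fun _ => (1:ℚ)) := ⟨1, fun _ => rfl⟩

lemma Vt1ind {l : X → ℕ} (c : Coord X l p) (x : X) :
    Vt l 1 (fun t => (p:ℚ) * (if l t = l x then 1 else 0) - 1) := by
  refine ⟨fun t t' h => by simp [h], ?_⟩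
  rw [sum_sub_distrib, ← mul_sum, ← sum_filter]
  simp [c.fib x, c.card]; ring

lemma Vt2diff {l : X → ℕ} {x x' : X} (h : l x = l x') :
    Vt l 2 (fun t => (if t = x then (1:ℚ) else 0) - (if t = x' then 1 else 0)) := by
  intro t
  rw [sum_sub_distrib]
  simp only [sum_ite_eq', mem_filter, mem_univ, true_and, h]
  simp

lemma Coord.marg1 {α : Type} {l : X → ℕ} (c : Coord X l p) (T : Finset α) (π : α → X)
    (h : ∀ f, Vt l 1 f → ∑ t ∈ T, f (π t) = 0) (x : X) :
    p * (T.filter (fun t => l (π t) = l x)).card = T.card := by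
  have := h _ (Vt1ind c x)
  rw [sum_sub_distrib, ← mul_sum, ← sum_filter] at this
  simp at this
  have : (p:ℚ) * (T.filter (fun t => l (π t) = l x)).card = T.card := by linarith
  exact_mod_cast this

lemma Coord.marg2 {α : Type} {l : X → ℕ} (T : Finset α) (π : α → X)
    (h : ∀ f, Vt l 2 f → ∑ t ∈ T, f (π t) = 0) {x x' : X} (e : l x = l x') :
    (T.filter (fun t => π t = x)).card = (T.filter (fun t => π t = x')).card := by
  have := h _ (Vt2diff e)
  rw [sum_sub_distrib, ← sum_filter, ← sum_filter] at this
  simp at this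
  have : ((T.filter (fun t => π t = x)).card : ℚ) = (T.filter (fun t => π t = x')).card := by linarith
  exact_mod_cast this

lemma Coord.marg2' {α : Type} {l : X → ℕ} (c : Coord X l p) (T : Finset α) (π : α → X)
    (h : ∀ f, Vt l 2 f → ∑ t ∈ T, f (π t) = 0) (x : X) :
    (T.filter (fun t => l (π t) = l x)).card = p * (T.filter (fun t => π t = x)).card := by
  rw [card_eq_sum_card_fiberwise (f := π) (t := univ.filter (fun t => l t = l x))]
  · rw [sum_congr rfl (g := fun _ => (T.filter (fun t => π t = x)).card), sum_const, c.fib x]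
    · rfl
    · intro u hu
      simp only [mem_filter, mem_univ, true_and] at hu
      rw [← Coord.marg2 T π h hu, filter_filter]
      congr 1
      ext t
      simp only [mem_filter]
      constructor
      · tauto
      · rintro ⟨h1, rfl⟩; exact ⟨h1, hu, rfl⟩
  · intro t ht
    simpa using (mem_filter.1 ht).2

lemma Coord.not_both {α : Type} {l : X → ℕ} (c : Coord X l p) (T : Finset α) (π : α → X)
    (h1 : ∀ f, Vt l 1 f → ∑ t ∈ T, f (π t) = 0)
    (h2 : ∀ f, Vt l 2 f → ∑ t ∈ T, f (π t) = 0) : p ^ 2 ∣ T.card := by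
  have : Nonempty X := by
    rw [← Fintype.card_pos_iff, c.card]; have := c.three; positivity
  obtain ⟨x⟩ := this
  rw [← c.marg1 T π h1 x, c.marg2' T π h2 x, ← mul_assoc, pow_two]
  exact dvd_mul_right _ _

lemma Cub.mx {e : ℕ} {T : Finset (X × Y × Z)} (h : Cub lx ly lz e 0 0 T) :
    ∀ f, Vt lx e f → ∑ t ∈ T, f t.1 = 0 := by
  intro f hf
  simpa using h f _ _ hf (Vt0one ly) (Vt0one lz)

lemma Cub.my {e : ℕ} {T : Finset (X × Y × Z)} (h : Cub lx ly lz 0 e 0 T) :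
    ∀ f, Vt ly e f → ∑ t ∈ T, f t.2.1 = 0 := by
  intro f hf
  simpa using h _ f _ (Vt0one lx) hf (Vt0one lz)

lemma Cub.mz {e : ℕ} {T : Finset (X × Y × Z)} (h : Cub lx ly lz 0 0 e T) :
    ∀ f, Vt lz e f → ∑ t ∈ T, f t.2.2 = 0 := by
  intro f hf
  simpa using h _ _ f (Vt0one lx) (Vt0one ly) hf

lemma sqndvd {p q r : ℕ} (hp : p.Prime) (hq : q.Prime) (hr : r.Prime) (h1 : p ≠ q) (h2 : p ≠ r) :
    ¬ p ^ 2 ∣ p * q * r := by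
  rw [pow_two, mul_assoc, Nat.mul_dvd_mul_iff_left hp.pos, hp.dvd_mul,
    Nat.prime_dvd_prime_iff_eq hp hq, Nat.prime_dvd_prime_iff_eq hp hr]
  tauto

/-- plane bound in the second coordinate -/
lemma Tile.plane (H : Tile lx ly lz p q r A B) (y : Y) :
    (A.filter (fun t => t.2.1 = y)).card ≤ p * r := by
  have hq0 := H.cy.prime.pos
  have hA := H.cardA
  rw [show p * q * r = q * (p * r) by ring] at hA
  by_cases h1 : Cub lx ly lz 0 1 0 A
  · have := H.cy.marg1 A (fun t => t.2.1) h1.my y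
    rw [hA] at this
    have := Nat.eq_of_mul_eq_mul_left hq0 this
    rw [← this]
    refine card_le_card fun t ht => ?_
    simp only [mem_filter] at ht ⊢
    exact ⟨ht.1, by rw [ht.2]⟩
  by_cases h2 : Cub lx ly lz 0 2 0 A
  · have h3 := H.cy.marg2' A (fun t => t.2.1) h2.my y
    have h4 : (A.filter (fun t => ly t.2.1 = ly y)).card ≤ A.card := card_filter_le _ _
    rw [hA, h3] at h4
    exact Nat.le_of_mul_le_mul_left h4 hq0
  exfalso
  have g1 := (H.dich 0 1 0 (by simp) (by simp) (by simp) (by simp)).resolve_left h1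
  have g2 := (H.dich 0 2 0 (by simp) (by simp) (by simp) (by simp)).resolve_left h2
  have := H.cy.not_both B (fun t => t.2.1) g1.my g2.my
  rw [H.cardB, show p * q * r = q * p * r by ring] at this
  exact sqndvd H.cy.prime H.cx.prime H.cz.prime H.hpq.symm H.hqr this

lemma Tile.zclass (H : Tile lx ly lz p q r A B) (z : Z) {T : Finset (X × Y × Z)}
    (h : Cub lx ly lz 0 0 1 T) (hT : T.card = p * q * r) :
    (T.filter (fun t => lz t.2.2 = lz z)).card = p * q := by
  have := H.cz.marg1 T (fun t => t.2.2) h.mz z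
  rw [hT, mul_comm] at this
  exact Nat.eq_of_mul_eq_mul_right H.cz.prime.pos this

end

end


section
open Finset
set_option linter.unusedSectionVars false

section
variable {X Y Z : Type} [Fintype X] [Fintype Y] [Fintype Z]
  [DecidableEq X] [DecidableEq Y] [DecidableEq Z]
  {lx : X → ℕ} {ly : Y → ℕ} {lz : Z → ℕ} {p q r : ℕ} {A B : Finset (X × Y × Z)}
  {x : X} {y : Y} {z1 z2 : Z}

lemma num3 {p q r : ℕ} (hp : 3 ≤ p) (hr : 3 ≤ r) {a b c d : ℕ} (ha : b ≠ 0 → a ≤ p - 1)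
    (hc : d ≠ 0 → c ≤ p ^ 2 - p)
    (h : (a * b : ℚ) / (ww p 1 * ww q 2 * ww r 1) + (c * d : ℚ) / (ww p 0 * ww q 2 * ww r 1) = 1) :
    r - 1 ≤ b + d := by
  rw [mul_right_comm, mul_right_comm (ww p 0)] at h
  by_cases hb : b = 0
  · subst hb
    exact (num1 (p := p) (q := r) (r := q) (a := 0) (b := 0) hp hr (by simp) hc (by simpa [ww] using h)).1
  · exact (num1 (p := p) (q := r) (r := q) hp hr (ha hb) hc (by simpa [ww] using h)).1

lemma Cr.A022 (C : Cr lx ly lz p q r A B x y z1 z2) (N : ∀ u, lx u ≠ lx x → (u, y, z2) ∈ A)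
    {u : X} (hu : lx u ≠ lx x) : Dv lx ly lz A 0 2 2 := by
  obtain ⟨t, ht1, ht2, -⟩ := C.H.cx.third x x
  exact ⟨_, _, _, _, _, _, N u hu, C.S2 t ht1 ht2, vv_zero.2 (by rw [ht1]; exact hu), vv_two.2 rfl, vv_two.2 rfl⟩

lemma Coord.off {l : X → ℕ} (c : Coord X l p) (x : X) : ∃ u, l u ≠ l x := by
  have h := c.cardOff x
  have h3 := c.three
  have : 0 < (univ.filter (fun t => l x ≠ l t)).card := by rw [h]; have : p < p ^ 2 := by nlinarith
                                                           omega
  obtain ⟨u, hu⟩ := card_pos.1 this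
  exact ⟨u, fun e => (mem_filter.1 hu).2 e.symm⟩

/-- classification for arbitrary `b` after step 2 -/
lemma Cr.cls3 (C : Cr lx ly lz p q r A B x y z1 z2) (N : ∀ u, lx u ≠ lx x → (u, y, z2) ∈ A)
    (B012 : Dv lx ly lz B 0 1 2) {y2 : Y} (hy : ly y2 = ly y) (hyn : y2 ≠ y)
    {a1 b1 c1 : X} {a2 b2 c2 : Y} {a3 b3 c3 : Z} (ha : (a1, a2, a3) ∈ A)
    (hb : (b1, b2, b3) ∈ B) (hc : (c1, c2, c3) ∈ B)
    (e1 : ((x = a1 ↔ b1 = c1) ∧ (lx x = lx a1 ↔ lx b1 = lx c1)))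
    (e2 : ((y2 = a2 ↔ b2 = c2) ∧ (ly y2 = ly a2 ↔ ly b2 = ly c2)))
    (e3 : ((z2 = a3 ↔ b3 = c3) ∧ (lz z2 = lz a3 ↔ lz b3 = lz c3))) :
    (a3 = z2 ∧ a2 = y ∧ a1 ≠ x ∧ lx a1 = lx x) ∨
    (a3 = z2 ∧ a2 = y ∧ lx a1 ≠ lx x) ∨
    (a3 = z2 ∧ a1 = x ∧ ly a2 ≠ ly y) ∨
    (a3 = z1 ∧ a1 = x ∧ ly a2 = ly y ∧ a2 ≠ y2) ∨
    (a3 = z1 ∧ a1 = x ∧ ly a2 ≠ ly y) := by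
  rcases C.cls hy hyn ha hb hc e1 e2 e3 with h | h | h | h | h | h | h | h
  · exact Or.inl h
  · exact Or.inr (Or.inl h)
  · exfalso
    have := C.H.nd (C.A022 N h.2.2) ⟨_, _, _, _, _, _, hb, hc, vv_zero.2 (by grind), vv_two.2 (by grind),
      vv_two.2 (by grind)⟩
    omega
  · exfalso
    obtain ⟨rfl, rfl, h⟩ := h
    have := C.H.nd ⟨_, _, _, _, _, _, ha, C.S1 y2 hy hyn, vv_zero.2 h, vv_one.2 ⟨hyn.symm, hy.symm⟩,
      vv_two.2 rfl⟩ B012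
    omega
  · exfalso
    obtain ⟨rfl, rfl, h⟩ := h
    obtain ⟨t, ht1, ht2, ht3⟩ := C.H.cy.third y a2
    have := C.H.nd ⟨_, _, _, _, _, _, ha, C.S1 t ht1 ht2, vv_zero.2 h, vv_one.2 ⟨ht3.symm, by rw [hy, ht1]⟩,
      vv_two.2 rfl⟩ B012
    omega
  · exact Or.inr (Or.inr (Or.inl h))
  · exact Or.inr (Or.inr (Or.inr (Or.inl h)))
  · exact Or.inr (Or.inr (Or.inr (Or.inr h)))

/-- at `(x,y,z1)` in case (b) -/
lemma Cr.clsE (C : Cr lx ly lz p q r A B x y z1 z2) (N : ∀ u, lx u ≠ lx x → (u, y, z2) ∈ A)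
    (hc1 : (x, y, z1) ∉ A)
    {a1 b1 c1 : X} {a2 b2 c2 : Y} {a3 b3 c3 : Z} (ha : (a1, a2, a3) ∈ A)
    (hb : (b1, b2, b3) ∈ B) (hc : (c1, c2, c3) ∈ B)
    (e1 : ((x = a1 ↔ b1 = c1) ∧ (lx x = lx a1 ↔ lx b1 = lx c1)))
    (e2 : ((y = a2 ↔ b2 = c2) ∧ (ly y = ly a2 ↔ ly b2 = ly c2)))
    (e3 : ((z1 = a3 ↔ b3 = c3) ∧ (lz z1 = lz a3 ↔ lz b3 = lz c3))) :
    a2 = y ∧ ((a1 = x ∧ lz a3 ≠ lz z1) ∨ (a3 = z2 ∧ a1 ≠ x)) := by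
  have hz := C.hz
  have hzn := C.hzn
  have F1 : a2 = y := by
    by_contra hh
    obtain ⟨t, ht1, ht2, ht3⟩ := C.H.cy.third y a2
    have := C.H.sd (C.S1 t ht1 ht2) ha hb hc e1 (by grind) e3
    tauto
  subst F1
  refine ⟨rfl, ?_⟩
  by_cases hx : a1 = x
  · subst hx
    left
    refine ⟨rfl, fun h => ?_⟩
    rcases C.hH with k | ⟨-, -, k⟩
    · exact hc1 k.1
    · rcases k a3 h with k | k
      · have := (k a1 a2 rfl rfl).1 ha; tauto
      · have := (k a1 a2 rfl rfl).1 ha; tauto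
  · right
    refine ⟨?_, hx⟩
    by_contra hh
    obtain ⟨t, ht1, ht2, ht3⟩ := C.H.cx.third x a1
    by_cases h1 : a3 = z1
    · subst h1
      have hx2 : lx a1 ≠ lx x := fun h => hx (C.P1 a1 a2 h rfl ha)
      have := C.H.nd (C.A022 N hx2) ⟨_, _, _, _, _, _, hb, hc, vv_zero.2 (by grind), vv_two.2 (by grind),
        vv_two.2 (by grind)⟩
      omega
    · have := C.H.sd (C.S2 t ht1 ht2) ha hb hc (by grind) e2 (by grind)
      tauto

set_option maxHeartbeats 1000000 in
/-- the sub-case with a type `(2,0,2)` exotic pair is impossible -/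
lemma Cr.noVI (C : Cr lx ly lz p q r A B x y z1 z2) (N : ∀ u, lx u ≠ lx x → (u, y, z2) ∈ A)
    (B012 : Dv lx ly lz B 0 1 2) (hc1 : (x, y, z1) ∉ A)
    (hk : ∀ z3, lz z3 = lz z2 → z3 ≠ z2 → ∀ t, ly t = ly y → t ≠ y → (x, t, z3) ∈ A)
    {w : Y} (hw : (x, w, z2) ∈ A) (hwy : ly w ≠ ly y)
    {b1 : X} {b2 b2' : Y} {b3 : Z} (hb : (b1, b2, b3) ∈ B) (hb' : (b1, b2', b3) ∈ B)
    (hbb : ly b2 ≠ ly b2') : False := by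
  have H := C.H
  have hz := C.hz
  have hzn := C.hzn
  obtain ⟨y2, hy, hyn, -⟩ := C.H.cy.third y y
  obtain ⟨z3, hz3, hz3n, hz3n'⟩ := C.H.cz.third z2 z1
  obtain ⟨t, ht1, ht2, -⟩ := C.H.cx.third x x
  -- the sat identity at b
  have s : tm lx ly lz p q r A B (x, y2, z2) (b1, b2, b3) (2, 0, 2) +
      tm lx ly lz p q r A B (x, y2, z2) (b1, b2, b3) (2, 2, 2) = 1 := by
    refine H.supp2 x b1 y2 b2 z2 b3 (2, 0, 2) (2, 2, 2) (by decide) (by decide) (by decide) ?_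
    intro a1 a2 a3 c1 c2 c3 ha hc e1 e2 e3
    left
    rcases C.cls3 N B012 hy hyn ha hb hc e1 e2 e3 with ⟨rfl, rfl, h1, h2⟩ | ⟨rfl, rfl, h1⟩ |
      ⟨rfl, rfl, h1⟩ | ⟨rfl, rfl, h1, h2⟩ | ⟨rfl, rfl, h1⟩
    · have := H.sd hw ha hb' hc (by grind) (by grind) (by grind)
      grind
    · have := H.sd hw ha hb' hc (by grind) (by grind) (by grind)
      grind
    · simp only [Prod.mk.injEq, vv_two, vv_zero]
      grind
    · have := H.sd (hk z3 hz3 hz3n y2 hy hyn) ha hb hc (by grind) (by grind) (by grind)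
      grind
    · have := H.sd (hk z3 hz3 hz3n y2 hy hyn) ha hb hc (by grind) (by grind) (by grind)
      grind
  have s222 : tm lx ly lz p q r A B (x, y2, z2) (b1, b2, b3) (2, 2, 2) = 0 := by
    have : Nn lx ly lz A 2 2 2 (x, y2, z2) = 0 := by
      by_contra h0
      obtain ⟨⟨u1, u2, u3⟩, hu, e⟩ := Nn_pos.1 h0
      rw [ty_two] at e
      rw [← e] at hu
      exact hyn (C.P2 x y2 rfl hy hu)
    simp [tm, this]
  rw [s222, add_zero] at s
  simp only [tm] at s
  have hal : Nn lx ly lz A 2 0 2 (x, y2, z2) ≤ q := by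
    rw [← H.cy.fib w]
    refine le_trans (card_le_card ?_) (card_image_le (f := fun t => (x, t, z2)))
    rintro ⟨u1, u2, u3⟩ hu
    simp only [mem_filter, vv_zero, vv_two] at hu
    obtain ⟨hu, rfl, h2, rfl⟩ := hu
    simp only [mem_image, mem_filter, mem_univ, true_and, Prod.mk.injEq, and_true]
    refine ⟨u2, ?_, rfl⟩
    by_contra hh
    have := H.nd ⟨_, _, _, _, _, _, hu, hw, vv_two.2 rfl, vv_zero.2 hh, vv_two.2 rfl⟩
      ⟨_, _, _, _, _, _, hb, hb', vv_two.2 rfl, vv_zero.2 hbb, vv_two.2 rfl⟩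
    omega
  have hbe : q - 1 ≤ Nn lx ly lz B 2 0 2 (b1, b2, b3) := by
    have hq3 := H.cy.three
    have q3 : (3:ℚ) ≤ q := by exact_mod_cast hq3
    simp only [ww] at s
    norm_num at s
    rw [div_eq_one_iff_eq (by nlinarith)] at s
    have s' : Nn lx ly lz A 2 0 2 (x, y2, z2) * Nn lx ly lz B 2 0 2 (b1, b2, b3) + q = q ^ 2 := by
      have : ((Nn lx ly lz A 2 0 2 (x, y2, z2) * Nn lx ly lz B 2 0 2 (b1, b2, b3) + q : ℕ) : ℚ) =
        (q ^ 2 : ℕ) := by push_cast; linarith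
      exact_mod_cast this
    have := Nat.mul_le_mul_right (Nn lx ly lz B 2 0 2 (b1, b2, b3)) hal
    by_contra hh
    push Not at hh
    obtain ⟨m, rfl⟩ : ∃ m, q = m + 1 := ⟨q - 1, by omega⟩
    have : Nn lx ly lz B 2 0 2 (b1, b2, b3) + 1 ≤ m := by omega
    nlinarith
  -- the line
  set Ln := B.filter (fun t => t.1 = b1 ∧ t.2.2 = b3) with hLn
  have hLc : q ≤ Ln.card := by
    have : insert (b1, b2, b3) (B.filter (fun t => vv lx b1 t.1 = 2 ∧ vv ly b2 t.2.1 = 0 ∧ vv lz b3 t.2.2 = 2)) ⊆ Ln := by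
      intro t ht
      simp only [mem_insert, mem_filter, vv_two, vv_zero] at ht
      rcases ht with rfl | ht
      · simp [hLn, hb]
      · simp only [hLn, mem_filter]; exact ⟨ht.1, ht.2.1.symm, ht.2.2.2.symm⟩
    have := card_le_card this
    rw [card_insert_of_notMem (by simp [vv_zero])] at this
    unfold Nn at hbe
    simp only at hbe
    omega
  have hLinj : (Ln.image (fun t => t.2.1)).card = Ln.card := by
    apply card_image_of_injOn
    rintro ⟨u1, u2, u3⟩ hu ⟨v1, v2, v3⟩ hv e
    simp only [hLn, coe_filter, Set.mem_ofPred_eq] at hu hv e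
    obtain ⟨-, rfl, rfl⟩ := hu
    obtain ⟨-, rfl, rfl⟩ := hv
    subst e; rfl
  -- every element of the line has many neighbours
  have hnb : ∀ v, (b1, v, b3) ∈ B → r ≤ (B.filter (fun t => lz t.2.2 = lz b3 ∧ t.2.1 = v)).card := by
    intro v hv
    have hf : ∃ v', (b1, v', b3) ∈ B ∧ ly v ≠ ly v' := by
      by_cases hvb : ly v = ly b2
      · exact ⟨b2', hb', by rw [hvb]; exact hbb⟩
      · exact ⟨b2, hb, hvb⟩
    obtain ⟨v', hv', hvv⟩ := hf
    have cl : ∀ {a1 a2 a3 c1 c2 c3}, (a1, a2, a3) ∈ A → (c1, c2, c3) ∈ B →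
      ((x = a1 ↔ b1 = c1) ∧ (lx x = lx a1 ↔ lx b1 = lx c1)) →
      ((y = a2 ↔ v = c2) ∧ (ly y = ly a2 ↔ ly v = ly c2)) →
      ((z1 = a3 ↔ b3 = c3) ∧ (lz z1 = lz a3 ↔ lz b3 = lz c3)) → a2 = y ∧ a3 = z2 ∧ a1 ≠ x := by
      intro a1 a2 a3 c1 c2 c3 ha hc e1 e2 e3
      obtain ⟨h1, h2 | h2⟩ := C.clsE N hc1 ha hv hc e1 e2 e3
      · have := H.sd hw ha hv' hc (by grind) (by grind) (by grind)
        grind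
      · exact ⟨h1, h2⟩
    have s3 := H.supp2 x b1 y v z1 b3 (1, 2, 1) (0, 2, 1) (by decide) (by decide) (by decide) (by
      intro a1 a2 a3 c1 c2 c3 ha hc e1 e2 e3
      obtain ⟨rfl, rfl, h1⟩ := cl ha hc e1 e2 e3
      simp only [Prod.mk.injEq, vv_one, vv_two, vv_zero]
      grind)
    simp only [tm] at s3
    have s4 := num3 H.cx.three H.cz.three (by
      intro h0
      obtain ⟨⟨c1, c2, c3⟩, hc, e⟩ := Nn_pos.1 h0
      simp only [ty, Prod.mk.injEq, vv_zero, vv_one, vv_two] at e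
      rw [← H.cx.cardPun x]
      refine le_trans (card_le_card ?_) (card_image_le (f := fun t => (t, y, z2)))
      rintro ⟨a1, a2, a3⟩ ha
      simp only [mem_filter, vv_one, vv_two] at ha
      obtain ⟨ha, h1, h2, h3⟩ := ha
      obtain ⟨rfl, rfl, h4⟩ := cl ha hc (by grind) (by grind) (by grind)
      simp only [mem_image, mem_filter, mem_univ, true_and, Prod.mk.injEq, and_true]
      exact ⟨a1, h1, rfl⟩) (by
      intro h0
      obtain ⟨⟨c1, c2, c3⟩, hc, e⟩ := Nn_pos.1 h0
      simp only [ty, Prod.mk.injEq, vv_zero, vv_one, vv_two] at e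
      rw [← H.cx.cardOff x]
      refine le_trans (card_le_card ?_) (card_image_le (f := fun t => (t, y, z2)))
      rintro ⟨a1, a2, a3⟩ ha
      simp only [mem_filter, vv_one, vv_two, vv_zero] at ha
      obtain ⟨ha, h1, h2, h3⟩ := ha
      obtain ⟨rfl, rfl, h4⟩ := cl ha hc (by grind) (by grind) (by grind)
      simp only [mem_image, mem_filter, mem_univ, true_and, Prod.mk.injEq, and_true]
      exact ⟨a1, h1, rfl⟩) s3
    have hsub : insert (b1, v, b3) ((B.filter (fun t => vv lx b1 t.1 = 1 ∧ vv ly v t.2.1 = 2 ∧ vv lz b3 t.2.2 = 1)) ∪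
        (B.filter (fun t => vv lx b1 t.1 = 0 ∧ vv ly v t.2.1 = 2 ∧ vv lz b3 t.2.2 = 1))) ⊆
        B.filter (fun t => lz t.2.2 = lz b3 ∧ t.2.1 = v) := by
      intro t ht
      simp only [mem_insert, mem_union, mem_filter, vv_two, vv_zero, vv_one] at ht ⊢
      rcases ht with rfl | ht | ht
      · exact ⟨hv, rfl, rfl⟩
      · exact ⟨ht.1, ht.2.2.2.2.symm, ht.2.2.1.symm⟩
      · exact ⟨ht.1, ht.2.2.2.2.symm, ht.2.2.1.symm⟩
    have := card_le_card hsub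
    rw [card_insert_of_notMem (by simp [vv_one]), card_union_of_disjoint] at this
    · unfold Nn at s4
      simp only at s4
      omega
    · rw [disjoint_left]
      intro a h1 h2
      simp only [mem_filter] at h1 h2
      omega
  have hBk : q * r ≤ (B.filter (fun t => lz t.2.2 = lz b3)).card := by
    rw [card_eq_sum_card_fiberwise (f := fun t => t.2.1) (t := univ) (by simp)]
    calc q * r ≤ (Ln.image (fun t => t.2.1)).card * r := Nat.mul_le_mul_right _ (by omega)
      _ = ∑ v ∈ Ln.image (fun t => t.2.1), r := by simp
      _ ≤ ∑ v ∈ Ln.image (fun t => t.2.1), ((B.filter (fun t => lz t.2.2 = lz b3)).filter (fun t => t.2.1 = v)).card := by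
          refine sum_le_sum fun v hv => ?_
          rw [filter_filter]
          apply hnb
          simp only [hLn, mem_image, mem_filter] at hv
          obtain ⟨⟨u1, u2, u3⟩, ⟨hu, rfl, rfl⟩, rfl⟩ := hv
          exact hu
      _ ≤ _ := sum_le_sum_of_subset (subset_univ _)
  -- lower bound on a line of A
  have hline : ∀ T : Finset (X × Y × Z), (∀ u, u ≠ x → (u, y, z2) ∈ T) → p ^ 2 - 1 ≤ T.card := by
    intro T hT
    have : (univ.erase x).image (fun u => (u, y, z2)) ⊆ T := by
      intro t ht
      simp only [mem_image, mem_erase] at ht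
      obtain ⟨u, hu, rfl⟩ := ht
      exact hT u hu.1
    have := card_le_card this
    rw [card_image_of_injective _ (by intro a b; simp), card_erase_of_mem (mem_univ _), card_univ,
      H.cx.card] at this
    exact this
  have hNA : ∀ u, u ≠ x → (u, y, z2) ∈ A := by
    intro u hu
    by_cases h : lx u = lx x
    · exact C.S2 u h hu
    · exact N u h
  have hp3 := H.cx.three
  have hq3 := H.cy.three
  have hr3 := H.cz.three
  have hpr : p < r := by
    have h1 := H.plane y
    have h2 := hline (A.filter (fun t => t.2.1 = y)) (fun u hu => by simp [hNA u hu])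
    have h3 := H.hpr
    have h4 : p ^ 2 ≤ p * r + 1 := by omega
    by_contra hh
    have : r + 1 ≤ p := by omega
    nlinarith
  rcases H.dich 0 0 1 (by simp) (by simp) (by simp) (by simp) with h | h
  · have h1 := H.zclass z2 h H.cardA
    have h2 : (p ^ 2 - 1) + (r - 1) * (q - 1) ≤ (A.filter (fun t => lz t.2.2 = lz z2)).card := by
      have e1 := hline (A.filter (fun t => t.2.2 = z2)) (fun u hu => by simp [hNA u hu])
      have e2 : (r - 1) * (q - 1) ≤ (A.filter (fun t => lz t.2.2 = lz z2 ∧ t.2.2 ≠ z2)).card := by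
        rw [← H.cz.cardPun z2, ← H.cy.cardPun y, ← card_product]
        refine card_le_card_of_injOn (fun t => (x, t.2, t.1)) ?_ ?_
        · rintro ⟨u, v⟩ huv
          simp only [coe_product, Set.mem_prod, mem_coe, mem_filter, mem_univ, true_and] at huv
          simp only [coe_filter, Set.mem_ofPred_eq]
          exact ⟨hk u huv.1.2.symm huv.1.1.symm v huv.2.2.symm huv.2.1.symm, huv.1.2.symm, huv.1.1.symm⟩
        · rintro ⟨u, v⟩ _ ⟨u', v'⟩ _ e
          simp only [Prod.mk.injEq, true_and] at e
          simp [e]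
      have e3 : (A.filter (fun t => t.2.2 = z2)) ∪ (A.filter (fun t => lz t.2.2 = lz z2 ∧ t.2.2 ≠ z2)) ⊆
          A.filter (fun t => lz t.2.2 = lz z2) := by
        intro t ht
        simp only [mem_union, mem_filter] at ht ⊢
        rcases ht with ht | ht
        · exact ⟨ht.1, by rw [ht.2]⟩
        · exact ⟨ht.1, ht.2.1⟩
      have e4 := card_le_card e3
      rw [card_union_of_disjoint] at e4
      · omega
      · rw [disjoint_left]
        intro a h1 h2
        simp only [mem_filter] at h1 h2
        tauto
    rw [h1] at h2
    obtain ⟨m, rfl⟩ : ∃ m, q = m + 1 := ⟨q - 1, by omega⟩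
    have h3 : p * m ≤ (r - 1) * m := Nat.mul_le_mul_right _ (by omega)
    simp only [Nat.add_sub_cancel] at h2
    have h4 : p ^ 2 - 1 ≤ p := by nlinarith
    have : p ^ 2 ≤ p + 1 := by omega
    nlinarith
  · have h1 := H.zclass b3 h H.cardB
    rw [h1] at hBk
    have : q * p < q * r := Nat.mul_lt_mul_of_pos_left hpr (by omega)
    nlinarith

end

end


section
open Finset
set_option linter.unusedSectionVars false

section
variable {X Y Z : Type} [Fintype X] [Fintype Y] [Fintype Z]
  [DecidableEq X] [DecidableEq Y] [DecidableEq Z]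
  {lx : X → ℕ} {ly : Y → ℕ} {lz : Z → ℕ} {p q r : ℕ} {A B : Finset (X × Y × Z)}
  {x : X} {y : Y} {z1 z2 : Z}

/-- only the two regular alternatives survive -/
lemma Cr.cls4 (C : Cr lx ly lz p q r A B x y z1 z2) (N : ∀ u, lx u ≠ lx x → (u, y, z2) ∈ A)
    (B012 : Dv lx ly lz B 0 1 2) {y2 : Y} (hy : ly y2 = ly y) (hyn : y2 ≠ y)
    {a1 b1 c1 : X} {a2 b2 c2 : Y} {a3 b3 c3 : Z} (ha : (a1, a2, a3) ∈ A)
    (hb : (b1, b2, b3) ∈ B) (hc : (c1, c2, c3) ∈ B)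
    (e1 : ((x = a1 ↔ b1 = c1) ∧ (lx x = lx a1 ↔ lx b1 = lx c1)))
    (e2 : ((y2 = a2 ↔ b2 = c2) ∧ (ly y2 = ly a2 ↔ ly b2 = ly c2)))
    (e3 : ((z2 = a3 ↔ b3 = c3) ∧ (lz z2 = lz a3 ↔ lz b3 = lz c3))) :
    (a3 = z2 ∧ a2 = y ∧ a1 ≠ x ∧ lx a1 = lx x) ∨
    (a3 = z2 ∧ a2 = y ∧ lx a1 ≠ lx x) := by
  have H := C.H
  have hz := C.hz
  have hzn := C.hzn
  have key : ¬ ((a3 = z2 ∧ a1 = x ∧ ly a2 ≠ ly y) ∨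
    (a3 = z1 ∧ a1 = x ∧ ly a2 = ly y ∧ a2 ≠ y2) ∨
    (a3 = z1 ∧ a1 = x ∧ ly a2 ≠ ly y)) := by
    rcases C.tri with h | ⟨h1, h2, z3, k1, k2, k3, k4⟩ | ⟨h1, h2, k⟩
    · rintro (⟨rfl, rfl, h1⟩ | ⟨rfl, rfl, h1, h2⟩ | ⟨rfl, rfl, h1⟩)
      · have := H.sd h.2 ha hb hc (by grind) (by grind) (by grind)
        grind
      · have := H.nd (C.A211a h.2) ⟨_, _, _, _, _, _, hb, hc, vv_two.2 (by grind), vv_one.2 (by grind),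
          vv_one.2 (by grind)⟩
        omega
      · have := H.sd h.2 ha hb hc (by grind) (by grind) (by grind)
        grind
    · obtain ⟨d1, d2, d3, f1, f2, f3, hd, hf, g1, g2, g3⟩ := H.pr x b1 y b2 z1 b3
      obtain ⟨rfl, g | g⟩ := C.clsE N h1 hd hb hf g1 g2 g3
      · obtain ⟨rfl, g⟩ := g
        rintro (⟨rfl, rfl, m1⟩ | ⟨rfl, rfl, m1, m2⟩ | ⟨rfl, rfl, m1⟩)
        · have := H.sd hd ha hf hc (by grind) (by grind) (by grind)
          grind
        · by_cases m : a2 = d2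
          · subst m; exact h1 ha
          · have := H.sd hd ha hf hc (by grind) (by grind) (by grind)
            grind
        · have := H.sd hd ha hf hc (by grind) (by grind) (by grind)
          grind
      · exfalso
        obtain ⟨t, ht1, ht2, ht3⟩ := H.cx.third x d1
        have := H.sd (k4 t ht1 ht2) hd hb hf (by grind) (by grind) (by grind)
        grind
    · obtain ⟨z3, hz3, hz3n, hz3n'⟩ := C.H.cz.third z2 z1
      rintro (⟨rfl, rfl, m1⟩ | ⟨rfl, rfl, m1, m2⟩ | ⟨rfl, rfl, m1⟩)
      · have q1 : b1 = c1 := by grind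
        have q3 : b3 = c3 := by grind
        subst q1 q3
        exact C.noVI N B012 h1 k ha m1 hb hc (by grind)
      · have := H.sd (k z3 hz3 hz3n y2 hy hyn) ha hb hc (by grind) (by grind) (by grind)
        grind
      · have := H.sd (k z3 hz3 hz3n y2 hy hyn) ha hb hc (by grind) (by grind) (by grind)
        grind
  rcases C.cls3 N B012 hy hyn ha hb hc e1 e2 e3 with h | h | h | h | h
  · exact Or.inl h
  · exact Or.inr h
  · exact absurd (Or.inl h) key
  · exact absurd (Or.inr (Or.inl h)) key
  · exact absurd (Or.inr (Or.inr h)) key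

lemma Cr.step3 (C : Cr lx ly lz p q r A B x y z1 z2) (N : ∀ u, lx u ≠ lx x → (u, y, z2) ∈ A)
    (B012 : Dv lx ly lz B 0 1 2) {b1 : X} {b2 : Y} {b3 : Z} (hb : (b1, b2, b3) ∈ B) :
    Nn lx ly lz B 1 1 2 (b1, b2, b3) + Nn lx ly lz B 0 1 2 (b1, b2, b3) = q - 1 := by
  have H := C.H
  obtain ⟨u, hu⟩ := H.cx.off x
  obtain ⟨y2, hy, hyn, -⟩ := C.H.cy.third y y
  refine le_antisymm (C.be2 (C.A022 N hu) b1 b2 b3) ?_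
  have cl := fun {a1 a2 a3 c1 c2 c3} ha hc => C.cls4 (a1 := a1) (a2 := a2) (a3 := a3) (c1 := c1)
    (c2 := c2) (c3 := c3) N B012 hy hyn ha hb hc
  have s := H.supp2 x b1 y2 b2 z2 b3 (1, 1, 2) (0, 1, 2) (by decide) (by decide) (by decide) (by
    intro a1 a2 a3 c1 c2 c3 ha hc e1 e2 e3
    rcases cl ha hc e1 e2 e3 with ⟨rfl, rfl, h1, h2⟩ | ⟨rfl, rfl, h1⟩
    · left
      simp only [Prod.mk.injEq, vv_one, vv_two]
      grind
    · right
      simp only [Prod.mk.injEq, vv_zero, vv_one, vv_two]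
      grind)
  simp only [tm] at s
  refine (num1 (r := r) H.cx.three H.cy.three (C.al112 hy) ?_ s).1
  intro hd0
  obtain ⟨⟨c1, c2, c3⟩, hc, e⟩ := Nn_pos.1 hd0
  simp only [ty, Prod.mk.injEq, vv_zero, vv_one, vv_two] at e
  refine (C.al012 ?_).1
  intro a1 a2 ha h1 h2 h3
  rcases cl ha hc (by grind) (by grind) (by grind) with ⟨h, rfl, k1, k2⟩ | ⟨h, rfl, k1⟩ <;> rfl

end

end


section
open Finset
set_option linter.unusedSectionVars false

section
variable {X Y Z : Type} [Fintype X] [Fintype Y] [Fintype Z]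
  [DecidableEq X] [DecidableEq Y] [DecidableEq Z]
  {lx : X → ℕ} {ly : Y → ℕ} {lz : Z → ℕ} {p q r : ℕ} {A B : Finset (X × Y × Z)}
  {x : X} {y : Y} {z1 z2 : Z}

lemma Cub.e012 {T : Finset (X × Y × Z)} (cy : Coord Y ly q) (h : Cub lx ly lz 0 1 2 T) (y : Y) {z z' : Z}
    (e : lz z = lz z') :
    q * (T.filter (fun t => ly t.2.1 = ly y ∧ t.2.2 = z)).card + (T.filter (fun t => t.2.2 = z')).card =
    q * (T.filter (fun t => ly t.2.1 = ly y ∧ t.2.2 = z')).card + (T.filter (fun t => t.2.2 = z)).card := by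
  have := h _ _ _ (Vt0one lx) (Vt1ind cy y) (Vt2diff e)
  rw [sum_congr rfl (g := fun t => (q:ℚ) * (if ly t.2.1 = ly y ∧ t.2.2 = z then 1 else 0) -
    q * (if ly t.2.1 = ly y ∧ t.2.2 = z' then 1 else 0) - (if t.2.2 = z then 1 else 0) +
    (if t.2.2 = z' then 1 else 0))] at this
  · simp only [sum_add_distrib, sum_sub_distrib, ← mul_sum, ← sum_filter, sum_const, nsmul_eq_mul, mul_one] at this
    have h2 : (q:ℚ) * (T.filter (fun t => ly t.2.1 = ly y ∧ t.2.2 = z)).card + (T.filter (fun t => t.2.2 = z')).card =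
      q * (T.filter (fun t => ly t.2.1 = ly y ∧ t.2.2 = z')).card + (T.filter (fun t => t.2.2 = z)).card := by linarith
    exact_mod_cast h2
  · intro t _
    by_cases k1 : ly t.2.1 = ly y <;> by_cases k2 : t.2.2 = z <;> by_cases k3 : t.2.2 = z' <;>
      simp only [k1, k2, k3, if_true, if_false, true_and, false_and] <;> ring

lemma Cub.e011 {T : Finset (X × Y × Z)} (cy : Coord Y ly q) (cz : Coord Z lz r) (h : Cub lx ly lz 0 1 1 T) (y : Y) (z : Z) :
    q * r * (T.filter (fun t => ly t.2.1 = ly y ∧ lz t.2.2 = lz z)).card + T.card =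
    q * (T.filter (fun t => ly t.2.1 = ly y)).card + r * (T.filter (fun t => lz t.2.2 = lz z)).card := by
  have := h _ _ _ (Vt0one lx) (Vt1ind cy y) (Vt1ind cz z)
  rw [sum_congr rfl (g := fun t => (q:ℚ) * r * (if ly t.2.1 = ly y ∧ lz t.2.2 = lz z then 1 else 0) -
    q * (if ly t.2.1 = ly y then 1 else 0) - r * (if lz t.2.2 = lz z then 1 else 0) +
    1)] at this
  · simp only [sum_add_distrib, sum_sub_distrib, ← mul_sum, ← sum_filter, sum_const, nsmul_eq_mul, mul_one] at this
    have h2 : (q:ℚ) * r * (T.filter (fun t => ly t.2.1 = ly y ∧ lz t.2.2 = lz z)).card + T.card =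
    q * (T.filter (fun t => ly t.2.1 = ly y)).card + r * (T.filter (fun t => lz t.2.2 = lz z)).card := by linarith
    exact_mod_cast h2
  · intro t _
    by_cases k1 : ly t.2.1 = ly y <;> by_cases k2 : lz t.2.2 = lz z <;>
      simp only [k1, k2, if_true, if_false, true_and, false_and] <;> ring

/-- the configuration is incompatible with a `(1,1,2)` difference in `B` -/
lemma Cr.fin (C : Cr lx ly lz p q r A B x y z1 z2) (hB : Dv lx ly lz B 1 1 2) : False := by
  obtain ⟨N, B012⟩ := C.step2 hB
  have H := C.H
  have st3 := fun {b1 b2 b3} hb => C.step3 (b1 := b1) (b2 := b2) (b3 := b3) N B012 hb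
  obtain ⟨b1, b2, b3, -, -, -, hb, -⟩ := hB
  have hp3 := H.cx.three
  have hq3 := H.cy.three
  have hr3 := H.cz.three
  obtain ⟨u0, hu0⟩ := H.cx.off x
  obtain ⟨y2, hy, hyn, -⟩ := C.H.cy.third y y
  have A022 := C.A022 N hu0
  have A011 : Dv lx ly lz A 0 1 1 := ⟨_, _, _, _, _, _, N u0 hu0, C.S1 y2 hy hyn, vv_zero.2 hu0,
    vv_one.2 ⟨hyn.symm, hy.symm⟩, vv_one.2 ⟨C.hzn.symm, C.hz.symm⟩⟩
  have row : ∀ {u u' v w}, (u, v, w) ∈ B → (u', v, w) ∈ B → u = u' := by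
    intro u u' v w h h'
    by_cases e : lx u = lx u'
    · exact C.n122 h h' e
    · have := H.nd A022 ⟨_, _, _, _, _, _, h, h', vv_zero.2 e, vv_two.2 rfl, vv_two.2 rfl⟩
      omega
  have bloc : ∀ {b1 b2 b3}, (b1, b2, b3) ∈ B → (B.filter (fun t => ly t.2.1 = ly b2 ∧ t.2.2 = b3)).card = q := by
    intro b1 b2 b3 hb
    have h := st3 hb
    unfold Nn at h
    dsimp only at h
    rw [← card_union_of_disjoint] at h
    · have : B.filter (fun t => ly t.2.1 = ly b2 ∧ t.2.2 = b3) = insert (b1, b2, b3)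
        (B.filter (fun t => vv lx b1 t.1 = 1 ∧ vv ly b2 t.2.1 = 1 ∧ vv lz b3 t.2.2 = 2) ∪
         B.filter (fun t => vv lx b1 t.1 = 0 ∧ vv ly b2 t.2.1 = 1 ∧ vv lz b3 t.2.2 = 2)) := by
        ext ⟨t1, t2, t3⟩
        simp only [mem_filter, mem_insert, mem_union, Prod.mk.injEq, vv_two, vv_one, vv_zero]
        constructor
        · rintro ⟨ht, h1, rfl⟩
          by_cases k2 : t2 = b2
          · subst k2
            exact Or.inl ⟨row ht hb, rfl, rfl⟩
          · right
            by_cases k1 : lx b1 = lx t1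
            · left
              refine ⟨ht, ⟨?_, k1⟩, ⟨Ne.symm k2, h1.symm⟩, rfl⟩
              rintro rfl
              exact k2 (C.n212 ht hb h1)
            · right
              exact ⟨ht, k1, ⟨Ne.symm k2, h1.symm⟩, rfl⟩
        · rintro (⟨rfl, rfl, rfl⟩ | h | h)
          · exact ⟨hb, rfl, rfl⟩
          · exact ⟨h.1, h.2.2.1.2.symm, h.2.2.2.symm⟩
          · exact ⟨h.1, h.2.2.1.2.symm, h.2.2.2.symm⟩
      rw [this, card_insert_of_notMem]
      · omega
      · simp [vv_one]
    · rw [disjoint_left]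
      intro a h1 h2
      simp only [mem_filter] at h1 h2
      omega
  have cell : ∀ {b1 b2 b3 c1 c2 c3}, (b1, b2, b3) ∈ B → (c1, c2, c3) ∈ B → ly b2 = ly c2 → lz b3 = lz c3 → b3 = c3 := by
    intro b1 b2 b3 c1 c2 c3 hb hc e2 e3
    by_contra hne
    have hcard := bloc hb
    have : ∃ d1 d2, (d1, d2, b3) ∈ B ∧ ly d2 = ly b2 ∧ d1 ≠ c1 ∧ d2 ≠ c2 := by
      by_contra hno
      push Not at hno
      have c1c : ((B.filter (fun t => ly t.2.1 = ly b2 ∧ t.2.2 = b3)).filter (fun t => t.1 = c1)).card ≤ 1 := by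
        rw [card_le_one]
        rintro ⟨u1, u2, u3⟩ hu ⟨v1, v2, v3⟩ hv
        simp only [mem_filter] at hu hv
        obtain ⟨⟨hu, k1, rfl⟩, rfl⟩ := hu
        obtain ⟨⟨hv, m1, rfl⟩, rfl⟩ := hv
        rw [C.n212 hu hv (by rw [k1, m1])]
      have c2c : ((B.filter (fun t => ly t.2.1 = ly b2 ∧ t.2.2 = b3)).filter (fun t => ¬ t.1 = c1)).card ≤ 1 := by
        rw [card_le_one]
        rintro ⟨u1, u2, u3⟩ hu ⟨v1, v2, v3⟩ hv
        simp only [mem_filter] at hu hv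
        obtain ⟨⟨hu, k1, rfl⟩, k2⟩ := hu
        obtain ⟨⟨hv, m1, rfl⟩, m2⟩ := hv
        have a1 := hno _ _ hu k1 k2
        have a2 := hno _ _ hv m1 m2
        subst a1 a2
        rw [row hu hv]
      have := card_filter_add_card_filter_not (s := B.filter (fun t => ly t.2.1 = ly b2 ∧ t.2.2 = b3)) (fun t => t.1 = c1)
      omega
    obtain ⟨d1, d2, hd, g1, g2, g3⟩ := this
    by_cases e : lx d1 = lx c1
    · rcases C.n111 hd hc e (by rw [g1, e2]) e3 with h | h | h
      · exact g2 h
      · exact g3 h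
      · exact hne h
    · have := H.nd A011 ⟨_, _, _, _, _, _, hd, hc, vv_zero.2 e, vv_one.2 ⟨g3, by rw [g1, e2]⟩, vv_one.2 ⟨hne, e3⟩⟩
      omega
  have bloc2 : ∀ {b1 b2 b3}, (b1, b2, b3) ∈ B → (B.filter (fun t => ly t.2.1 = ly b2 ∧ lz t.2.2 = lz b3)).card = q := by
    intro b1 b2 b3 hb
    rw [← bloc hb]
    congr 1
    ext ⟨t1, t2, t3⟩
    simp only [mem_filter]
    constructor
    · rintro ⟨h1, h2, h3⟩
      exact ⟨h1, h2, cell h1 hb h2 h3⟩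
    · rintro ⟨h1, h2, rfl⟩
      exact ⟨h1, h2, rfl⟩
  -- bound on classes
  have Bk : ∀ z, (B.filter (fun t => lz t.2.2 = lz z)).card ≤ q ^ 2 := by
    intro z
    rw [← H.cy.card, ← card_univ]
    refine card_le_card_of_injOn (fun t => t.2.1) (by simp) ?_
    rintro ⟨u1, u2, u3⟩ hu ⟨v1, v2, v3⟩ hv e
    simp only [coe_filter, Set.mem_ofPred_eq] at hu hv e
    subst e
    have := cell hu.1 hv.1 rfl (by rw [hu.2, hv.2])
    subst this
    rw [row hu.1 hv.1]
  have Bz : ∀ z, (B.filter (fun t => t.2.2 = z)).card ≤ q ^ 2 := by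
    intro z
    refine le_trans (card_le_card ?_) (Bk z)
    intro t ht
    simp only [mem_filter] at ht ⊢
    exact ⟨ht.1, by rw [ht.2]⟩
  have Bjq : ∀ v, q ∣ (B.filter (fun t => ly t.2.1 = ly v)).card := by
    intro v
    rw [card_eq_sum_card_fiberwise (f := fun t => t.2.2) (t := univ) (by simp)]
    refine dvd_sum fun z _ => ?_
    rw [filter_filter]
    rcases (B.filter (fun t => ly t.2.1 = ly v ∧ t.2.2 = z)).eq_empty_or_nonempty with h | ⟨⟨u1, u2, u3⟩, h⟩
    · rw [h]; simp
    · simp only [mem_filter] at h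
      obtain ⟨h, k1, rfl⟩ := h
      rw [← k1, bloc h]
  have hqdvd : ¬ q ∣ p * r := by
    rw [H.cy.prime.dvd_mul, Nat.prime_dvd_prime_iff_eq H.cy.prime H.cx.prime, Nat.prime_dvd_prime_iff_eq H.cy.prime H.cz.prime]
    have := H.hpq; have := H.hqr
    rintro (h | h)
    · exact this (absurd h.symm H.hpq)
    · exact this h
  have A010 : Cub lx ly lz 0 1 0 A := by
    refine (H.dich 0 1 0 (by simp) (by simp) (by simp) (by simp)).resolve_right fun h => ?_
    have h1 := H.cy.marg1 B (fun t => t.2.1) h.my b2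
    rw [H.cardB, show p * q * r = q * (p * r) by ring] at h1
    have h1 := Nat.eq_of_mul_eq_mul_left H.cy.prime.pos h1
    exact hqdvd (h1 ▸ Bjq b2)
  have Aj : ∀ v, (A.filter (fun t => ly t.2.1 = ly v)).card = p * r := by
    intro v
    have h1 := H.cy.marg1 A (fun t => t.2.1) A010.my v
    rw [H.cardA, show p * q * r = q * (p * r) by ring] at h1
    exact Nat.eq_of_mul_eq_mul_left H.cy.prime.pos h1
  have Ajz : p ^ 2 - 1 ≤ (A.filter (fun t => ly t.2.1 = ly y ∧ t.2.2 = z2)).card := by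
    have : (univ.erase x).image (fun u => (u, y, z2)) ⊆ A.filter (fun t => ly t.2.1 = ly y ∧ t.2.2 = z2) := by
      intro t ht
      simp only [mem_image, mem_erase] at ht
      obtain ⟨u, hu, rfl⟩ := ht
      simp only [mem_filter, and_true]
      by_cases h : lx u = lx x
      · exact C.S2 u h hu.1
      · exact N u h
    have := card_le_card this
    rw [card_image_of_injective _ (by intro a b; simp), card_erase_of_mem (mem_univ _), card_univ,
      H.cx.card] at this
    exact this
  have hpp : p < p ^ 2 - 1 := by
    have : p + 1 < p ^ 2 := by nlinarith
    omega
  have A012 : Cub lx ly lz 0 1 2 A := by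
    refine (H.dich 0 1 2 (by simp) (by simp) (by simp) (by simp)).resolve_right fun h => ?_
    have : ∀ z, q ^ 2 ∣ (B.filter (fun t => t.2.2 = z)).card := by
      intro z
      rcases (B.filter (fun t => t.2.2 = z)).eq_empty_or_nonempty with h0 | ⟨⟨u1, u2, u3⟩, h0⟩
      · rw [h0]; simp
      · simp only [mem_filter] at h0
        obtain ⟨h0, rfl⟩ := h0
        obtain ⟨z', hz', hzn', -⟩ := H.cz.third u3 u3
        have h1 := h.e012 H.cy u2 hz'
        have h2 := bloc h0
        have h3 : B.filter (fun t => ly t.2.1 = ly u2 ∧ t.2.2 = z') = ∅ := by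
          rw [filter_eq_empty_iff]
          rintro ⟨t1, t2, t3⟩ ht ⟨m1, m2⟩
          dsimp only at m1 m2
          subst m2
          exact hzn' (cell ht h0 m1 hz')
        rw [h3, h2] at h1
        have h4 := Bz u3
        have : (B.filter (fun t => t.2.2 = u3)).card = q ^ 2 := by
          rw [card_empty] at h1
          nlinarith
        rw [this]
    have h5 : q ^ 2 ∣ B.card := by
      rw [card_eq_sum_card_fiberwise (s := B) (f := fun t => t.2.2) (t := univ) (by simp)]
      exact dvd_sum fun z _ => this z
    rw [H.cardB, show p * q * r = q * p * r by ring] at h5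
    exact sqndvd H.cy.prime H.cx.prime H.cz.prime H.hpq.symm H.hqr h5
  by_cases A002 : Cub lx ly lz 0 0 2 A
  · have h1 : ∀ z, lz z = lz z2 → (A.filter (fun t => ly t.2.1 = ly y ∧ t.2.2 = z)).card =
        (A.filter (fun t => ly t.2.1 = ly y ∧ t.2.2 = z2)).card := by
      intro z hz
      have h1 := A012.e012 H.cy y hz
      have h2 := Coord.marg2 A (fun t => t.2.2) A002.mz hz
      rw [h2] at h1
      exact Nat.eq_of_mul_eq_mul_left H.cy.prime.pos (Nat.add_right_cancel h1)
    have h2 : r * (p ^ 2 - 1) ≤ (A.filter (fun t => ly t.2.1 = ly y)).card := by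
      rw [card_eq_sum_card_fiberwise (s := A.filter (fun t => ly t.2.1 = ly y)) (f := fun t => t.2.2) (t := univ) (by simp)]
      calc r * (p ^ 2 - 1) = ∑ z with lz z = lz z2, (p ^ 2 - 1) := by
            rw [sum_const, H.cz.fib z2]; simp
        _ ≤ ∑ z with lz z = lz z2, ((A.filter (fun t => ly t.2.1 = ly y)).filter (fun t => t.2.2 = z)).card := by
            refine sum_le_sum fun z hz => ?_
            simp only [mem_filter, mem_univ, true_and] at hz
            rw [filter_filter, h1 z hz]
            exact Ajz
        _ ≤ _ := sum_le_sum_of_subset (filter_subset _ _)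
    rw [Aj, mul_comm] at h2
    have := Nat.le_of_mul_le_mul_right h2 (by omega)
    omega
  have B002 := (H.dich 0 0 2 (by simp) (by simp) (by simp) (by simp)).resolve_left A002
  have A001 : Cub lx ly lz 0 0 1 A := by
    refine (H.dich 0 0 1 (by simp) (by simp) (by simp) (by simp)).resolve_right fun h => ?_
    have := H.cz.not_both B (fun t => t.2.2) h.mz B002.mz
    rw [H.cardB, show p * q * r = r * p * q by ring] at this
    exact sqndvd H.cz.prime H.cx.prime H.cy.prime H.hpr.symm H.hqr.symm this
  rcases H.dich 0 1 1 (by simp) (by simp) (by simp) (by simp) with h | h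
  · have h1 := h.e011 H.cy H.cz y z2
    have h2 := H.zclass z2 A001 H.cardA
    rw [h2, Aj, H.cardA] at h1
    have h3 : q * r * (A.filter (fun t => ly t.2.1 = ly y ∧ lz t.2.2 = lz z2)).card = q * r * p := by
      have e1 : p * q * r = q * r * p := by ring
      have e2 : q * (p * r) = q * r * p := by ring
      have e3 : r * (p * q) = q * r * p := by ring
      omega
    have h4 := Nat.eq_of_mul_eq_mul_left (Nat.mul_pos (by omega) (by omega)) h3
    have h5 : (A.filter (fun t => ly t.2.1 = ly y ∧ t.2.2 = z2)).card ≤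
        (A.filter (fun t => ly t.2.1 = ly y ∧ lz t.2.2 = lz z2)).card := by
      refine card_le_card fun t ht => ?_
      simp only [mem_filter] at ht ⊢
      exact ⟨ht.1, ht.2.1, by rw [ht.2.2]⟩
    omega
  · have hrk : r ∣ (B.filter (fun t => lz t.2.2 = lz b3)).card := by
      rw [H.cz.marg2' B (fun t => t.2.2) B002.mz b3]
      exact dvd_mul_right _ _
    have h1 := h.e011 H.cy H.cz b2 b3
    rw [bloc2 hb, H.cardB] at h1
    by_cases hex : ∃ z', B.filter (fun t => ly t.2.1 = ly b2 ∧ lz t.2.2 = lz z') = ∅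
    · obtain ⟨z', hz'⟩ := hex
      have h2 := h.e011 H.cy H.cz b2 z'
      rw [hz', card_empty, H.cardB] at h2
      have h3 : r * (q ^ 2 + (B.filter (fun t => lz t.2.2 = lz z')).card) = r * (B.filter (fun t => lz t.2.2 = lz b3)).card := by
        have : r * (q ^ 2 + (B.filter (fun t => lz t.2.2 = lz z')).card) = q * r * q + r * (B.filter (fun t => lz t.2.2 = lz z')).card := by ring
        omega
      have h3 := Nat.eq_of_mul_eq_mul_left H.cz.prime.pos h3
      have h4 := Bk b3
      have h5 : (B.filter (fun t => lz t.2.2 = lz b3)).card = q ^ 2 := by omega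
      rw [h5] at hrk
      have := H.cz.prime.dvd_of_dvd_pow hrk
      rw [Nat.prime_dvd_prime_iff_eq H.cz.prime H.cy.prime] at this
      exact H.hqr this.symm
    · push Not at hex
      have h2 : (B.filter (fun t => ly t.2.1 = ly b2)).card = q * r := by
        rw [card_eq_sum_card_fiberwise (s := B.filter (fun t => ly t.2.1 = ly b2)) (f := fun t => lz t.2.2) (t := univ.image lz)
          (by intro t _; simp)]
        rw [sum_congr rfl (g := fun _ => q), sum_const, H.cz.cardImg, smul_eq_mul, mul_comm]
        intro k hk
        obtain ⟨z', -, rfl⟩ := mem_image.1 hk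
        obtain ⟨⟨u1, u2, u3⟩, hu⟩ := hex z'
        simp only [mem_filter] at hu
        rw [filter_filter, ← hu.2.1, ← hu.2.2]
        exact bloc2 hu.1
      rw [h2] at h1
      have h3 : r * (p * q) = r * (B.filter (fun t => lz t.2.2 = lz b3)).card := by
        have e1 : q * r * q = q * (q * r) := by ring
        have e2 : p * q * r = r * (p * q) := by ring
        omega
      have h3 := Nat.eq_of_mul_eq_mul_left H.cz.prime.pos h3
      rw [← h3, H.cz.prime.dvd_mul, Nat.prime_dvd_prime_iff_eq H.cz.prime H.cx.prime,
        Nat.prime_dvd_prime_iff_eq H.cz.prime H.cy.prime] at hrk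
      rcases hrk with h | h
      · exact H.hpr h.symm
      · exact H.hqr h.symm

end

end


section
open Finset
set_option linter.unusedSectionVars false

section
variable {X Y Z : Type} [Fintype X] [Fintype Y] [Fintype Z]
  [DecidableEq X] [DecidableEq Y] [DecidableEq Z]
  {lx : X → ℕ} {ly : Y → ℕ} {lz : Z → ℕ} {p q r : ℕ} {A B : Finset (X × Y × Z)}

/-- swap the first two coordinates -/
def s12 (T : Finset (X × Y × Z)) : Finset (Y × X × Z) :=
  T.map ⟨fun t => (t.2.1, t.1, t.2.2), by rintro ⟨a, b, c⟩ ⟨a', b', c'⟩ h; simp_all⟩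

/-- swap the last two coordinates -/
def s23 (T : Finset (X × Y × Z)) : Finset (X × Z × Y) :=
  T.map ⟨fun t => (t.1, t.2.2, t.2.1), by rintro ⟨a, b, c⟩ ⟨a', b', c'⟩ h; simp_all⟩

lemma mem_s12 {T : Finset (X × Y × Z)} {x : X} {y : Y} {z : Z} : (y, x, z) ∈ s12 T ↔ (x, y, z) ∈ T := by
  simp only [s12, mem_map, Function.Embedding.coeFn_mk, Prod.mk.injEq, Prod.exists]
  constructor
  · rintro ⟨a, b, c, h, h'⟩; cases h'; exact h
  · intro h; exact ⟨_, _, _, h, rfl⟩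

lemma mem_s23 {T : Finset (X × Y × Z)} {x : X} {y : Y} {z : Z} : (x, z, y) ∈ s23 T ↔ (x, y, z) ∈ T := by
  simp only [s23, mem_map, Function.Embedding.coeFn_mk, Prod.mk.injEq, Prod.exists]
  constructor
  · rintro ⟨a, b, c, h, h'⟩; cases h'; exact h
  · intro h; exact ⟨_, _, _, h, rfl⟩

lemma Cub.s12 {e1 e2 e3 : ℕ} {T : Finset (X × Y × Z)} : Cub ly lx lz e2 e1 e3 (s12 T) ↔ Cub lx ly lz e1 e2 e3 T := by
  constructor
  · intro h f g k hf hg hk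
    have := h g f k hg hf hk
    simp only [_root_.s12, sum_map, Function.Embedding.coeFn_mk] at this
    rw [← this]
    exact sum_congr rfl fun t _ => by
      show f t.1 * g t.2.1 * k t.2.2 = g t.2.1 * f t.1 * k t.2.2
      ring
  · intro h g f k hg hf hk
    have := h f g k hf hg hk
    simp only [_root_.s12, sum_map, Function.Embedding.coeFn_mk]
    rw [← this]
    exact sum_congr rfl fun t _ => by
      show g t.2.1 * f t.1 * k t.2.2 = f t.1 * g t.2.1 * k t.2.2
      ring

lemma Cub.s23 {e1 e2 e3 : ℕ} {T : Finset (X × Y × Z)} : Cub lx lz ly e1 e3 e2 (s23 T) ↔ Cub lx ly lz e1 e2 e3 T := by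
  constructor
  · intro h f g k hf hg hk
    have := h f k g hf hk hg
    simp only [_root_.s23, sum_map, Function.Embedding.coeFn_mk] at this
    rw [← this]
    exact sum_congr rfl fun t _ => by
      show f t.1 * g t.2.1 * k t.2.2 = f t.1 * k t.2.2 * g t.2.1
      ring
  · intro h f k g hf hk hg
    have := h f g k hf hg hk
    simp only [_root_.s23, sum_map, Function.Embedding.coeFn_mk]
    rw [← this]
    exact sum_congr rfl fun t _ => by
      show f t.1 * k t.2.2 * g t.2.1 = f t.1 * g t.2.1 * k t.2.2
      ring

lemma Tile.s12 (H : Tile lx ly lz p q r A B) : Tile ly lx lz q p r (s12 A) (s12 B) where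
  cx := H.cy
  cy := H.cx
  cz := H.cz
  hpq := H.hpq.symm
  hpr := H.hqr
  hqr := H.hpr
  cardA := by rw [_root_.s12, card_map, H.cardA]; ring
  cardB := by rw [_root_.s12, card_map, H.cardB]; ring
  dich e1 e2 e3 h1 h2 h3 h := by
    rw [Cub.s12, Cub.s12]; exact H.dich e2 e1 e3 h2 h1 h3 (by omega)

lemma Tile.s23 (H : Tile lx ly lz p q r A B) : Tile lx lz ly p r q (s23 A) (s23 B) where
  cx := H.cx
  cy := H.cz
  cz := H.cy
  hpq := H.hpr
  hpr := H.hpq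
  hqr := H.hqr.symm
  cardA := by rw [_root_.s23, card_map, H.cardA]; ring
  cardB := by rw [_root_.s23, card_map, H.cardB]; ring
  dich e1 e2 e3 h1 h2 h3 h := by
    rw [Cub.s23, Cub.s23]; exact H.dich e1 e3 e2 h1 h3 h2 (by omega)

lemma Dv.s12 {T : Finset (X × Y × Z)} {i j k : ℕ} (h : Dv lx ly lz T i j k) : Dv ly lx lz (s12 T) j i k := by
  obtain ⟨x, y, z, x', y', z', h1, h2, h3, h4, h5⟩ := h
  exact ⟨_, _, _, _, _, _, mem_s12.2 h1, mem_s12.2 h2, h4, h3, h5⟩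

lemma Dv.s23 {T : Finset (X × Y × Z)} {i j k : ℕ} (h : Dv lx ly lz T i j k) : Dv lx lz ly (s23 T) i k j := by
  obtain ⟨x, y, z, x', y', z', h1, h2, h3, h4, h5⟩ := h
  exact ⟨_, _, _, _, _, _, mem_s23.2 h1, mem_s23.2 h2, h3, h5, h4⟩

/-- exceptional structure, without ordering of the primes -/
lemma cr_any {x : X} {y : Y} {z1 z2 : Z} (H : Tile lx ly lz p q r A B) (hz : lz z1 = lz z2) (hzn : z1 ≠ z2)
    (S1 : ∀ t, ly t = ly y → t ≠ y → (x, t, z1) ∈ A)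
    (S2 : ∀ t, lx t = lx x → t ≠ x → (t, y, z2) ∈ A)
    (P1 : ∀ u v, lx u = lx x → ly v = ly y → (u, v, z1) ∈ A → u = x)
    (P2 : ∀ u v, lx u = lx x → ly v = ly y → (u, v, z2) ∈ A → v = y)
    (hH : ((x, y, z1) ∈ A ∧ (x, y, z2) ∈ A) ∨
      ((x, y, z1) ∉ A ∧ (x, y, z2) ∉ A ∧ ∀ z, lz z = lz z1 →
      ((∀ u v, lx u = lx x → ly v = ly y → ((u, v, z) ∈ A ↔ u = x ∧ v ≠ y)) ∨
       (∀ u v, lx u = lx x → ly v = ly y → ((u, v, z) ∈ A ↔ v = y ∧ u ≠ x)))))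
    (hB : Dv lx ly lz B 1 1 2) : False := by
  rcases lt_or_gt_of_ne H.hpq with h | h
  · exact Cr.fin ⟨H, h, hz, hzn, S1, S2, P1, P2, hH⟩ hB
  · refine Cr.fin (x := y) (y := x) (z1 := z2) (z2 := z1) ⟨H.s12, h, hz.symm, hzn.symm, ?_, ?_, ?_, ?_, ?_⟩ hB.s12
    · intro t h1 h2; rw [mem_s12]; exact S2 t h1 h2
    · intro t h1 h2; rw [mem_s12]; exact S1 t h1 h2
    · intro u v h1 h2 h3; rw [mem_s12] at h3; exact P2 _ _ h2 h1 h3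
    · intro u v h1 h2 h3; rw [mem_s12] at h3; exact P1 _ _ h2 h1 h3
    · rcases hH with h | ⟨h1, h2, h⟩
      · left; rw [mem_s12, mem_s12]; exact h.symm
      · right
        rw [mem_s12, mem_s12]
        refine ⟨h2, h1, fun z hz' => ?_⟩
        rcases h z (by rw [hz', hz]) with h | h
        · right
          intro u v g1 g2
          rw [mem_s12]; exact h v u g2 g1
        · left
          intro u v g1 g2
          rw [mem_s12]; exact h v u g2 g1

/-- the full setup: `A` unfibered in the box of `o` -/
structure Su (lx : X → ℕ) (ly : Y → ℕ) (lz : Z → ℕ) (p q r : ℕ) (A B : Finset (X × Y × Z))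
    (o1 : X) (o2 : Y) (o3 : Z) : Prop where
  H : Tile lx ly lz p q r A B
  c : Cub lx ly lz 2 2 2 A
  nx : ∃ x x' y z, lx x = lx o1 ∧ lx x' = lx o1 ∧ ly y = ly o2 ∧ lz z = lz o3 ∧ (x, y, z) ∈ A ∧ (x', y, z) ∉ A
  ny : ∃ x y y' z, lx x = lx o1 ∧ ly y = ly o2 ∧ ly y' = ly o2 ∧ lz z = lz o3 ∧ (x, y, z) ∈ A ∧ (x, y', z) ∉ A
  nz : ∃ x y z z', lx x = lx o1 ∧ ly y = ly o2 ∧ lz z = lz o3 ∧ lz z' = lz o3 ∧ (x, y, z) ∈ A ∧ (x, y, z') ∉ A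

variable {o1 : X} {o2 : Y} {o3 : Z}

lemma Su.s12 (S : Su lx ly lz p q r A B o1 o2 o3) : Su ly lx lz q p r (s12 A) (s12 B) o2 o1 o3 where
  H := S.H.s12
  c := Cub.s12.2 S.c
  nx := by
    obtain ⟨x, y, y', z, h1, h2, h3, h4, h5, h6⟩ := S.ny
    exact ⟨y, y', x, z, h2, h3, h1, h4, mem_s12.2 h5, by rwa [mem_s12]⟩
  ny := by
    obtain ⟨x, x', y, z, h1, h2, h3, h4, h5, h6⟩ := S.nx
    exact ⟨y, x, x', z, h3, h1, h2, h4, mem_s12.2 h5, by rwa [mem_s12]⟩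
  nz := by
    obtain ⟨x, y, z, z', h1, h2, h3, h4, h5, h6⟩ := S.nz
    exact ⟨y, x, z, z', h2, h1, h3, h4, mem_s12.2 h5, by rwa [mem_s12]⟩

lemma Su.s23 (S : Su lx ly lz p q r A B o1 o2 o3) : Su lx lz ly p r q (s23 A) (s23 B) o1 o3 o2 where
  H := S.H.s23
  c := Cub.s23.2 S.c
  nx := by
    obtain ⟨x, x', y, z, h1, h2, h3, h4, h5, h6⟩ := S.nx
    exact ⟨x, x', z, y, h1, h2, h4, h3, mem_s23.2 h5, by rwa [mem_s23]⟩
  ny := by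
    obtain ⟨x, y, z, z', h1, h2, h3, h4, h5, h6⟩ := S.nz
    exact ⟨x, z, z', y, h1, h3, h4, h2, mem_s23.2 h5, by rwa [mem_s23]⟩
  nz := by
    obtain ⟨x, y, y', z, h1, h2, h3, h4, h5, h6⟩ := S.ny
    exact ⟨x, z, y, y', h1, h4, h2, h3, mem_s23.2 h5, by rwa [mem_s23]⟩

def indf (lx : X → ℕ) (ly : Y → ℕ) (lz : Z → ℕ) (A : Finset (X × Y × Z)) (o1 : X) (o2 : Y) (o3 : Z)
    (u : {x // lx x = lx o1}) (v : {x // ly x = ly o2}) (w : {x // lz x = lz o3}) : ℤ :=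
  if (u.1, v.1, w.1) ∈ A then 1 else 0

lemma indf_one {u v w} : indf lx ly lz A o1 o2 o3 u v w = 1 ↔ (u.1, v.1, w.1) ∈ A := by
  simp [indf]

lemma indf_zero {u v w} : indf lx ly lz A o1 o2 o3 u v w = 0 ↔ (u.1, v.1, w.1) ∉ A := by
  simp [indf]

lemma sum_ind (T : Finset (X × Y × Z)) (x : X) (y : Y) (z : Z) :
    ∑ t ∈ T, (if t.1 = x then (1:ℚ) else 0) * (if t.2.1 = y then 1 else 0) * (if t.2.2 = z then 1 else 0) =
      if (x, y, z) ∈ T then 1 else 0 := by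
  rw [← sum_ite_eq' T (x, y, z) (fun _ => (1:ℚ))]
  refine sum_congr rfl ?_
  rintro ⟨a, b, c⟩ _
  simp only [Prod.mk.injEq]
  by_cases h1 : a = x <;> by_cases h2 : b = y <;> by_cases h3 : c = z <;> simp [h1, h2, h3]

lemma Su.uf (S : Su lx ly lz p q r A B o1 o2 o3) : UF (indf lx ly lz A o1 o2 o3) where
  zo u v w := by unfold indf; split_ifs <;> simp
  cube := by
    rintro ⟨u, hu⟩ ⟨u', hu'⟩ ⟨v, hv⟩ ⟨v', hv'⟩ ⟨w, hw⟩ ⟨w', hw'⟩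
    have := S.c _ _ _ (Vt2diff (hu.trans hu'.symm)) (Vt2diff (hv.trans hv'.symm)) (Vt2diff (hw.trans hw'.symm))
    simp only [sub_mul, mul_sub, sum_sub_distrib, sum_ind] at this
    have h : ((indf lx ly lz A o1 o2 o3 ⟨u, hu⟩ ⟨v, hv⟩ ⟨w, hw⟩ - indf lx ly lz A o1 o2 o3 ⟨u', hu'⟩ ⟨v, hv⟩ ⟨w, hw⟩
      - indf lx ly lz A o1 o2 o3 ⟨u, hu⟩ ⟨v', hv'⟩ ⟨w, hw⟩ + indf lx ly lz A o1 o2 o3 ⟨u', hu'⟩ ⟨v', hv'⟩ ⟨w, hw⟩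
      - indf lx ly lz A o1 o2 o3 ⟨u, hu⟩ ⟨v, hv⟩ ⟨w', hw'⟩ + indf lx ly lz A o1 o2 o3 ⟨u', hu'⟩ ⟨v, hv⟩ ⟨w', hw'⟩
      + indf lx ly lz A o1 o2 o3 ⟨u, hu⟩ ⟨v', hv'⟩ ⟨w', hw'⟩ - indf lx ly lz A o1 o2 o3 ⟨u', hu'⟩ ⟨v', hv'⟩ ⟨w', hw'⟩ : ℤ) : ℚ) = 0 := by
      simp only [indf]
      push_cast
      linarith
    exact_mod_cast h
  tu := by
    rintro ⟨u, hu⟩ ⟨u', hu'⟩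
    obtain ⟨t, h1, h2, h3⟩ := S.H.cx.third u u'
    exact ⟨⟨t, h1.trans hu⟩, by simpa using h2, by simpa using h3⟩
  tv := by
    rintro ⟨u, hu⟩ ⟨u', hu'⟩
    obtain ⟨t, h1, h2, h3⟩ := S.H.cy.third u u'
    exact ⟨⟨t, h1.trans hu⟩, by simpa using h2, by simpa using h3⟩
  tw := by
    rintro ⟨u, hu⟩ ⟨u', hu'⟩
    obtain ⟨t, h1, h2, h3⟩ := S.H.cz.third u u'
    exact ⟨⟨t, h1.trans hu⟩, by simpa using h2, by simpa using h3⟩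
  nx := by
    obtain ⟨x, x', y, z, h1, h2, h3, h4, h5, h6⟩ := S.nx
    exact ⟨⟨x, h1⟩, ⟨x', h2⟩, ⟨y, h3⟩, ⟨z, h4⟩, indf_one.2 h5, indf_zero.2 h6⟩
  ny := by
    obtain ⟨x, y, y', z, h1, h2, h3, h4, h5, h6⟩ := S.ny
    exact ⟨⟨x, h1⟩, ⟨y, h2⟩, ⟨y', h3⟩, ⟨z, h4⟩, indf_one.2 h5, indf_zero.2 h6⟩
  nz := by
    obtain ⟨x, y, z, z', h1, h2, h3, h4, h5, h6⟩ := S.nz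
    exact ⟨⟨x, h1⟩, ⟨y, h2⟩, ⟨z, h3⟩, ⟨z', h4⟩, indf_one.2 h5, indf_zero.2 h6⟩

lemma Su.n122 (S : Su lx ly lz p q r A B o1 o2 o3) (h : Dv lx ly lz B 1 2 2) : False := by
  obtain ⟨⟨u, hu⟩, ⟨u', hu'⟩, ⟨v, hv⟩, ⟨w, hw⟩, h1, h2, h3⟩ := S.uf.T1
  rw [indf_one] at h2 h3
  have := S.H.nd ⟨_, _, _, _, _, _, h2, h3, vv_one.2 ⟨by simpa using h1, hu.trans hu'.symm⟩, vv_two.2 rfl, vv_two.2 rfl⟩ h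
  omega

lemma Su.n111 (S : Su lx ly lz p q r A B o1 o2 o3) (h : Dv lx ly lz B 1 1 1) : False := by
  obtain ⟨⟨u, hu⟩, ⟨u', hu'⟩, ⟨v, hv⟩, ⟨v', hv'⟩, ⟨w, hw⟩, ⟨w', hw'⟩, h1, h2, h3, h4, h5⟩ := S.uf.T123
  rw [indf_one] at h4 h5
  have := S.H.nd ⟨_, _, _, _, _, _, h4, h5, vv_one.2 ⟨by simpa using h1, hu.trans hu'.symm⟩,
    vv_one.2 ⟨by simpa using h2, hv.trans hv'.symm⟩, vv_one.2 ⟨by simpa using h3, hw.trans hw'.symm⟩⟩ h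
  omega

lemma Su.n112 (S : Su lx ly lz p q r A B o1 o2 o3) (h : Dv lx ly lz B 1 1 2) : False := by
  rcases S.uf.T12 with h1 | h1 | h1
  · obtain ⟨⟨u, hu⟩, ⟨u', hu'⟩, ⟨v, hv⟩, ⟨v', hv'⟩, ⟨w, hw⟩, h1, h2, h4, h5⟩ := h1
    rw [indf_one] at h4 h5
    have := S.H.nd ⟨_, _, _, _, _, _, h4, h5, vv_one.2 ⟨by simpa using h1, hu.trans hu'.symm⟩,
      vv_one.2 ⟨by simpa using h2, hv.trans hv'.symm⟩, vv_two.2 rfl⟩ h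
    omega
  · obtain ⟨⟨x, hx⟩, ⟨y, hy⟩, ⟨z1, hz1⟩, ⟨z2, hz2⟩, h1, h2⟩ := h1
    simp only [indf_one, Subtype.forall, Subtype.mk.injEq] at h1 h2
    refine cr_any (x := x) (y := y) (z1 := z1) (z2 := z2) S.H (hz1.trans hz2.symm) ?_ ?_ ?_ ?_ ?_ (Or.inl ⟨?_, ?_⟩) h
    · rintro rfl
      obtain ⟨t, g1, g2, -⟩ := S.H.cx.third x x
      exact g2 ((h1 t (g1.trans hx) y hy).1 ((h2 t (g1.trans hx) y hy).2 rfl))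
    · intro t g1 g2
      exact (h1 x hx t (g1.trans hy)).2 rfl
    · intro t g1 g2
      exact (h2 t (g1.trans hx) y hy).2 rfl
    · intro u v g1 g2 g3
      exact (h1 u (g1.trans hx) v (g2.trans hy)).1 g3
    · intro u v g1 g2 g3
      exact (h2 u (g1.trans hx) v (g2.trans hy)).1 g3
    · exact (h1 x hx y hy).2 rfl
    · exact (h2 x hx y hy).2 rfl
  · obtain ⟨⟨x, hx⟩, ⟨y, hy⟩, ⟨z1, hz1⟩, ⟨z2, hz2⟩, h1, h2, h3⟩ := h1
    simp only [indf_one, Subtype.forall, Subtype.mk.injEq, ne_eq] at h1 h2 h3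
    refine cr_any (x := x) (y := y) (z1 := z1) (z2 := z2) S.H (hz1.trans hz2.symm) ?_ ?_ ?_ ?_ ?_ (Or.inr ⟨?_, ?_, ?_⟩) h
    · rintro rfl
      obtain ⟨t, g1, g2, -⟩ := S.H.cx.third x x
      exact g2 ((h1 t (g1.trans hx) y hy).1 ((h2 t (g1.trans hx) y hy).2 ⟨rfl, g2⟩)).1
    · intro t g1 g2
      exact (h1 x hx t (g1.trans hy)).2 ⟨rfl, g2⟩
    · intro t g1 g2
      exact (h2 t (g1.trans hx) y hy).2 ⟨rfl, g2⟩
    · intro u v g1 g2 g3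
      exact ((h1 u (g1.trans hx) v (g2.trans hy)).1 g3).1
    · intro u v g1 g2 g3
      exact ((h2 u (g1.trans hx) v (g2.trans hy)).1 g3).1
    · intro g; exact ((h1 x hx y hy).1 g).2 rfl
    · intro g; exact ((h2 x hx y hy).1 g).2 rfl
    · intro z hz
      rcases h3 z (hz.trans hz1) with g | g
      · left
        intro u v g1 g2
        exact g u (g1.trans hx) v (g2.trans hy)
      · right
        intro u v g1 g2
        exact g u (g1.trans hx) v (g2.trans hy)

/-- main combinatorial conclusion: `B` is injective on low digits -/
lemma Su.inj (S : Su lx ly lz p q r A B o1 o2 o3) {x x' : X} {y y' : Y} {z z' : Z}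
    (h : (x, y, z) ∈ B) (h' : (x', y', z') ∈ B) (e1 : lx x = lx x') (e2 : ly y = ly y') (e3 : lz z = lz z') :
    x = x' ∧ y = y' ∧ z = z' := by
  have mk : ∀ i j k, vv lx x x' = i → vv ly y y' = j → vv lz z z' = k → Dv lx ly lz B i j k :=
    fun i j k a b c => ⟨_, _, _, _, _, _, h, h', a, b, c⟩
  by_cases k1 : x = x' <;> by_cases k2 : y = y' <;> by_cases k3 : z = z'
  · exact ⟨k1, k2, k3⟩
  · exact (S.s23.s12.n122 (mk 2 2 1 (vv_two.2 k1) (vv_two.2 k2) (vv_one.2 ⟨k3, e3⟩)).s23.s12).elim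
  · exact (S.s12.n122 (mk 2 1 2 (vv_two.2 k1) (vv_one.2 ⟨k2, e2⟩) (vv_two.2 k3)).s12).elim
  · exact (S.s12.s23.n112 (mk 2 1 1 (vv_two.2 k1) (vv_one.2 ⟨k2, e2⟩) (vv_one.2 ⟨k3, e3⟩)).s12.s23).elim
  · exact (S.n122 (mk 1 2 2 (vv_one.2 ⟨k1, e1⟩) (vv_two.2 k2) (vv_two.2 k3))).elim
  · exact (S.s23.n112 (mk 1 2 1 (vv_one.2 ⟨k1, e1⟩) (vv_two.2 k2) (vv_one.2 ⟨k3, e3⟩)).s23).elim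
  · exact (S.n112 (mk 1 1 2 (vv_one.2 ⟨k1, e1⟩) (vv_one.2 ⟨k2, e2⟩) (vv_two.2 k3))).elim
  · exact (S.n111 (mk 1 1 1 (vv_one.2 ⟨k1, e1⟩) (vv_one.2 ⟨k2, e2⟩) (vv_one.2 ⟨k3, e3⟩))).elim

end

end


section
open Finset
set_option linter.unusedSectionVars false

section
variable {X Y Z : Type} [Fintype X] [Fintype Y] [Fintype Z]
  [DecidableEq X] [DecidableEq Y] [DecidableEq Z]
  {lx : X → ℕ} {ly : Y → ℕ} {lz : Z → ℕ} {p q r : ℕ} {A B : Finset (X × Y × Z)}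

/-- distinct points of `B` lie in distinct cells -/
def Ij (lx : X → ℕ) (ly : Y → ℕ) (lz : Z → ℕ) (B : Finset (X × Y × Z)) : Prop :=
  ∀ x y z x' y' z', (x, y, z) ∈ B → (x', y', z') ∈ B → lx x = lx x' → ly y = ly y' →
    lz z = lz z' → x = x' ∧ y = y' ∧ z = z'

/-- the cell of a point -/
def cel (lx : X → ℕ) (ly : Y → ℕ) (lz : Z → ℕ) (b : X × Y × Z) : Finset (X × Y × Z) :=
  (univ.filter fun x => lx x = lx b.1) ×ˢ ((univ.filter fun y => ly y = ly b.2.1) ×ˢ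
    (univ.filter fun z => lz z = lz b.2.2))

lemma mem_cel {b t : X × Y × Z} : t ∈ cel lx ly lz b ↔
    lx t.1 = lx b.1 ∧ ly t.2.1 = ly b.2.1 ∧ lz t.2.2 = lz b.2.2 := by
  simp [cel]

lemma Tile.card_cel (H : Tile lx ly lz p q r A B) (b : X × Y × Z) :
    (cel lx ly lz b).card = p * q * r := by
  rw [cel, card_product, card_product, H.cx.fib, H.cy.fib, H.cz.fib]; ring

lemma Ij.disj (I : Ij lx ly lz B) : (B : Set (X × Y × Z)).PairwiseDisjoint (cel lx ly lz) := by
  rintro ⟨x, y, z⟩ hb ⟨x', y', z'⟩ hb' hne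
  rw [Function.onFun, Finset.disjoint_left]
  intro t h1 h2
  rw [mem_cel] at h1 h2
  obtain ⟨e1, e2, e3⟩ := I x y z x' y' z' hb hb' (h1.1.symm.trans h2.1) (h1.2.1.symm.trans h2.2.1)
    (h1.2.2.symm.trans h2.2.2)
  exact hne (by rw [e1, e2, e3])

lemma Ij.univ_eq (I : Ij lx ly lz B) (H : Tile lx ly lz p q r A B) :
    B.biUnion (cel lx ly lz) = univ := by
  apply Finset.eq_univ_of_card
  rw [card_biUnion I.disj, sum_congr rfl (fun b _ => H.card_cel b), sum_const, H.cardB,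
    Fintype.card_prod, Fintype.card_prod, H.cx.card, H.cy.card, H.cz.card, smul_eq_mul]
  ring

lemma Ij.cov (I : Ij lx ly lz B) (H : Tile lx ly lz p q r A B) (x : X) (y : Y) (z : Z) :
    ∃ x' y' z', (x', y', z') ∈ B ∧ lx x' = lx x ∧ ly y' = ly y ∧ lz z' = lz z := by
  have h : (x, y, z) ∈ B.biUnion (cel lx ly lz) := by rw [I.univ_eq H]; exact mem_univ _
  rw [mem_biUnion] at h
  obtain ⟨⟨x', y', z'⟩, h1, h2⟩ := h
  rw [mem_cel] at h2
  exact ⟨x', y', z', h1, h2.1.symm, h2.2.1.symm, h2.2.2.symm⟩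

lemma Vt.low {l : X → ℕ} {e : ℕ} (he : e ≤ 1) {f : X → ℚ} (h : Vt l e f) :
    ∀ x x', l x = l x' → f x = f x' := by
  interval_cases e
  · obtain ⟨c, hc⟩ := h
    intro x x' _; rw [hc, hc]
  · exact h.1

lemma Ij.lowB (I : Ij lx ly lz B) (H : Tile lx ly lz p q r A B) {e1 e2 e3 : ℕ}
    (h1 : e1 ≤ 1) (h2 : e2 ≤ 1) (h3 : e3 ≤ 1) (h : e1 + e2 + e3 ≠ 0) : Cub lx ly lz e1 e2 e3 B := by
  intro f g k hf hg hk
  have hs : ∑ t : X × Y × Z, f t.1 * g t.2.1 * k t.2.2 = (∑ x, f x) * (∑ y, g y) * ∑ z, k z := by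
    rw [Fintype.sum_prod_type, Finset.sum_mul, Finset.sum_mul]
    refine sum_congr rfl fun x _ => ?_
    rw [Fintype.sum_prod_type, mul_assoc, Finset.sum_mul_sum, Finset.mul_sum]
    refine sum_congr rfl fun y _ => ?_
    rw [Finset.mul_sum]
    exact sum_congr rfl fun z _ => by ring
  have h0 : ∑ t : X × Y × Z, f t.1 * g t.2.1 * k t.2.2 = 0 := by
    rw [hs]
    by_cases a1 : e1 = 1
    · subst a1; rw [hf.2]; ring
    by_cases a2 : e2 = 1
    · subst a2; rw [hg.2]; ring
    have a3 : e3 = 1 := by omega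
    subst a3; rw [hk.2]; ring
  rw [← I.univ_eq H, sum_biUnion I.disj] at h0
  have h4 : ∀ b ∈ B, ∑ t ∈ cel lx ly lz b, f t.1 * g t.2.1 * k t.2.2
      = ((p * q * r : ℕ) : ℚ) * (f b.1 * g b.2.1 * k b.2.2) := by
    intro b _
    rw [← H.card_cel b, ← nsmul_eq_mul, ← sum_const]
    refine sum_congr rfl fun t ht => ?_
    rw [mem_cel] at ht
    rw [hf.low h1 _ _ ht.1, hg.low h2 _ _ ht.2.1, hk.low h3 _ _ ht.2.2]
  rw [sum_congr rfl h4, ← mul_sum] at h0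
  have h5 : ((p * q * r : ℕ) : ℚ) ≠ 0 := by
    have := H.cx.prime.pos; have := H.cy.prime.pos; have := H.cz.prime.pos
    positivity
  exact (mul_eq_zero.1 h0).resolve_left h5

lemma Coord.other {l : X → ℕ} (c : Coord X l p) (x : X) : ∃ x', l x = l x' ∧ x ≠ x' := by
  have h := c.fib x
  have h3 := c.three
  obtain ⟨x', h1, h2⟩ := Finset.exists_mem_ne (s := univ.filter fun x' => l x' = l x) (by omega) x
  exact ⟨x', by simpa using (mem_filter.1 h1).2.symm, h2.symm⟩

lemma Ij.n221 (I : Ij lx ly lz B) (H : Tile lx ly lz p q r A B) (h0 : Cub lx ly lz 2 2 0 B)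
    (h1 : Cub lx ly lz 2 2 1 B) : False := by
  have hne : B.Nonempty := by
    rw [← card_pos, H.cardB]
    have := H.cx.prime.pos; have := H.cy.prime.pos; have := H.cz.prime.pos
    positivity
  obtain ⟨⟨x, y, z⟩, hb⟩ := hne
  obtain ⟨x', ex, nx⟩ := H.cx.other x
  obtain ⟨y', ey, ny⟩ := H.cy.other y
  have a0 := h0 _ _ _ (Vt2diff ex) (Vt2diff ey) (Vt0one lz)
  have a1 := h1 _ _ _ (Vt2diff ex) (Vt2diff ey) (Vt1ind H.cz z)
  have hr : (r:ℚ) ≠ 0 := by have := H.cz.prime.pos; positivity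
  have key : ∑ t ∈ B, ((((if t.1 = x then (1:ℚ) else 0) - (if t.1 = x' then 1 else 0)) *
      ((if t.2.1 = y then (1:ℚ) else 0) - (if t.2.1 = y' then 1 else 0))) *
      ((r:ℚ) * (if lz t.2.2 = lz z then 1 else 0))) = r := by
    rw [sum_eq_single_of_mem (x, y, z) hb]
    · simp [nx, ny]
    · rintro ⟨u, v, w⟩ ht hn
      dsimp only
      by_cases c1 : lx u = lx x
      · by_cases c2 : ly v = ly y
        · by_cases c3 : lz w = lz z
          · obtain ⟨e1, e2, e3⟩ := I _ _ _ _ _ _ ht hb c1 c2 c3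
            exact absurd (by rw [e1, e2, e3]) hn
          · simp [c3]
        · have d1 : v ≠ y := fun h => c2 (by rw [h])
          have d2 : v ≠ y' := fun h => c2 (by rw [h, ey])
          simp [d1, d2]
      · have d1 : u ≠ x := fun h => c1 (by rw [h])
        have d2 : u ≠ x' := fun h => c1 (by rw [h, ex])
        simp [d1, d2]
  apply hr
  have a2 := sum_add_distrib (s := B)
      (f := fun t => ((if t.1 = x then (1:ℚ) else 0) - (if t.1 = x' then 1 else 0)) *
      ((if t.2.1 = y then (1:ℚ) else 0) - (if t.2.1 = y' then 1 else 0)) *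
      ((r:ℚ) * (if lz t.2.2 = lz z then 1 else 0) - 1))
      (g := fun t => ((if t.1 = x then (1:ℚ) else 0) - (if t.1 = x' then 1 else 0)) *
      ((if t.2.1 = y then (1:ℚ) else 0) - (if t.2.1 = y' then 1 else 0)) * 1)
  rw [a1, a0, add_zero] at a2
  rw [← key]
  refine Eq.trans ?_ a2
  exact sum_congr rfl fun t _ => by ring

lemma Ij.box (I : Ij lx ly lz B) (H : Tile lx ly lz p q r A B) (x0 : X) (y0 : Y) :
    (B.filter fun t => lx t.1 = lx x0 ∧ ly t.2.1 = ly y0).card = r := by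
  have h1 := H.cx.marg1 B (fun t => t.1) (Cub.mx (I.lowB H (e1 := 1) (e2 := 0) (e3 := 0)
    (by simp) (by simp) (by simp) (by simp))) x0
  have h2 := H.cy.marg1 B (fun t => t.2.1) (Cub.my (I.lowB H (e1 := 0) (e2 := 1) (e3 := 0)
    (by simp) (by simp) (by simp) (by simp))) y0
  have h3 := (I.lowB H (e1 := 1) (e2 := 1) (e3 := 0)
    (by simp) (by simp) (by simp) (by simp)) _ _ _ (Vt1ind H.cx x0) (Vt1ind H.cy y0) (Vt0one lz)
  rw [H.cardB] at h1 h2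
  have e : ∀ t ∈ B, ((p:ℚ) * (if lx t.1 = lx x0 then 1 else 0) - 1) *
      ((q:ℚ) * (if ly t.2.1 = ly y0 then 1 else 0) - 1) * 1 =
      (p:ℚ) * q * (if lx t.1 = lx x0 ∧ ly t.2.1 = ly y0 then 1 else 0)
      - p * (if lx t.1 = lx x0 then 1 else 0) - q * (if ly t.2.1 = ly y0 then 1 else 0) + 1 := by
    intro t _
    by_cases a : lx t.1 = lx x0 <;> by_cases b : ly t.2.1 = ly y0 <;> simp [a, b] <;> ring
  rw [sum_congr rfl e, sum_add_distrib, sum_sub_distrib, sum_sub_distrib, ← mul_sum, ← mul_sum,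
    ← mul_sum, ← sum_filter, ← sum_filter, ← sum_filter] at h3
  simp only [sum_const, nsmul_eq_mul, mul_one] at h3
  rw [H.cardB] at h3
  have g1 : (p:ℚ) * ((B.filter fun t => lx t.1 = lx x0).card : ℚ) = ((p * q * r : ℕ) : ℚ) := by
    rw [← h1]; push_cast; rfl
  have g2 : (q:ℚ) * ((B.filter fun t => ly t.2.1 = ly y0).card : ℚ) = ((p * q * r : ℕ) : ℚ) := by
    rw [← h2]; push_cast; rfl
  rw [g1, g2] at h3
  have hp : (p:ℚ) * q ≠ 0 := by
    have := H.cx.prime.pos; have := H.cy.prime.pos; positivity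
  push_cast at h3
  have h4 : (p:ℚ) * q * ((B.filter fun t => lx t.1 = lx x0 ∧ ly t.2.1 = ly y0).card : ℚ)
    = p * q * r := by linarith
  exact_mod_cast mul_left_cancel₀ hp h4

lemma Ij.dv4 (I : Ij lx ly lz B) (H : Tile lx ly lz p q r A B) (h : Cub lx ly lz 2 2 0 B) :
    Dv lx ly lz B 2 2 0 ∧ Dv lx ly lz B 1 2 0 ∧ Dv lx ly lz B 2 1 0 ∧ Dv lx ly lz B 1 1 0 := by
  have hne : B.Nonempty := by
    rw [← card_pos, H.cardB]
    have := H.cx.prime.pos; have := H.cy.prime.pos; have := H.cz.prime.pos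
    positivity
  obtain ⟨⟨x0, y0, z0⟩, hb⟩ := hne
  obtain ⟨w, hw⟩ : ∃ w : X → Y → ℕ, ∀ x y, w x y = (B.filter fun t => t.1 = x ∧ t.2.1 = y).card :=
    ⟨_, fun _ _ => rfl⟩
  have add : ∀ x x' y y', lx x = lx x' → ly y = ly y' → w x y + w x' y' = w x y' + w x' y := by
    intro x x' y y' hx hy
    have := h _ _ _ (Vt2diff hx) (Vt2diff hy) (Vt0one lz)
    have e : ∀ t ∈ B, ((if t.1 = x then (1:ℚ) else 0) - (if t.1 = x' then 1 else 0)) *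
      ((if t.2.1 = y then (1:ℚ) else 0) - (if t.2.1 = y' then 1 else 0)) * 1 =
      (if t.1 = x ∧ t.2.1 = y then 1 else 0) - (if t.1 = x ∧ t.2.1 = y' then 1 else 0)
      - (if t.1 = x' ∧ t.2.1 = y then 1 else 0) + (if t.1 = x' ∧ t.2.1 = y' then 1 else 0) := by
      intro t _
      rw [ite_and, ite_and, ite_and, ite_and]
      split_ifs <;> ring
    rw [sum_congr rfl e, sum_add_distrib, sum_sub_distrib, sum_sub_distrib,
      ← sum_filter, ← sum_filter, ← sum_filter, ← sum_filter] at this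
    simp only [sum_const, nsmul_eq_mul, mul_one, ← hw] at this
    have : ((w x y + w x' y' : ℕ) : ℚ) = ((w x y' + w x' y : ℕ) : ℚ) := by push_cast; linarith
    exact_mod_cast this
  obtain ⟨ys, hys, hmin⟩ := exists_min_image (univ.filter fun y => ly y = ly y0) (w x0)
    ⟨y0, by simp⟩
  simp only [mem_filter, mem_univ, true_and] at hys hmin
  have tot : ∑ x with lx x = lx x0, ∑ y with ly y = ly y0, w x y = r := by
    rw [← I.box H x0 y0, ← sum_product', card_eq_sum_card_fiberwise (f := fun t => (t.1, t.2.1))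
      (t := (univ.filter fun x => lx x = lx x0) ×ˢ (univ.filter fun y => ly y = ly y0))]
    · refine sum_congr rfl fun t ht => ?_
      simp only [mem_product, mem_filter, mem_univ, true_and] at ht
      rw [hw, filter_filter]
      congr 1
      ext s
      simp only [mem_filter, Prod.ext_iff]
      constructor
      · rintro ⟨a, b, c⟩; exact ⟨a, ⟨by rw [b]; exact ht.1, by rw [c]; exact ht.2⟩, b, c⟩
      · rintro ⟨a, _, b, c⟩; exact ⟨a, b, c⟩
    · intro t ht
      simpa using (mem_filter.1 ht).2
  obtain ⟨x1, hx1, w1⟩ : ∃ x1, lx x1 = lx x0 ∧ w x1 ys ≠ 0 := by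
    by_contra! hn
    rw [sum_congr rfl (g := fun _ => ∑ y with ly y = ly y0, w x0 y), sum_const, H.cx.fib,
      smul_eq_mul] at tot
    · have : p ∣ r := ⟨_, tot.symm⟩
      exact H.hpr ((Nat.prime_dvd_prime_iff_eq H.cx.prime H.cz.prime).1 this)
    · intro x hx
      simp only [mem_filter, mem_univ, true_and] at hx
      refine sum_congr rfl fun y hy => ?_
      simp only [mem_filter, mem_univ, true_and] at hy
      have a1 := add x x0 y ys hx (hy.trans hys.symm)
      have a2 := hn x hx
      have a3 := hn x0 rfl
      omega
  obtain ⟨y1, hy1, w2⟩ : ∃ y1, ly y1 = ly y0 ∧ w x0 ys < w x0 y1 := by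
    by_contra! hn
    have e : ∀ y, ly y = ly y0 → ∀ x, lx x = lx x0 → w x y = w x ys := by
      intro y hy x hx
      have a1 := add x x0 y ys hx (hy.trans hys.symm)
      have a2 := hn y hy
      have a3 := hmin y hy
      omega
    rw [sum_congr rfl (g := fun x => q * w x ys), ← mul_sum] at tot
    · have : q ∣ r := ⟨_, tot.symm⟩
      exact H.hqr ((Nat.prime_dvd_prime_iff_eq H.cy.prime H.cz.prime).1 this)
    · intro x hx
      simp only [mem_filter, mem_univ, true_and] at hx
      rw [sum_congr rfl (g := fun _ => w x ys), sum_const, H.cy.fib, smul_eq_mul]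
      intro y hy
      simp only [mem_filter, mem_univ, true_and] at hy
      exact e y hy x hx
  have row : ∀ y, ly y = ly y0 → 0 < w x1 y := by
    intro y hy
    have a1 := add x1 x0 y ys hx1 (hy.trans hys.symm)
    have a3 := hmin y hy
    omega
  have col : ∀ x, lx x = lx x0 → 0 < w x y1 := by
    intro x hx
    have a1 := add x x0 y1 ys hx (hy1.trans hys.symm)
    omega
  have two : 1 < w x1 y1 := by
    have a1 := add x1 x0 y1 ys hx1 (hy1.trans hys.symm)
    omega
  have ex : ∀ x y, 0 < w x y → ∃ z, (x, y, z) ∈ B := by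
    intro x y hh
    rw [hw, card_pos] at hh
    obtain ⟨⟨a, b, c⟩, hh⟩ := hh
    simp only [mem_filter] at hh
    obtain ⟨h1, rfl, rfl⟩ := hh
    exact ⟨c, h1⟩
  have dv : ∀ x y z x' y' z', (x, y, z) ∈ B → (x', y', z') ∈ B → lx x = lx x' → ly y = ly y' →
      (x ≠ x' ∨ y ≠ y' ∨ z ≠ z') → lz z ≠ lz z' := by
    intro x y z x' y' z' h1 h2 h3 h4 h5 h6
    have := I _ _ _ _ _ _ h1 h2 h3 h4 h6
    tauto
  obtain ⟨x2, hx2, nx2⟩ := H.cx.other x1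
  obtain ⟨y2, hy2, ny2⟩ := H.cy.other y1
  obtain ⟨z12, hz12⟩ := ex x1 y2 (row y2 (hy2.symm.trans hy1))
  obtain ⟨z21, hz21⟩ := ex x2 y1 (col x2 (hx2.symm.trans hx1))
  obtain ⟨z11, hz11⟩ := ex x1 y1 (by omega)
  refine ⟨?_, ?_, ?_, ?_⟩
  · rw [hw, one_lt_card] at two
    obtain ⟨⟨a, b, c⟩, h1, ⟨a', b', c'⟩, h2, hn⟩ := two
    simp only [mem_filter] at h1 h2
    obtain ⟨h1, rfl, rfl⟩ := h1
    obtain ⟨h2, rfl, rfl⟩ := h2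
    refine ⟨_, _, _, _, _, _, h1, h2, vv_two.2 rfl, vv_two.2 rfl, vv_zero.2
      (dv _ _ _ _ _ _ h1 h2 rfl rfl (Or.inr (Or.inr ?_)))⟩
    rintro rfl; exact hn rfl
  · exact ⟨_, _, _, _, _, _, hz11, hz21, vv_one.2 ⟨nx2, hx2⟩, vv_two.2 rfl,
      vv_zero.2 (dv _ _ _ _ _ _ hz11 hz21 hx2 rfl (Or.inl nx2))⟩
  · exact ⟨_, _, _, _, _, _, hz11, hz12, vv_two.2 rfl, vv_one.2 ⟨ny2, hy2⟩,
      vv_zero.2 (dv _ _ _ _ _ _ hz11 hz12 rfl hy2 (Or.inr (Or.inl ny2)))⟩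
  · exact ⟨_, _, _, _, _, _, hz12, hz21, vv_one.2 ⟨nx2, hx2⟩, vv_one.2 ⟨ny2.symm, hy2.symm⟩,
      vv_zero.2 (dv _ _ _ _ _ _ hz12 hz21 hx2 hy2.symm (Or.inl nx2))⟩

lemma Vt.loc {l : X → ℕ} {f : X → ℚ} (h : Vt l 2 f) (x0 : X) :
    Vt l 2 (fun x => f x * if l x = l x0 then 1 else 0) := by
  intro x
  have := h x
  by_cases hx : l x = l x0
  · refine Eq.trans ?_ this
    refine sum_congr rfl fun t ht => ?_
    dsimp only
    rw [if_pos ((mem_filter.1 ht).2.trans hx), mul_one]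
  · refine sum_eq_zero fun t ht => ?_
    rw [if_neg, mul_zero]
    rw [(mem_filter.1 ht).2]; exact hx

lemma Ij.a220 (I : Ij lx ly lz B) (H : Tile lx ly lz p q r A B) : Cub lx ly lz 2 2 0 A := by
  rcases H.dich 2 2 0 (by simp) (by simp) (by simp) (by simp) with h | h
  · exact h
  rcases H.dich 2 2 1 (by simp) (by simp) (by simp) (by simp) with h1 | h1
  swap
  · exact (I.n221 H h h1).elim
  obtain ⟨d22, d12, d21, d11⟩ := I.dv4 H h
  have same : ∀ x y z x' y' z', (x, y, z) ∈ A → (x', y', z') ∈ A → lx x = lx x' → ly y = ly y' →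
      lz z = lz z' := by
    intro x y z x' y' z' m m' ex ey
    by_contra ez
    have ez := vv_zero.2 ez
    by_cases hx : x = x' <;> by_cases hy : y = y'
    · have := H.nd ⟨_, _, _, _, _, _, m, m', vv_two.2 hx, vv_two.2 hy, ez⟩ d22; omega
    · have := H.nd ⟨_, _, _, _, _, _, m, m', vv_two.2 hx, vv_one.2 ⟨hy, ey⟩, ez⟩ d21; omega
    · have := H.nd ⟨_, _, _, _, _, _, m, m', vv_one.2 ⟨hx, ex⟩, vv_two.2 hy, ez⟩ d12; omega
    · have := H.nd ⟨_, _, _, _, _, _, m, m', vv_one.2 ⟨hx, ex⟩, vv_one.2 ⟨hy, ey⟩, ez⟩ d11; omega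
  intro f g k hf hg hk
  obtain ⟨c, hc⟩ := hk
  have loc : ∀ x0 y0, ∑ t ∈ A, (f t.1 * if lx t.1 = lx x0 then 1 else 0) *
      (g t.2.1 * if ly t.2.1 = ly y0 then 1 else 0) = 0 := by
    intro x0 y0
    by_cases hh : ∃ x y z, (x, y, z) ∈ A ∧ lx x = lx x0 ∧ ly y = ly y0
    · obtain ⟨x, y, z, m, ex, ey⟩ := hh
      obtain ⟨z1, hz1⟩ := H.cz.off z
      have := h1 _ _ _ (hf.loc x0) (hg.loc y0) (Vt1ind H.cz z1)
      rw [← neg_eq_zero, ← sum_neg_distrib]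
      refine Eq.trans ?_ this
      refine sum_congr rfl ?_
      rintro ⟨u, v, w⟩ mt
      dsimp only
      by_cases c1 : lx u = lx x0
      · by_cases c2 : ly v = ly y0
        · have c3 := same _ _ _ _ _ _ mt m (c1.trans ex.symm) (c2.trans ey.symm)
          have c4 : ¬ lz w = lz z1 := by rw [c3]; exact fun h => hz1 h.symm
          simp [c4]
        · simp [c2]
      · simp [c1]
    · refine sum_eq_zero ?_
      rintro ⟨u, v, w⟩ mt
      dsimp only
      by_cases c1 : lx u = lx x0
      · by_cases c2 : ly v = ly y0
        · exact absurd ⟨_, _, _, mt, c1, c2⟩ hh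
        · simp [c2]
      · simp [c1]
  have hsum : ∑ x0 : X, ∑ y0 : Y, ∑ t ∈ A, (f t.1 * if lx t.1 = lx x0 then 1 else 0) *
      (g t.2.1 * if ly t.2.1 = ly y0 then 1 else 0) = 0 :=
    sum_eq_zero fun x0 _ => sum_eq_zero fun y0 _ => loc x0 y0
  have cnt : ∀ {W : Type} [Fintype W] {l : W → ℕ} {p : ℕ} (_ : Coord W l p) (x : W),
      ∑ x0 : W, (if l x = l x0 then (1:ℚ) else 0) = p := by
    intro W _ l p c x
    rw [← sum_filter]
    simp only [eq_comm (a := l x), sum_const, c.fib x, nsmul_eq_mul, mul_one]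
  have e : ∑ x0 : X, ∑ y0 : Y, ∑ t ∈ A, (f t.1 * if lx t.1 = lx x0 then 1 else 0) *
      (g t.2.1 * if ly t.2.1 = ly y0 then 1 else 0) = ∑ t ∈ A, (p:ℚ) * q * (f t.1 * g t.2.1) := by
    rw [sum_congr rfl (fun x0 _ => sum_comm), sum_comm]
    refine sum_congr rfl fun t _ => ?_
    rw [← sum_mul_sum, ← mul_sum, ← mul_sum, cnt H.cx, cnt H.cy]
    ring
  rw [e, ← mul_sum] at hsum
  have hp : (p:ℚ) * q ≠ 0 := by
    have := H.cx.prime.pos; have := H.cy.prime.pos; positivity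
  have h0 := (mul_eq_zero.1 hsum).resolve_left hp
  simp only [hc]
  rw [← sum_mul, h0, zero_mul]

lemma Ij.s12 (I : Ij lx ly lz B) : Ij ly lx lz (s12 B) := by
  intro y x z y' x' z' h h' ey ex ez
  rw [mem_s12] at h h'
  have := I _ _ _ _ _ _ h h' ex ey ez
  exact ⟨this.2.1, this.1, this.2.2⟩

lemma Ij.s23 (I : Ij lx ly lz B) : Ij lx lz ly (s23 B) := by
  intro x z y x' z' y' h h' ex ez ey
  rw [mem_s23] at h h'
  have := I _ _ _ _ _ _ h h' ex ey ez
  exact ⟨this.1, this.2.2, this.2.1⟩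

lemma Ij.b200 (I : Ij lx ly lz B) (H : Tile lx ly lz p q r A B) : ¬ Cub lx ly lz 2 0 0 B := by
  intro h
  have h1 : Cub lx ly lz 1 0 0 B := I.lowB H (by simp) (by simp) (by simp) (by simp)
  have := H.cx.not_both B (fun t => t.1) h1.mx h.mx
  rw [H.cardB] at this
  exact sqndvd H.cx.prime H.cy.prime H.cz.prime H.hpq H.hpr this

lemma Ij.a200 (I : Ij lx ly lz B) (H : Tile lx ly lz p q r A B) : Cub lx ly lz 2 0 0 A :=
  (H.dich 2 0 0 (by simp) (by simp) (by simp) (by simp)).resolve_right (I.b200 H)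

lemma Ij.a100 (I : Ij lx ly lz B) (H : Tile lx ly lz p q r A B) : ¬ Cub lx ly lz 1 0 0 A := by
  intro h
  have := H.cx.not_both A (fun t => t.1) h.mx (I.a200 H).mx
  rw [H.cardA] at this
  exact sqndvd H.cx.prime H.cy.prime H.cz.prime H.hpq H.hpr this

lemma Ij.hiA (I : Ij lx ly lz B) (H : Tile lx ly lz p q r A B) (c : Cub lx ly lz 2 2 2 A)
    {e1 e2 e3 : ℕ} (h1 : e1 = 0 ∨ e1 = 2) (h2 : e2 = 0 ∨ e2 = 2) (h3 : e3 = 0 ∨ e3 = 2)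
    (h : e1 + e2 + e3 ≠ 0) : Cub lx ly lz e1 e2 e3 A := by
  rcases h1 with rfl | rfl <;> rcases h2 with rfl | rfl <;> rcases h3 with rfl | rfl
  · simp at h
  · exact Cub.s23.1 (Cub.s12.1 (I.s23.s12.a200 H.s23.s12))
  · exact Cub.s12.1 (I.s12.a200 H.s12)
  · exact Cub.s12.1 (Cub.s23.1 (I.s12.s23.a220 H.s12.s23))
  · exact I.a200 H
  · exact Cub.s23.1 (I.s23.a220 H.s23)
  · exact I.a220 H
  · exact c

lemma Ij.loA (I : Ij lx ly lz B) (H : Tile lx ly lz p q r A B) : ¬ Cub lx ly lz 1 0 0 A ∧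
    ¬ Cub lx ly lz 0 1 0 A ∧ ¬ Cub lx ly lz 0 0 1 A :=
  ⟨I.a100 H, fun h => I.s12.a100 H.s12 (Cub.s12.2 h),
    fun h => I.s23.s12.a100 H.s23.s12 (Cub.s12.2 (Cub.s23.2 h))⟩

lemma Ij.hiB (I : Ij lx ly lz B) (H : Tile lx ly lz p q r A B) : ¬ Cub lx ly lz 2 0 0 B ∧
    ¬ Cub lx ly lz 0 2 0 B ∧ ¬ Cub lx ly lz 0 0 2 B :=
  ⟨I.b200 H, fun h => I.s12.b200 H.s12 (Cub.s12.2 h),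
    fun h => I.s23.s12.b200 H.s23.s12 (Cub.s12.2 (Cub.s23.2 h))⟩

end

end


section
open Finset
set_option linter.unusedSectionVars false

section

/-- low digit -/
def ll (p : ℕ) (x : ZMod (p ^ 2)) : ℕ := (ZMod.castHom (dvd_pow_self p two_ne_zero) (ZMod p) x).val

lemma cast_iff {M d : ℕ} [NeZero M] (h : d ∣ M) (x y : ZMod M) :
    ZMod.castHom h (ZMod d) x = ZMod.castHom h (ZMod d) y ↔ d ∣ (x - y).val := by
  rw [← sub_eq_zero, ← map_sub]
  conv_lhs => rw [← ZMod.natCast_zmod_val (x - y), map_natCast]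
  rw [ZMod.natCast_eq_zero_iff]

lemma dvd_val {M d : ℕ} [NeZero M] (h : d ∣ M) (x : ZMod M) : (d : ZMod M) ∣ x ↔ d ∣ x.val := by
  constructor
  · rintro ⟨w, hw⟩
    have := (cast_iff h x 0).1 (by rw [hw, map_mul, map_natCast, map_zero]; simp)
    simpa using this
  · rintro ⟨k, hk⟩
    refine ⟨(k : ZMod M), ?_⟩
    rw [← Nat.cast_mul, ← hk, ZMod.natCast_zmod_val]

lemma ll_cast {p : ℕ} [NeZero p] {x x' : ZMod (p ^ 2)} : ll p x = ll p x' ↔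
    ZMod.castHom (dvd_pow_self p two_ne_zero) (ZMod p) x =
    ZMod.castHom (dvd_pow_self p two_ne_zero) (ZMod p) x' :=
  ⟨fun h => ZMod.val_injective p h, fun h => by rw [ll, ll, h]⟩

lemma ll_iff {p : ℕ} [NeZero p] {x x' : ZMod (p ^ 2)} : ll p x = ll p x' ↔
    ∃ u, x = x' + p * u := by
  rw [ll_cast, cast_iff, ← dvd_val (dvd_pow_self p two_ne_zero)]
  constructor
  · rintro ⟨u, hu⟩; exact ⟨u, by rw [← hu]; ring⟩
  · rintro ⟨u, hu⟩; exact ⟨u, by rw [hu]; ring⟩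

lemma ll_coord {p : ℕ} [NeZero p] (hp : p.Prime) (h3 : 3 ≤ p) : Coord (ZMod (p ^ 2)) (ll p) p where
  prime := hp
  three := h3
  card := ZMod.card _
  fib x := by
    set F := ZMod.castHom (dvd_pow_self p two_ne_zero) (ZMod p) with hF
    have e : ∀ c, (univ.filter fun x' : ZMod (p ^ 2) => F x' = c).card =
        (univ.filter fun x' => ll p x' = ll p x).card := by
      intro c
      rw [AddMonoidHom.card_fiber_eq_of_mem_range F (ZMod.castHom_surjective _ c)
        (ZMod.castHom_surjective _ (F x))]
      congr 1
      ext t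
      simp only [mem_filter, mem_univ, true_and]
      exact ll_cast.symm
    have := card_eq_sum_card_fiberwise (f := F) (s := (univ : Finset (ZMod (p ^ 2))))
      (t := (univ : Finset (ZMod p))) (fun _ _ => mem_univ _)
    rw [sum_congr rfl (fun c _ => e c), sum_const, card_univ, card_univ, ZMod.card, ZMod.card,
      smul_eq_mul] at this
    exact Nat.eq_of_mul_eq_mul_left hp.pos (this.symm.trans (pow_two p))

lemma dec {p : ℕ} [NeZero p] (hp : p.Prime) {e : ℕ} (he : e ≤ 2) (f : ZMod (p ^ 2) → ℚ)
    (hf : Vt (ll p) e f) : ∃ c : ZMod (p ^ 2) → ℂ,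
      (∀ x, (f x : ℂ) = ∑ j, c j * ZMod.stdAddChar (j * x)) ∧
      ∀ j, c j ≠ 0 → orderOf (ZMod.stdAddChar j : ℂ) = p ^ e := by
  have : Fact p.Prime := ⟨hp⟩
  set F : ZMod (p ^ 2) → ℂ := fun x => (f x : ℂ) with hF
  have hN : (((p ^ 2 : ℕ) : ℂ))⁻¹ ≠ 0 := by
    have := hp.pos; simp; omega
  refine ⟨fun j => (((p ^ 2 : ℕ) : ℂ))⁻¹ * ZMod.dft F j, ?_, ?_⟩
  · intro x
    have h := ZMod.invDFT_apply (ZMod.dft F) x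
    rw [LinearEquiv.symm_apply_apply] at h
    change F x = _
    rw [h, smul_eq_mul, mul_sum]
    refine sum_congr rfl fun j _ => ?_
    rw [smul_eq_mul]; ring
  · intro j hj
    have hj : ZMod.dft F j ≠ 0 := fun h => hj (by simp [h])
    rw [ZMod.dft_apply] at hj
    have cp : ∀ n : ℕ, (ZMod.stdAddChar j : ℂ) ^ n = ZMod.stdAddChar ((n : ZMod (p ^ 2)) * j) := by
      intro n
      rw [← AddChar.map_nsmul_eq_pow, nsmul_eq_mul]
    interval_cases e
    · obtain ⟨c, hc⟩ := hf
      have : j = 0 := by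
        by_contra h0
        apply hj
        simp only [hF, hc, smul_eq_mul]
        rw [← sum_mul]
        have := AddChar.sum_mulShift (R := ZMod (p ^ 2)) (R' := ℂ) (-j) (ZMod.isPrimitive_stdAddChar (p ^ 2))
        simp only [neg_eq_zero, h0, if_false] at this
        simp only [mul_neg] at this
        push_cast at this
        rw [this, zero_mul]
      subst this
      simp
    · have h1 : (ZMod.stdAddChar j : ℂ) ^ p = 1 := by
        rw [cp]
        have hs : ∑ x, ZMod.stdAddChar (-(x * j)) • F x =
            ZMod.stdAddChar (-((p : ZMod (p ^ 2)) * j)) * ∑ x, ZMod.stdAddChar (-(x * j)) • F x := by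
          conv_lhs => rw [← Equiv.sum_comp (Equiv.addRight (p : ZMod (p ^ 2)))]
          rw [mul_sum]
          refine sum_congr rfl fun x _ => ?_
          have : F (x + p) = F x := by
            simp only [hF]
            rw [hf.1 (x + p) x (ll_iff.2 ⟨1, by ring⟩)]
          simp only [Equiv.coe_addRight, smul_eq_mul, this]
          rw [← mul_assoc, ← AddChar.map_add_eq_mul]
          congr 2; ring
        have h2 : ZMod.stdAddChar (-((p : ZMod (p ^ 2)) * j)) = (1 : ℂ) :=
          mul_right_cancel₀ hj (by rw [one_mul]; exact hs.symm)
        rw [AddChar.map_neg_eq_inv, inv_eq_one] at h2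
        exact h2
      have h2 : (ZMod.stdAddChar j : ℂ) ≠ 1 := by
        intro h
        have : j = 0 := ZMod.injective_stdAddChar (by rw [h, AddChar.map_zero_eq_one])
        subst this
        apply hj
        simp only [mul_zero, neg_zero, AddChar.map_zero_eq_one, one_smul, hF]
        exact_mod_cast hf.2
      rw [pow_one]
      exact orderOf_eq_prime h1 h2
    · refine orderOf_eq_prime_pow (n := 1) ?_ ?_
      · rw [pow_one, cp]
        intro h
        apply hj
        rw [← sum_fiberwise_of_maps_to (t := univ.image (ll p)) (g := ll p)
          (fun x _ => mem_image_of_mem _ (mem_univ x))]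
        refine sum_eq_zero fun c hc => ?_
        obtain ⟨x, _, rfl⟩ := mem_image.1 hc
        have := hf x
        rw [sum_congr rfl (g := fun x' => ZMod.stdAddChar (-(x * j)) * F x'), ← mul_sum]
        · have h0 : ∑ x' with ll p x' = ll p x, F x' = 0 := by simp only [hF]; exact_mod_cast this
          rw [h0, mul_zero]
        · intro t ht
          obtain ⟨u, hu⟩ := ll_iff.1 (mem_filter.1 ht).2
          rw [smul_eq_mul, hu]
          congr 1
          have : -((x + p * u) * j) = -(x * j) + -((u.val : ZMod (p ^ 2)) * (p * j)) := by
            rw [ZMod.natCast_zmod_val]; ring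
          rw [this, AddChar.map_add_eq_mul, AddChar.map_neg_eq_inv (ZMod.stdAddChar) (_ * (_ * j)),
            ← nsmul_eq_mul u.val, AddChar.map_nsmul_eq_pow, h]
          simp
      · rw [cp]
        norm_num
end

end


section
open Finset
set_option linter.unusedSectionVars false

section
variable {M p q r : ℕ} [NeZero M] [NeZero p] [NeZero q] [NeZero r]

lemma cyc_iff {s : ℕ} (hs : 0 < s) {ω : ℂ} (h : IsPrimitiveRoot ω s) (T : Finset (ZMod M)) :
    cycDvd M s T ↔ ∑ t ∈ T, ω ^ t.val = 0 := by
  have e : Polynomial.aeval ω (maskPoly M T) = ∑ t ∈ T, ω ^ t.val := by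
    simp [maskPoly]
  rw [← e, cycDvd, Polynomial.cyclotomic_eq_minpoly h hs]
  constructor
  · rintro ⟨g, hg⟩
    rw [hg, map_mul, minpoly.aeval, zero_mul]
  · intro h0
    exact minpoly.isIntegrallyClosed_dvd (h.isIntegral hs) h0

lemma om_add {ω : ℂ} (h : ω ^ M = 1) (a b : ZMod M) : ω ^ (a + b).val = ω ^ a.val * ω ^ b.val := by
  rw [ZMod.val_add, ← pow_add]
  exact (pow_eq_pow_mod _ h).symm

lemma dich_cyc {s : ℕ} (hs : 1 < s) (hsM : s ∣ M) {A B : Finset (ZMod M)}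
    (ht : IsTiling M (A : Set (ZMod M)) (B : Set (ZMod M))) : cycDvd M s A ∨ cycDvd M s B := by
  have hω := Complex.isPrimitiveRoot_exp s (by omega)
  set ω := Complex.exp (2 * Real.pi * Complex.I / s)
  rw [cyc_iff (by omega) hω, cyc_iff (by omega) hω, ← mul_eq_zero]
  have hM : ω ^ M = 1 := by rw [hω.pow_eq_one_iff_dvd]; exact hsM
  have h1 : ω ≠ 1 := hω.ne_one hs
  have hM1 : M ≠ 1 := by
    rintro rfl
    exact h1 (by simpa using hM)
  have hz : ∑ z : ZMod M, ω ^ z.val = 0 := by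
    have e : ∑ z : ZMod M, ω ^ z.val = (∑ z : ZMod M, ω ^ z.val) * ω := by
      conv_lhs => rw [← Equiv.sum_comp (Equiv.addRight (1 : ZMod M))]
      rw [sum_mul]
      refine sum_congr rfl fun z _ => ?_
      rw [Equiv.coe_addRight, om_add hM, ZMod.val_one'' hM1, pow_one]
    have : (∑ z : ZMod M, ω ^ z.val) * (ω - 1) = 0 := by rw [mul_sub, ← e]; ring
    exact (mul_eq_zero.1 this).resolve_right (sub_ne_zero.2 h1)
  rw [← hz, sum_mul_sum, ← sum_product']
  refine sum_bij (fun t _ => t.1 + t.2) (fun _ _ => mem_univ _) ?_ ?_ ?_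
  · intro a ha b hb hab
    rw [mem_product] at ha hb
    exact (ht (a.1 + a.2)).unique ⟨ha.1, ha.2, rfl⟩ ⟨hb.1, hb.2, hab.symm⟩
  · intro z _
    obtain ⟨ab, ⟨h1, h2, h3⟩, _⟩ := ht z
    exact ⟨ab, mem_product.2 ⟨h1, h2⟩, h3⟩
  · intro a _
    rw [om_add hM]

/-- the three coordinates of a point -/
def ph (h1 : p ^ 2 ∣ M) (h2 : q ^ 2 ∣ M) (h3 : r ^ 2 ∣ M) (t : ZMod M) :
    ZMod (p ^ 2) × ZMod (q ^ 2) × ZMod (r ^ 2) :=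
  (ZMod.castHom h1 _ t, ZMod.castHom h2 _ t, ZMod.castHom h3 _ t)

lemma ph_inj (h1 : p ^ 2 ∣ M) (h2 : q ^ 2 ∣ M) (h3 : r ^ 2 ∣ M) (hM : M = p ^ 2 * q ^ 2 * r ^ 2)
    (hp : p.Prime) (hq : q.Prime) (hr : r.Prime) (hpq : p ≠ q) (hpr : p ≠ r) (hqr : q ≠ r) : Function.Injective (ph h1 h2 h3) := by
  intro x y h
  simp only [ph, Prod.mk.injEq] at h
  rw [cast_iff, cast_iff, cast_iff] at h
  have a := (Nat.coprime_primes hp hq).2 hpq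
  have b := (Nat.coprime_primes hp hr).2 hpr
  have c := (Nat.coprime_primes hq hr).2 hqr
  have d : p ^ 2 * q ^ 2 * r ^ 2 ∣ (x - y).val := by
    refine Nat.Coprime.mul_dvd_of_dvd_of_dvd ?_ (Nat.Coprime.mul_dvd_of_dvd_of_dvd ?_ h.1 h.2.1) h.2.2
    · exact Nat.Coprime.mul_left (Nat.Coprime.pow _ _ b) (Nat.Coprime.pow _ _ c)
    · exact Nat.Coprime.pow _ _ a
  rw [← hM] at d
  have := Nat.eq_zero_of_dvd_of_lt d (ZMod.val_lt _)
  rw [ZMod.val_eq_zero] at this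
  exact sub_eq_zero.1 this

lemma chi_cast {d : ℕ} [NeZero d] (h : d ∣ M) (j : ZMod d) (t : ZMod M) :
    (ZMod.stdAddChar (j * ZMod.castHom h (ZMod d) t) : ℂ) = (ZMod.stdAddChar j) ^ t.val := by
  conv_lhs => rw [← ZMod.natCast_zmod_val t, map_natCast, mul_comm, ← nsmul_eq_mul,
    AddChar.map_nsmul_eq_pow]

lemma cyc_cub (h1 : p ^ 2 ∣ M) (h2 : q ^ 2 ∣ M) (h3 : r ^ 2 ∣ M) (hM : M = p ^ 2 * q ^ 2 * r ^ 2)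
    (hp : p.Prime) (hq : q.Prime) (hr : r.Prime) (hpq : p ≠ q) (hpr : p ≠ r) (hqr : q ≠ r)
    {e1 e2 e3 : ℕ} (l1 : e1 ≤ 2) (l2 : e2 ≤ 2) (l3 : e3 ≤ 2) {T : Finset (ZMod M)}
    (h : cycDvd M (p ^ e1 * q ^ e2 * r ^ e3) T) :
    Cub (ll p) (ll q) (ll r) e1 e2 e3 (T.image (ph h1 h2 h3)) := by
  intro f g k hf hg hk
  have a := (Nat.coprime_primes hp hq).2 hpq
  have b := (Nat.coprime_primes hp hr).2 hpr
  have c := (Nat.coprime_primes hq hr).2 hqr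
  rw [sum_image (ph_inj h1 h2 h3 hM hp hq hr hpq hpr hqr).injOn]
  obtain ⟨cf, f1, f2⟩ := dec hp l1 f hf
  obtain ⟨cg, g1, g2⟩ := dec hq l2 g hg
  obtain ⟨ck, k1, k2⟩ := dec hr l3 k hk
  have key : ((∑ t ∈ T, f (ph h1 h2 h3 t).1 * g (ph h1 h2 h3 t).2.1 * k (ph h1 h2 h3 t).2.2 : ℚ) : ℂ)
      = ∑ i, ∑ j, ∑ m, ∑ t ∈ T, cf i * cg j * ck m *
        (ZMod.stdAddChar i * ZMod.stdAddChar j * ZMod.stdAddChar m) ^ t.val := by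
    push_cast
    have : ∀ t ∈ T, (f (ph h1 h2 h3 t).1 : ℂ) * g (ph h1 h2 h3 t).2.1 * k (ph h1 h2 h3 t).2.2 =
        ∑ i, ∑ j, ∑ m, cf i * cg j * ck m *
        (ZMod.stdAddChar i * ZMod.stdAddChar j * ZMod.stdAddChar m) ^ t.val := by
      intro t _
      rw [f1, g1, k1, sum_mul_sum, sum_mul]
      refine sum_congr rfl fun i _ => ?_
      rw [sum_mul]
      refine sum_congr rfl fun j _ => ?_
      rw [mul_sum]
      refine sum_congr rfl fun m _ => ?_
      simp only [ph]
      rw [chi_cast, chi_cast, chi_cast, mul_pow, mul_pow]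
      ring
    rw [sum_congr rfl this, sum_comm]
    refine sum_congr rfl fun i _ => ?_
    rw [sum_comm]
    refine sum_congr rfl fun j _ => ?_
    rw [sum_comm]
  have z : ((∑ t ∈ T, f (ph h1 h2 h3 t).1 * g (ph h1 h2 h3 t).2.1 * k (ph h1 h2 h3 t).2.2 : ℚ) : ℂ)
      = 0 := by
    rw [key]
    refine sum_eq_zero fun i _ => sum_eq_zero fun j _ => sum_eq_zero fun m _ => ?_
    rw [← mul_sum]
    by_cases z1 : cf i = 0
    · rw [z1]; ring
    by_cases z2 : cg j = 0
    · rw [z2]; ring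
    by_cases z3 : ck m = 0
    · rw [z3]; ring
    have o1 := f2 i z1
    have o2 := g2 j z2
    have o3 := k2 m z3
    have o12 : orderOf (ZMod.stdAddChar i * ZMod.stdAddChar j : ℂ) = p ^ e1 * q ^ e2 := by
      rw [Commute.orderOf_mul_eq_mul_orderOf_of_coprime (Commute.all _ _), o1, o2]
      rw [o1, o2]; exact Nat.Coprime.pow _ _ a
    have o123 : orderOf (ZMod.stdAddChar i * ZMod.stdAddChar j * ZMod.stdAddChar m : ℂ) =
        p ^ e1 * q ^ e2 * r ^ e3 := by
      rw [Commute.orderOf_mul_eq_mul_orderOf_of_coprime (Commute.all _ _), o12, o3]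
      rw [o12, o3]
      exact Nat.Coprime.mul_left (Nat.Coprime.pow _ _ b) (Nat.Coprime.pow _ _ c)
    have hs : 0 < p ^ e1 * q ^ e2 * r ^ e3 := by
      have := hp.pos; have := hq.pos; have := hr.pos; positivity
    rw [(cyc_iff hs (IsPrimitiveRoot.iff_orderOf.2 o123) T).1 h, mul_zero]
  exact_mod_cast z

/-- reproducing property of the kernels -/
lemma repr_EE (hp : p.Prime) (h3 : 3 ≤ p) {e : ℕ} (he : e ≤ 2) {ω : ℂ} (hω : IsPrimitiveRoot ω (p ^ e))
    (x' : ZMod (p ^ 2)) :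
    ω ^ x'.val = ∑ x : ZMod (p ^ 2), ω ^ x.val * (EE (ll p) p e x x' : ℂ) := by
  have c := ll_coord hp h3
  have hp0 : (p : ℂ) ≠ 0 := by exact_mod_cast hp.ne_zero
  have hM : ω ^ (p ^ 2) = 1 := by
    rw [hω.pow_eq_one_iff_dvd]; exact pow_dvd_pow p he
  have hz : ω ≠ 1 → ∑ z : ZMod (p ^ 2), ω ^ z.val = 0 := by
    intro h1
    have e : ∑ z : ZMod (p ^ 2), ω ^ z.val = (∑ z : ZMod (p ^ 2), ω ^ z.val) * ω := by
      conv_lhs => rw [← Equiv.sum_comp (Equiv.addRight (1 : ZMod (p ^ 2)))]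
      rw [sum_mul]
      refine sum_congr rfl fun z _ => ?_
      rw [Equiv.coe_addRight, om_add hM, ZMod.val_one'' (by nlinarith), pow_one]
    have : (∑ z : ZMod (p ^ 2), ω ^ z.val) * (ω - 1) = 0 := by rw [mul_sub, ← e]; ring
    exact (mul_eq_zero.1 this).resolve_right (sub_ne_zero.2 h1)
  have hv : ((p : ZMod (p ^ 2))).val = p := by
    rw [ZMod.val_natCast]; exact Nat.mod_eq_of_lt (by nlinarith)
  interval_cases e
  · have : ω = 1 := by simpa using hω
    subst this
    simp [EE, ZMod.card]
  · have hω1 : ω ^ p = 1 := by simpa using hω.pow_eq_one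
    have hn : ω ≠ 1 := hω.ne_one (by simpa using hp.one_lt)
    have cl : ∀ x, ll p x = ll p x' → ω ^ x.val = ω ^ x'.val := by
      intro x hx
      obtain ⟨u, hu⟩ := ll_iff.1 hx
      rw [hu, om_add hM]
      have : ω ^ ((p : ZMod (p ^ 2)) * u).val = 1 := by
        rw [ZMod.val_mul, ← pow_eq_pow_mod _ hM, hv, pow_mul, hω1, one_pow]
      rw [this, mul_one]
    have e1 : ∀ x : ZMod (p ^ 2), ω ^ x.val * (EE (ll p) p 1 x x' : ℂ) =
        (if ll p x = ll p x' then ω ^ x'.val / p else 0) - ω ^ x.val * (1 / (p : ℂ) ^ 2) := by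
      intro x
      by_cases hx : ll p x = ll p x'
      · simp [EE, hx, cl x hx]; ring
      · simp [EE, hx]
    rw [sum_congr rfl (fun x _ => e1 x), sum_sub_distrib, ← sum_mul, hz hn, ← sum_filter, sum_const,
      c.fib, nsmul_eq_mul]
    field_simp; ring
  · have cs : ∑ x with ll p x = ll p x', ω ^ x.val = 0 := by
      have hn : ω ^ p ≠ 1 := by
        intro h
        rw [hω.pow_eq_one_iff_dvd] at h
        have := Nat.le_of_dvd hp.pos h
        nlinarith
      have e : ∑ x with ll p x = ll p x', ω ^ x.val = (∑ x with ll p x = ll p x', ω ^ x.val) * ω ^ p := by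
        rw [sum_mul]
        symm
        refine sum_bij (fun x _ => x + p) ?_ ?_ ?_ ?_
        · intro x hx
          simp only [mem_filter, mem_univ, true_and] at hx ⊢
          rw [← hx]; exact ll_iff.2 ⟨1, by ring⟩
        · intro x _ y _ h; exact add_right_cancel h
        · intro x hx
          simp only [mem_filter, mem_univ, true_and] at hx
          refine ⟨x - p, ?_, by ring⟩
          simp only [mem_filter, mem_univ, true_and]
          rw [← hx]; exact ll_iff.2 ⟨-1, by ring⟩
        · intro x _
          rw [om_add hM, hv]
      have : (∑ x with ll p x = ll p x', ω ^ x.val) * (ω ^ p - 1) = 0 := by rw [mul_sub, ← e]; ring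
      exact (mul_eq_zero.1 this).resolve_right (sub_ne_zero.2 hn)
    have e1 : ∀ x : ZMod (p ^ 2), ω ^ x.val * (EE (ll p) p 2 x x' : ℂ) =
        (if x = x' then ω ^ x.val else 0) - (if ll p x = ll p x' then ω ^ x.val else 0) * (1 / p) := by
      intro x
      by_cases hx : ll p x = ll p x' <;> by_cases hx' : x = x' <;> simp [EE, hx, hx'] <;> ring
    rw [sum_congr rfl (fun x _ => e1 x), sum_sub_distrib, ← sum_mul, ← sum_filter (fun x => ll p x = ll p x'), cs]
    simp

lemma pow_cast {d : ℕ} [NeZero d] (h : d ∣ M) {ω : ℂ} (hω : ω ^ d = 1) (t : ZMod M) :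
    ω ^ t.val = ω ^ (ZMod.castHom h (ZMod d) t).val := by
  conv_rhs => rw [← ZMod.natCast_zmod_val t, map_natCast, ZMod.val_natCast, ← pow_eq_pow_mod _ hω]

lemma cub_cyc (h1 : p ^ 2 ∣ M) (h2 : q ^ 2 ∣ M) (h3 : r ^ 2 ∣ M) (hM : M = p ^ 2 * q ^ 2 * r ^ 2)
    (hp : p.Prime) (hq : q.Prime) (hr : r.Prime) (hpq : p ≠ q) (hpr : p ≠ r) (hqr : q ≠ r)
    (t1 : 3 ≤ p) (t2 : 3 ≤ q) (t3 : 3 ≤ r)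
    {e1 e2 e3 : ℕ} (l1 : e1 ≤ 2) (l2 : e2 ≤ 2) (l3 : e3 ≤ 2) {T : Finset (ZMod M)}
    (h : Cub (ll p) (ll q) (ll r) e1 e2 e3 (T.image (ph h1 h2 h3))) :
    cycDvd M (p ^ e1 * q ^ e2 * r ^ e3) T := by
  have a := (Nat.coprime_primes hp hq).2 hpq
  have b := (Nat.coprime_primes hp hr).2 hpr
  have c := (Nat.coprime_primes hq hr).2 hqr
  have w1 := Complex.isPrimitiveRoot_exp (p ^ e1) (pow_ne_zero _ hp.ne_zero)
  have w2 := Complex.isPrimitiveRoot_exp (q ^ e2) (pow_ne_zero _ hq.ne_zero)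
  have w3 := Complex.isPrimitiveRoot_exp (r ^ e3) (pow_ne_zero _ hr.ne_zero)
  generalize Complex.exp (2 * Real.pi * Complex.I / ((p ^ e1 : ℕ) : ℂ)) = ω1 at w1
  generalize Complex.exp (2 * Real.pi * Complex.I / ((q ^ e2 : ℕ) : ℂ)) = ω2 at w2
  generalize Complex.exp (2 * Real.pi * Complex.I / ((r ^ e3 : ℕ) : ℂ)) = ω3 at w3
  have o1 := IsPrimitiveRoot.iff_orderOf.1 w1
  have o2 := IsPrimitiveRoot.iff_orderOf.1 w2
  have o3 := IsPrimitiveRoot.iff_orderOf.1 w3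
  have o12 : orderOf (ω1 * ω2) = p ^ e1 * q ^ e2 := by
    rw [Commute.orderOf_mul_eq_mul_orderOf_of_coprime (Commute.all _ _), o1, o2]
    rw [o1, o2]; exact Nat.Coprime.pow _ _ a
  have o123 : orderOf (ω1 * ω2 * ω3) = p ^ e1 * q ^ e2 * r ^ e3 := by
    rw [Commute.orderOf_mul_eq_mul_orderOf_of_coprime (Commute.all _ _), o12, o3]
    rw [o12, o3]
    exact Nat.Coprime.mul_left (Nat.Coprime.pow _ _ b) (Nat.Coprime.pow _ _ c)
  have hs : 0 < p ^ e1 * q ^ e2 * r ^ e3 := by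
    have := hp.pos; have := hq.pos; have := hr.pos; positivity
  rw [cyc_iff hs (IsPrimitiveRoot.iff_orderOf.2 o123) T]
  have v1 : ω1 ^ p ^ 2 = 1 := by rw [w1.pow_eq_one_iff_dvd]; exact pow_dvd_pow _ l1
  have v2 : ω2 ^ q ^ 2 = 1 := by rw [w2.pow_eq_one_iff_dvd]; exact pow_dvd_pow _ l2
  have v3 : ω3 ^ r ^ 2 = 1 := by rw [w3.pow_eq_one_iff_dvd]; exact pow_dvd_pow _ l3
  have hz : ∀ i j m, ∑ t ∈ T, ((EE (ll p) p e1 i (ph h1 h2 h3 t).1 *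
      EE (ll q) q e2 j (ph h1 h2 h3 t).2.1 * EE (ll r) r e3 m (ph h1 h2 h3 t).2.2 : ℚ) : ℂ) = 0 := by
    intro i j m
    have := h _ _ _ (EE_Vt (ll_coord hp t1) i e1 l1) (EE_Vt (ll_coord hq t2) j e2 l2)
      (EE_Vt (ll_coord hr t3) m e3 l3)
    rw [sum_image (ph_inj h1 h2 h3 hM hp hq hr hpq hpr hqr).injOn] at this
    exact_mod_cast this
  have key : ∀ t ∈ T, (ω1 * ω2 * ω3) ^ t.val = ∑ i : ZMod (p ^ 2), ∑ j : ZMod (q ^ 2), ∑ m : ZMod (r ^ 2),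
      ω1 ^ i.val * ω2 ^ j.val * ω3 ^ m.val * ((EE (ll p) p e1 i (ph h1 h2 h3 t).1 *
      EE (ll q) q e2 j (ph h1 h2 h3 t).2.1 * EE (ll r) r e3 m (ph h1 h2 h3 t).2.2 : ℚ) : ℂ) := by
    intro t _
    rw [mul_pow, mul_pow, pow_cast h1 v1, pow_cast h2 v2, pow_cast h3 v3, repr_EE hp t1 l1 w1,
      repr_EE hq t2 l2 w2, repr_EE hr t3 l3 w3, sum_mul_sum, sum_mul]
    refine sum_congr rfl fun i _ => ?_
    rw [sum_mul]
    refine sum_congr rfl fun j _ => ?_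
    rw [mul_sum]
    refine sum_congr rfl fun m _ => ?_
    simp only [ph]
    push_cast
    ring
  rw [sum_congr rfl key, sum_comm]
  refine sum_eq_zero fun i _ => ?_
  rw [sum_comm]
  refine sum_eq_zero fun j _ => ?_
  rw [sum_comm]
  refine sum_eq_zero fun m _ => ?_
  rw [← mul_sum, hz, mul_zero]

end

end


section
open Finset
set_option linter.unusedSectionVars false

section
variable {M p q r : ℕ} [NeZero M] [NeZero p] [NeZero q] [NeZero r]

lemma ll_ph (h1 : p ^ 2 ∣ M) (x y : ZMod M) :
    ll p (ZMod.castHom h1 (ZMod (p ^ 2)) x) = ll p (ZMod.castHom h1 (ZMod (p ^ 2)) y) ↔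
      p ∣ (x - y).val := by
  have e : ∀ t, ZMod.castHom (dvd_pow_self p two_ne_zero) (ZMod p) (ZMod.castHom h1 (ZMod (p ^ 2)) t)
      = ZMod.castHom ((dvd_pow_self p two_ne_zero).trans h1) (ZMod p) t := by
    intro t
    rw [← RingHom.comp_apply]
    exact RingHom.congr_fun (Subsingleton.elim _ _) t
  rw [ll_cast, e, e, cast_iff]

lemma grid_iff (h1 : p ^ 2 ∣ M) (h2 : q ^ 2 ∣ M) (h3 : r ^ 2 ∣ M) (hM : M = p ^ 2 * q ^ 2 * r ^ 2)
    (hp : p.Prime) (hq : q.Prime) (hr : r.Prime) (hpq : p ≠ q) (hpr : p ≠ r) (hqr : q ≠ r)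
    (x y : ZMod M) : y ∈ gridSet M x (p * q * r) ↔
      ll p (ph h1 h2 h3 y).1 = ll p (ph h1 h2 h3 x).1 ∧
      ll q (ph h1 h2 h3 y).2.1 = ll q (ph h1 h2 h3 x).2.1 ∧
      ll r (ph h1 h2 h3 y).2.2 = ll r (ph h1 h2 h3 x).2.2 := by
  have a := (Nat.coprime_primes hp hq).2 hpq
  have b := (Nat.coprime_primes hp hr).2 hpr
  have c := (Nat.coprime_primes hq hr).2 hqr
  simp only [ph]
  rw [ll_ph, ll_ph, ll_ph, gridSet, Set.mem_ofPred_eq, dvd_val ⟨p * q * r, by rw [hM]; ring⟩]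
  constructor
  · intro h
    exact ⟨(Dvd.intro (q * r) (by ring)).trans h, (Dvd.intro (p * r) (by ring)).trans h,
      (Dvd.intro (p * q) (by ring)).trans h⟩
  · rintro ⟨d1, d2, d3⟩
    exact Nat.Coprime.mul_dvd_of_dvd_of_dvd (Nat.Coprime.mul_left b c)
      (Nat.Coprime.mul_dvd_of_dvd_of_dvd a d1 d2) d3

/-- one coordinate of the fiber through a point -/
lemma fiber_dvd {D d : ℕ} (hD : D ∣ M) (hd : d ∣ D) {x y : ZMod M} (h : y ∈ gridSet M x D) :
    d ∣ (y - x).val := by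
  rw [gridSet, Set.mem_ofPred_eq, dvd_val hD] at h
  exact hd.trans h

lemma not_fib {D d : ℕ} {A : Finset (ZMod M)} {x0 : ZMod M}
    (hn : ¬ Fibered M d ((A : Set (ZMod M)) ∩ gridSet M x0 D)) :
    ∃ s ∈ A, s ∈ gridSet M x0 D ∧ ∃ y, y ∈ gridSet M s (M / d) ∧ ¬ (y ∈ A ∧ y ∈ gridSet M x0 D) := by
  unfold Fibered at hn
  push Not at hn
  obtain ⟨s, ⟨h1, h2⟩, h3⟩ := hn
  rw [Set.not_subset] at h3
  obtain ⟨y, h4, h5⟩ := h3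
  exact ⟨s, h1, h2, y, h4, h5⟩

lemma fib_x (h1 : p ^ 2 ∣ M) (h2 : q ^ 2 ∣ M) (h3 : r ^ 2 ∣ M) (hM : M = p ^ 2 * q ^ 2 * r ^ 2)
    {s y : ZMod M} (h : y ∈ gridSet M s (M / p)) :
    ll p (ph h1 h2 h3 y).1 = ll p (ph h1 h2 h3 s).1 ∧
      (ph h1 h2 h3 y).2.1 = (ph h1 h2 h3 s).2.1 ∧
      (ph h1 h2 h3 y).2.2 = (ph h1 h2 h3 s).2.2 := by
  have e : M / p = p * q ^ 2 * r ^ 2 := by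
    rw [hM]; exact Nat.div_eq_of_eq_mul_right (Nat.pos_of_ne_zero (NeZero.ne p)) (by ring)
  have hD : M / p ∣ M := ⟨p, by rw [e, hM]; ring⟩
  simp only [ph]
  rw [ll_ph, cast_iff, cast_iff]
  exact ⟨fiber_dvd hD (by rw [e]; exact ⟨q ^ 2 * r ^ 2, by ring⟩) h,
    fiber_dvd hD (by rw [e]; exact ⟨p * r ^ 2, by ring⟩) h,
    fiber_dvd hD (by rw [e]; exact ⟨p * q ^ 2, by ring⟩) h⟩

lemma fib_y (h1 : p ^ 2 ∣ M) (h2 : q ^ 2 ∣ M) (h3 : r ^ 2 ∣ M) (hM : M = p ^ 2 * q ^ 2 * r ^ 2)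
    {s y : ZMod M} (h : y ∈ gridSet M s (M / q)) :
    (ph h1 h2 h3 y).1 = (ph h1 h2 h3 s).1 ∧
      ll q (ph h1 h2 h3 y).2.1 = ll q (ph h1 h2 h3 s).2.1 ∧
      (ph h1 h2 h3 y).2.2 = (ph h1 h2 h3 s).2.2 := by
  have := fib_x h2 h1 h3 (by rw [hM]; ring) h
  exact ⟨this.2.1, this.1, this.2.2⟩

lemma fib_z (h1 : p ^ 2 ∣ M) (h2 : q ^ 2 ∣ M) (h3 : r ^ 2 ∣ M) (hM : M = p ^ 2 * q ^ 2 * r ^ 2)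
    {s y : ZMod M} (h : y ∈ gridSet M s (M / r)) :
    (ph h1 h2 h3 y).1 = (ph h1 h2 h3 s).1 ∧
      (ph h1 h2 h3 y).2.1 = (ph h1 h2 h3 s).2.1 ∧
      ll r (ph h1 h2 h3 y).2.2 = ll r (ph h1 h2 h3 s).2.2 := by
  have := fib_x h3 h1 h2 (by rw [hM]; ring) h
  exact ⟨this.2.1, this.2.2, this.1⟩

/-- exponent bound -/
lemma exp_le (hM : M = p ^ 2 * q ^ 2 * r ^ 2)
    (hp : p.Prime) (hq : q.Prime) (hr : r.Prime) (hpq : p ≠ q) (hpr : p ≠ r) {e : ℕ}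
    (h : p ^ e ∣ M) : e ≤ 2 := by
  have a := (Nat.coprime_primes hp hq).2 hpq
  have b := (Nat.coprime_primes hp hr).2 hpr
  rw [hM] at h
  have h' := Nat.Coprime.dvd_of_dvd_mul_right (Nat.Coprime.pow e 2 b) h
  have h'' := Nat.Coprime.dvd_of_dvd_mul_right (Nat.Coprime.pow e 2 a) h'
  exact (Nat.pow_dvd_pow_iff_le_right hp.one_lt).1 h''

lemma prime_of {l e : ℕ} (hM : M = p ^ 2 * q ^ 2 * r ^ 2)
    (hp : p.Prime) (hq : q.Prime) (hr : r.Prime) (hl : l.Prime) (he : 1 ≤ e) (h : l ^ e ∣ M) :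
    l = p ∨ l = q ∨ l = r := by
  have h : l ∣ p ^ 2 * q ^ 2 * r ^ 2 := by rw [← hM]; exact (dvd_pow_self l (by omega)).trans h
  rw [hl.dvd_mul, hl.dvd_mul] at h
  rcases h with (h | h) | h
  · exact Or.inl ((Nat.prime_dvd_prime_iff_eq hl hp).1 (hl.dvd_of_dvd_pow h))
  · exact Or.inr (Or.inl ((Nat.prime_dvd_prime_iff_eq hl hq).1 (hl.dvd_of_dvd_pow h)))
  · exact Or.inr (Or.inr ((Nat.prime_dvd_prime_iff_eq hl hr).1 (hl.dvd_of_dvd_pow h)))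

/-- (T2) from the list of admissible exponents -/
lemma t2_of (hM : M = p ^ 2 * q ^ 2 * r ^ 2)
    (hp : p.Prime) (hq : q.Prime) (hr : r.Prime) (hpq : p ≠ q) (hpr : p ≠ r) (hqr : q ≠ r)
    {T : Finset (ZMod M)} {v : ℕ}
    (g1 : ∀ e, 1 ≤ e → e ≤ 2 → cycDvd M (p ^ e * q ^ 0 * r ^ 0) T → e = v)
    (g2 : ∀ e, 1 ≤ e → e ≤ 2 → cycDvd M (p ^ 0 * q ^ e * r ^ 0) T → e = v)
    (g3 : ∀ e, 1 ≤ e → e ≤ 2 → cycDvd M (p ^ 0 * q ^ 0 * r ^ e) T → e = v)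
    (g : ∀ e1 e2 e3, (e1 = 0 ∨ e1 = v) → (e2 = 0 ∨ e2 = v) → (e3 = 0 ∨ e3 = v) →
      e1 + e2 + e3 ≠ 0 → cycDvd M (p ^ e1 * q ^ e2 * r ^ e3) T) : SatisfiesT2 M T := by
  intro P e hP h
  obtain ⟨E, hE⟩ : ∃ E : ℕ → ℕ, ∀ l, E l = if l ∈ P then e l else 0 := ⟨_, fun _ => rfl⟩
  have hprod : ∏ l ∈ P, l ^ e l = p ^ E p * q ^ E q * r ^ E r := by
    have : ∏ l ∈ ({p, q, r} : Finset ℕ), l ^ E l = p ^ E p * q ^ E q * r ^ E r := by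
      rw [prod_insert (by simp [hpq, hpr]), prod_insert (by simp [hqr]), prod_singleton, mul_assoc]
    rw [← this]
    have hsub : P ⊆ {p, q, r} := by
      intro l hl
      obtain ⟨a1, a2, a3, _⟩ := h l hl
      simpa using prime_of hM hp hq hr a1 a2 a3
    rw [← prod_subset hsub]
    · exact prod_congr rfl fun l hl => by rw [hE, if_pos hl]
    · intro l _ hl; rw [hE, if_neg hl, pow_zero]
  rw [hprod]
  have k1 : E p = 0 ∨ E p = v := by
    rw [hE]
    by_cases hl : p ∈ P
    · rw [if_pos hl]
      obtain ⟨a1, a2, a3, a4⟩ := h p hl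
      exact Or.inr (g1 _ a2 (exp_le hM hp hq hr hpq hpr a3) (by simpa using a4))
    · exact Or.inl (if_neg hl)
  have k2 : E q = 0 ∨ E q = v := by
    rw [hE]
    by_cases hl : q ∈ P
    · rw [if_pos hl]
      obtain ⟨a1, a2, a3, a4⟩ := h q hl
      exact Or.inr (g2 _ a2 (exp_le (p := q) (q := p) (r := r) (by rw [hM]; ring) hq hp hr hpq.symm hqr a3)
        (by simpa using a4))
    · exact Or.inl (if_neg hl)
  have k3 : E r = 0 ∨ E r = v := by
    rw [hE]
    by_cases hl : r ∈ P
    · rw [if_pos hl]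
      obtain ⟨a1, a2, a3, a4⟩ := h r hl
      exact Or.inr (g3 _ a2 (exp_le (p := r) (q := p) (r := q) (by rw [hM]; ring) hr hp hq hpr.symm
        hqr.symm a3) (by simpa using a4))
    · exact Or.inl (if_neg hl)
  refine g _ _ _ k1 k2 k3 ?_
  obtain ⟨l, hl⟩ := hP
  obtain ⟨a1, a2, a3, _⟩ := h l hl
  have hEl : 1 ≤ E l := by rw [hE, if_pos hl]; exact a2
  rcases prime_of hM hp hq hr a1 a2 a3 with rfl | rfl | rfl <;> omega

end


end

/-- Unfibered grid case: if `A ⊕ B = ℤ_M`, `|A| = |B| = p_i p_j p_k`,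
`Φ_M | A`, and some `D(M)`-grid `Λ` meets `A` in a nonempty set which is not `M`-fibered in
any of the three directions, then `Λ ⊕ B = ℤ_M` is also a tiling and both `A`, `B`
satisfy (T2). Here `D(M) = p_i p_j p_k`. -/
theorem statement2
    (pi pj pk : ℕ) (hpi : pi.Prime) (hpj : pj.Prime) (hpk : pk.Prime)
    (hoi : Odd pi) (hoj : Odd pj) (hok : Odd pk)
    (hij : pi ≠ pj) (hik : pi ≠ pk) (hjk : pj ≠ pk)
    (M : ℕ) (hM : M = pi ^ 2 * pj ^ 2 * pk ^ 2)
    (A B : Finset (ZMod M))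
    (htile : IsTiling M (A : Set (ZMod M)) (B : Set (ZMod M)))
    (hcardA : A.card = pi * pj * pk) (hcardB : B.card = pi * pj * pk)
    (hPhiM : cycDvd M M A)
    (x0 : ZMod M)
    (hne : ((A : Set (ZMod M)) ∩ gridSet M x0 (pi * pj * pk)).Nonempty)
    (hnfi : ¬ Fibered M pi ((A : Set (ZMod M)) ∩ gridSet M x0 (pi * pj * pk)))
    (hnfj : ¬ Fibered M pj ((A : Set (ZMod M)) ∩ gridSet M x0 (pi * pj * pk)))
    (hnfk : ¬ Fibered M pk ((A : Set (ZMod M)) ∩ gridSet M x0 (pi * pj * pk))) :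
    IsTiling M (gridSet M x0 (pi * pj * pk)) (B : Set (ZMod M)) ∧
      SatisfiesT2 M A ∧ SatisfiesT2 M B := by
  have three : ∀ p : ℕ, p.Prime → Odd p → 3 ≤ p := by
    intro p hp ho
    have := hp.two_le
    obtain ⟨k, hk⟩ := ho
    omega
  have t1 := three pi hpi hoi
  have t2 := three pj hpj hoj
  have t3 := three pk hpk hok
  have : NeZero pi := ⟨hpi.ne_zero⟩
  have : NeZero pj := ⟨hpj.ne_zero⟩
  have : NeZero pk := ⟨hpk.ne_zero⟩
  have : NeZero M := ⟨by rw [hM]; have := hpi.pos; have := hpj.pos; have := hpk.pos; positivity⟩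
  have h1 : pi ^ 2 ∣ M := ⟨pj ^ 2 * pk ^ 2, by rw [hM]; ring⟩
  have h2 : pj ^ 2 ∣ M := ⟨pi ^ 2 * pk ^ 2, by rw [hM]; ring⟩
  have h3 : pk ^ 2 ∣ M := ⟨pi ^ 2 * pj ^ 2, by rw [hM]; ring⟩
  have inj := ph_inj h1 h2 h3 hM hpi hpj hpk hij hik hjk
  have C1 : ∀ {e1 e2 e3 : ℕ} (_ : e1 ≤ 2) (_ : e2 ≤ 2) (_ : e3 ≤ 2) {T : Finset (ZMod M)},
      cycDvd M (pi ^ e1 * pj ^ e2 * pk ^ e3) T →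
      Cub (ll pi) (ll pj) (ll pk) e1 e2 e3 (T.image (ph h1 h2 h3)) :=
    fun a b c _ h => cyc_cub h1 h2 h3 hM hpi hpj hpk hij hik hjk a b c h
  have C2 : ∀ {e1 e2 e3 : ℕ} (_ : e1 ≤ 2) (_ : e2 ≤ 2) (_ : e3 ≤ 2) {T : Finset (ZMod M)},
      Cub (ll pi) (ll pj) (ll pk) e1 e2 e3 (T.image (ph h1 h2 h3)) →
      cycDvd M (pi ^ e1 * pj ^ e2 * pk ^ e3) T :=
    fun a b c _ h => cub_cyc h1 h2 h3 hM hpi hpj hpk hij hik hjk t1 t2 t3 a b c h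
  have H : Tile (ll pi) (ll pj) (ll pk) pi pj pk (A.image (ph h1 h2 h3)) (B.image (ph h1 h2 h3)) := by
    refine ⟨ll_coord hpi t1, ll_coord hpj t2, ll_coord hpk t3, hij, hik, hjk, ?_, ?_, ?_⟩
    · rw [Finset.card_image_of_injective _ inj, hcardA]
    · rw [Finset.card_image_of_injective _ inj, hcardB]
    · intro e1 e2 e3 l1 l2 l3 h0
      have hs : 1 < pi ^ e1 * pj ^ e2 * pk ^ e3 := by
        have a1 : 1 ≤ pi ^ e1 := Nat.one_le_pow _ _ hpi.pos
        have a2 : 1 ≤ pj ^ e2 := Nat.one_le_pow _ _ hpj.pos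
        have a3 : 1 ≤ pk ^ e3 := Nat.one_le_pow _ _ hpk.pos
        by_contra hh
        have hh : pi ^ e1 * pj ^ e2 * pk ^ e3 = 1 := by
          have : 0 < pi ^ e1 * pj ^ e2 * pk ^ e3 := by positivity
          omega
        have b3 := Nat.dvd_one.1 (Dvd.intro_left _ hh)
        rw [b3, mul_one] at hh
        have b2 := Nat.dvd_one.1 (Dvd.intro_left _ hh)
        have b1 := Nat.dvd_one.1 (Dvd.intro _ hh)
        rw [Nat.pow_eq_one] at b1 b2 b3
        omega
      have hd : pi ^ e1 * pj ^ e2 * pk ^ e3 ∣ M := by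
        rw [hM]
        exact mul_dvd_mul (mul_dvd_mul (pow_dvd_pow _ l1) (pow_dvd_pow _ l2)) (pow_dvd_pow _ l3)
      exact (dich_cyc hs hd htile).imp (C1 l1 l2 l3) (C1 l1 l2 l3)
  have c : Cub (ll pi) (ll pj) (ll pk) 2 2 2 (A.image (ph h1 h2 h3)) :=
    C1 le_rfl le_rfl le_rfl (by rw [← hM]; exact hPhiM)
  have G := grid_iff h1 h2 h3 hM hpi hpj hpk hij hik hjk
  have mA : ∀ t x y z, ph h1 h2 h3 t = (x, y, z) → ((x, y, z) ∈ A.image (ph h1 h2 h3) ↔ t ∈ A) := by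
    intro t x y z h
    rw [← h]
    exact inj.mem_finset_image
  have S : Su (ll pi) (ll pj) (ll pk) pi pj pk (A.image (ph h1 h2 h3)) (B.image (ph h1 h2 h3))
      (ph h1 h2 h3 x0).1 (ph h1 h2 h3 x0).2.1 (ph h1 h2 h3 x0).2.2 := by
    refine ⟨H, c, ?_, ?_, ?_⟩
    · obtain ⟨s, hs, hg, y, hy, hn⟩ := not_fib hnfi
      have f := fib_x h1 h2 h3 hM hy
      rw [G] at hg hn
      refine ⟨(ph h1 h2 h3 s).1, (ph h1 h2 h3 y).1, (ph h1 h2 h3 s).2.1, (ph h1 h2 h3 s).2.2,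
        hg.1, f.1.trans hg.1, hg.2.1, hg.2.2, (mA s _ _ _ rfl).2 hs, ?_⟩
      rw [mA y _ _ _ (by rw [← f.2.1, ← f.2.2])]
      exact fun hh => hn ⟨hh, f.1.trans hg.1, by rw [f.2.1]; exact hg.2.1, by rw [f.2.2]; exact hg.2.2⟩
    · obtain ⟨s, hs, hg, y, hy, hn⟩ := not_fib hnfj
      have f := fib_y h1 h2 h3 hM hy
      rw [G] at hg hn
      refine ⟨(ph h1 h2 h3 s).1, (ph h1 h2 h3 s).2.1, (ph h1 h2 h3 y).2.1, (ph h1 h2 h3 s).2.2,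
        hg.1, hg.2.1, f.2.1.trans hg.2.1, hg.2.2, (mA s _ _ _ rfl).2 hs, ?_⟩
      rw [mA y _ _ _ (by rw [← f.1, ← f.2.2])]
      exact fun hh => hn ⟨hh, by rw [f.1]; exact hg.1, f.2.1.trans hg.2.1, by rw [f.2.2]; exact hg.2.2⟩
    · obtain ⟨s, hs, hg, y, hy, hn⟩ := not_fib hnfk
      have f := fib_z h1 h2 h3 hM hy
      rw [G] at hg hn
      refine ⟨(ph h1 h2 h3 s).1, (ph h1 h2 h3 s).2.1, (ph h1 h2 h3 s).2.2, (ph h1 h2 h3 y).2.2,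
        hg.1, hg.2.1, hg.2.2, f.2.2.trans hg.2.2, (mA s _ _ _ rfl).2 hs, ?_⟩
      rw [mA y _ _ _ (by rw [← f.1, ← f.2.1])]
      exact fun hh => hn ⟨hh, by rw [f.1]; exact hg.1, by rw [f.2.1]; exact hg.2.1, f.2.2.trans hg.2.2⟩
  have I : Ij (ll pi) (ll pj) (ll pk) (B.image (ph h1 h2 h3)) :=
    fun x y z x' y' z' a b c d e => S.inj a b c d e
  have sub : ∀ z b, z - b ∈ gridSet M x0 (pi * pj * pk) ↔ b ∈ gridSet M (z - x0) (pi * pj * pk) := by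
    intro z b
    simp only [gridSet, Set.mem_ofPred_eq]
    rw [← dvd_neg]
    have : -(z - b - x0) = b - (z - x0) := by ring
    rw [this]
  refine ⟨?_, ?_, ?_⟩
  · intro z
    obtain ⟨x, y, w, hb, e1, e2, e3⟩ := I.cov H (ph h1 h2 h3 (z - x0)).1 (ph h1 h2 h3 (z - x0)).2.1
      (ph h1 h2 h3 (z - x0)).2.2
    obtain ⟨b, hbB, hbe⟩ := Finset.mem_image.1 hb
    refine ⟨(z - b, b), ⟨?_, hbB, by simp⟩, ?_⟩
    · rw [sub, G, hbe]; exact ⟨e1, e2, e3⟩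
    · rintro ⟨a', b'⟩ ⟨ha, hb', hs⟩
      dsimp only at ha hb' hs
      have ea : a' = z - b' := by rw [← hs]; ring
      rw [ea, sub, G] at ha
      have hm : ph h1 h2 h3 b' ∈ B.image (ph h1 h2 h3) := Finset.mem_image_of_mem _ hb'
      have := I _ _ _ _ _ _ hm hb (ha.1.trans e1.symm) (ha.2.1.trans e2.symm) (ha.2.2.trans e3.symm)
      have hbb : b' = b := by
        apply inj
        rw [hbe]
        exact Prod.ext this.1 (Prod.ext this.2.1 this.2.2)
      rw [ea, hbb]
  · refine t2_of hM hpi hpj hpk hij hik hjk (v := 2) ?_ ?_ ?_ ?_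
    · intro e a b h
      interval_cases e
      · exact ((I.loA H).1 (C1 (by simp) (by simp) (by simp) h)).elim
      · rfl
    · intro e a b h
      interval_cases e
      · exact ((I.loA H).2.1 (C1 (by simp) (by simp) (by simp) h)).elim
      · rfl
    · intro e a b h
      interval_cases e
      · exact ((I.loA H).2.2 (C1 (by simp) (by simp) (by simp) h)).elim
      · rfl
    · intro e1 e2 e3 l1 l2 l3 h
      exact C2 (by omega) (by omega) (by omega) (I.hiA H c l1 l2 l3 h)
  · refine t2_of hM hpi hpj hpk hij hik hjk (v := 1) ?_ ?_ ?_ ?_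
    · intro e a b h
      interval_cases e
      · rfl
      · exact ((I.hiB H).1 (C1 (by simp) (by simp) (by simp) h)).elim
    · intro e a b h
      interval_cases e
      · rfl
      · exact ((I.hiB H).2.1 (C1 (by simp) (by simp) (by simp) h)).elim
    · intro e a b h
      interval_cases e
      · rfl
      · exact ((I.hiB H).2.2 (C1 (by simp) (by simp) (by simp) h)).elim
    · intro e1 e2 e3 l1 l2 l3 h
      exact C2 (by omega) (by omega) (by omega) (I.lowB H (by omega) (by omega) (by omega) h)
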